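/- Let 1 < p < 2, p ≤ q, assume (p−1)²(q−1) > 1, set κ₁ = p−1, κ₂ = q(p−1)−1, let a_j, ℓ, b_ℓ, the metric d = d₁ + d₂, the set D_ε, and the maps T^{(1)}(u₂) = w_{ℓ+1} + R(G(u₂, v_ℓ)), T^{(2)}(u₁) = v_{ℓ+1} + R(H(u₁, w_{ℓ+1})) be as in the context, with κ₁a_ℓ < 1, 0 < ε ≤ 1, f⃗₁ ∈ Y_{κ₁}(ε), f⃗₂ ∈ Y_{κ₂}(ε). Then for (u₁,u₂), (u₁*,u₂*) ∈ D_ε: d₁(T^{(1)}(u₂), w_{ℓ+1}) ≤ C ε^{(p−1)b_ℓ + (p−1)²}, d₂(T^{(2)}(u₁), v_{ℓ+1}) ≤ C ε^{(p−1)b_ℓ + (p−1)(q−1)}, d₁(T^{(1)}(u₂), T^{(1)}(u₂*)) ≤ C ε^{(p−1)²} d₂(u₂, u₂*), and d₂(T^{(2)}(u₁), T^{(2)}(u₁*)) ≤ C ε^{(p−1)(q−1)} d₁(u₁, u₁*), where C depends only on p and q. -/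

import Mathlib

open Real MeasureTheory Filter

noncomputable section

/-- Partial derivative with respect to the first (radial) variable. -/
def pdr (u : ℝ → ℝ → ℝ) : ℝ → ℝ → ℝ := fun r t => deriv (fun r' => u r' t) r

/-- Partial derivative with respect to the second (time) variable. -/
def pdt (u : ℝ → ℝ → ℝ) : ℝ → ℝ → ℝ := fun r t => deriv (fun t' => u r t') t

/-- `[u(r,t)]₁ = |u| + r (|∂_r u| + |∂_t u|)`. -/
def bracket1 (u : ℝ → ℝ → ℝ) (r t : ℝ) : ℝ :=
  |u r t| + r * (|pdr u r t| + |pdt u r t|)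

/-- `[u(r,t)]₂ = |u| + (1+r)(|∂_r u| + |∂_t u|) + r (|∂_r² u| + |∂_r∂_t u| + |∂_t² u|)`. -/
def bracket2 (u : ℝ → ℝ → ℝ) (r t : ℝ) : ℝ :=
  |u r t| + (1 + r) * (|pdr u r t| + |pdt u r t|) +
    r * (|pdr (pdr u) r t| + |pdr (pdt u) r t| + |pdt (pdt u) r t|)

def bracketS (s : ℕ) (u : ℝ → ℝ → ℝ) (r t : ℝ) : ℝ :=
  if s = 1 then bracket1 u r t else bracket2 u r t

/-- Membership in the class `X^s`: `u ∈ C^{s-1}(ℝ × [0,∞))`, `r u ∈ C^s(ℝ × [0,∞))`,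
and `u` is even in `r`. -/
def memX (s : ℕ) (u : ℝ → ℝ → ℝ) : Prop :=
  ContDiffOn ℝ ((s - 1 : ℕ) : ℕ∞) (fun z : ℝ × ℝ => u z.1 z.2) (Set.univ ×ˢ Set.Ici (0:ℝ)) ∧
  ContDiffOn ℝ ((s : ℕ) : ℕ∞) (fun z : ℝ × ℝ => z.1 * u z.1 z.2) (Set.univ ×ˢ Set.Ici (0:ℝ)) ∧
  ∀ r t : ℝ, 0 ≤ t → u (-r) t = u r t

/-- The set of values whose supremum is `‖u‖_{X^s(ν)}`. -/
def XSet (s : ℕ) (ν : ℝ) (u : ℝ → ℝ → ℝ) : Set ℝ :=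
  {x | ∃ r t : ℝ, 0 < r ∧ 0 ≤ t ∧ x = bracketS s u r t * (1 + |r - t|) ^ ν}

/-- `‖u‖_{X^s(ν)}`. -/
def Xnorm (s : ℕ) (ν : ℝ) (u : ℝ → ℝ → ℝ) : ℝ := sSup (XSet s ν u)

/-- `u ∈ X^s(ν)`. -/
def memXnu (s : ℕ) (ν : ℝ) (u : ℝ → ℝ → ℝ) : Prop := memX s u ∧ BddAbove (XSet s ν u)

/-- The set of values whose supremum is `‖u‖_{Z^s(ν)}`. -/
def ZSet (s : ℕ) (ν : ℝ) (u : ℝ → ℝ → ℝ) : Set ℝ :=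
  {x | ∃ r t : ℝ, 0 < r ∧ 0 ≤ t ∧
    x = bracketS s u r t * (1 + r + t) ^ (ν - 1) * (1 + |r - t|)}

/-- `‖u‖_{Z^s(ν)}`. -/
def Znorm (s : ℕ) (ν : ℝ) (u : ℝ → ℝ → ℝ) : ℝ := sSup (ZSet s ν u)

/-- `u ∈ Z^s(ν)`. -/
def memZnu (s : ℕ) (ν : ℝ) (u : ℝ → ℝ → ℝ) : Prop := memX s u ∧ BddAbove (ZSet s ν u)

/-- `|||f⃗(r)|||`. -/
def tripleNorm (f g : ℝ → ℝ) (r : ℝ) : ℝ :=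
  |f r| + (1 + r) * (|deriv f r| + |g r|) + r * (|deriv (deriv f) r| + |deriv g r|)

def tnorm (fg : (ℝ → ℝ) × (ℝ → ℝ)) (r : ℝ) : ℝ := tripleNorm fg.1 fg.2 r

/-- `f⃗ ∈ Y_ν(ε)`. -/
def memY (ν ε : ℝ) (fg : (ℝ → ℝ) × (ℝ → ℝ)) : Prop :=
  ContDiff ℝ 1 fg.1 ∧ Continuous fg.2 ∧
  (∀ r : ℝ, fg.1 (-r) = fg.1 r) ∧ (∀ r : ℝ, fg.2 (-r) = fg.2 r) ∧
  ContDiff ℝ 2 (fun r : ℝ => r * fg.1 r) ∧ ContDiff ℝ 1 (fun r : ℝ => r * fg.2 r) ∧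
  ∀ r : ℝ, 0 < r → (1 + r) ^ ν * tnorm fg r ≤ ε

/-- Solution operator `K[f⃗]` of the radial homogeneous wave equation. -/
def Kop (fg : (ℝ → ℝ) × (ℝ → ℝ)) : ℝ → ℝ → ℝ := fun r t =>
  (1 / (2 * r)) * ((∫ l in (r - t)..(r + t), l * fg.2 l) +
    deriv (fun s : ℝ => ∫ l in (r - s)..(r + s), l * fg.1 l) t)

/-- Duhamel operator `L(F)` for the initial value problem with zero data. -/
def Lop (F : ℝ → ℝ → ℝ) : ℝ → ℝ → ℝ := fun r t =>
  (1 / (2 * r)) * ∫ s in (0:ℝ)..t, (∫ l in (r - (t - s))..(r + (t - s)), l * F l s)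

/-- Operator `R(F)` associated with the final value problem. -/
def Rop (F : ℝ → ℝ → ℝ) : ℝ → ℝ → ℝ := fun r t =>
  (1 / (2 * r)) * ∫ s in Set.Ioi t, (∫ l in ((s - t) - r)..((s - t) + r), l * F l s)

/-- Values whose supremum is `M₀(F)`. -/
def M0Set (α β γ δ : ℝ) (F : ℝ → ℝ → ℝ) : Set ℝ :=
  {x | ∃ r t : ℝ, 0 < r ∧ 0 ≤ t ∧
    x = |F r t| * r ^ α * (1 + r) ^ β * (1 + r + t) ^ γ * (1 + |r - t|) ^ δ}

/-- Values whose supremum is the second summand of `M₁(F)`. -/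
def M1Set (α β γ δ : ℝ) (F : ℝ → ℝ → ℝ) : Set ℝ :=
  {x | ∃ r t : ℝ, 0 < r ∧ 0 ≤ t ∧
    x = |pdr F r t| * r ^ (α + 1) * (1 + r) ^ (β - 1) * (1 + r + t) ^ γ * (1 + |r - t|) ^ δ}

/-- `M_s(F)` for `s = 0, 1`. -/
def Mnorm (s : ℕ) (α β γ δ : ℝ) (F : ℝ → ℝ → ℝ) : ℝ :=
  if s = 0 then sSup (M0Set α β γ δ F)
  else sSup (M0Set α β γ δ F) + sSup (M1Set α β γ δ F)

/-- Finiteness of `M_s(F)`. -/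
def MFinite (s : ℕ) (α β γ δ : ℝ) (F : ℝ → ℝ → ℝ) : Prop :=
  BddAbove (M0Set α β γ δ F) ∧ (s = 0 ∨ BddAbove (M1Set α β γ δ F))

/-- Energy norm `‖w(t)‖_E` of the radial function `w(|x|,t)` on `ℝ³`. -/
def energy (w : ℝ → ℝ → ℝ) (t : ℝ) : ℝ :=
  Real.sqrt ((1 / 2) * ∫ x : EuclideanSpace ℝ (Fin 3),
    ((pdt w ‖x‖ t) ^ 2 + (pdr w ‖x‖ t) ^ 2))

/-- The nonlinearity `|∂_t u|^p`. -/
def NLt (p : ℝ) (u : ℝ → ℝ → ℝ) : ℝ → ℝ → ℝ := fun r t => |pdt u r t| ^ p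

/-- `(u₁,u₂)` solves the radially symmetric system (S). -/
def solvesS (p q : ℝ) (u₁ u₂ : ℝ → ℝ → ℝ) : Prop :=
  ∀ r t : ℝ, 0 < r → 0 ≤ t →
    pdt (pdt u₁) r t - (pdr (pdr u₁) r t + (2 / r) * pdr u₁ r t) = |pdt u₂ r t| ^ p ∧
    pdt (pdt u₂) r t - (pdr (pdr u₂) r t + (2 / r) * pdr u₂ r t) = |pdt u₁ r t| ^ q

/-- Initial data `(u(·,0), ∂_t u(·,0))` of a function `u(r,t)`. -/
def datum (u : ℝ → ℝ → ℝ) : (ℝ → ℝ) × (ℝ → ℝ) := (fun r => u r 0, fun r => pdt u r 0)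

/-- The sequence `a₀ = 1`, `a_{j+1} = κ₁ (a_j - 1) + κ₂`. -/
def aseq (κ₁ κ₂ : ℝ) : ℕ → ℝ
  | 0 => 1
  | n + 1 => κ₁ * (aseq κ₁ κ₂ n - 1) + κ₂

/-- Auxiliary iteration producing the pairs `((w_j, v_j), (w_{j+1}, v_{j+1}))`. -/
def iterAux (p q : ℝ) (fg1 fg2 : (ℝ → ℝ) × (ℝ → ℝ)) :
    ℕ → ((ℝ → ℝ → ℝ) × (ℝ → ℝ → ℝ)) × ((ℝ → ℝ → ℝ) × (ℝ → ℝ → ℝ))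
  | 0 =>
    ((Kop fg1, Kop fg2),
     (Kop fg1 + Lop (NLt p (Kop fg2)),
      Kop fg2 + Rop (NLt q (Kop fg1 + Lop (NLt p (Kop fg2))))))
  | n + 1 =>
    let prev := iterAux p q fg1 fg2 n
    let wnext := prev.2.1 + Lop (NLt p prev.2.2 - NLt p prev.1.2)
    (prev.2, (wnext, prev.2.2 + Rop (NLt q wnext - NLt q prev.2.1)))

/-- The iterate `w_j`. -/
def witer (p q : ℝ) (fg1 fg2 : (ℝ → ℝ) × (ℝ → ℝ)) (j : ℕ) : ℝ → ℝ → ℝ :=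
  (iterAux p q fg1 fg2 j).1.1

/-- The iterate `v_j`. -/
def viter (p q : ℝ) (fg1 fg2 : (ℝ → ℝ) × (ℝ → ℝ)) (j : ℕ) : ℝ → ℝ → ℝ :=
  (iterAux p q fg1 fg2 j).1.2

/-- The starred iterates `(w_j^*, v_j^*)` built from a solution `(u₁,u₂)`. -/
def starIter (p q : ℝ) (φ1 : (ℝ → ℝ) × (ℝ → ℝ)) (u₁ u₂ : ℝ → ℝ → ℝ) :
    ℕ → (ℝ → ℝ → ℝ) × (ℝ → ℝ → ℝ)
  | 0 => (Kop φ1, u₂ - Rop (NLt q u₁))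
  | n + 1 =>
    let w := Kop φ1 + Lop (NLt p (starIter p q φ1 u₁ u₂ n).2)
    (w, (u₂ - Rop (NLt q u₁)) + Rop (NLt q w))

/-- The quantity `d₁(w, 0) = ‖w‖_{Z²(κ₁ a_{ℓ+1})} + ‖w‖_{Z¹(κ₁ a_{ℓ+1})}^{p-1}` (applied to
differences). -/
def dOne (p q : ℝ) (ℓ : ℕ) (w : ℝ → ℝ → ℝ) : ℝ :=
  Znorm 2 ((p - 1) * aseq (p - 1) (q * (p - 1) - 1) (ℓ + 1)) w +
    Znorm 1 ((p - 1) * aseq (p - 1) (q * (p - 1) - 1) (ℓ + 1)) w ^ (p - 1)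

/-- The quantity `d₂(w, 0) = ‖w‖_{Z²(a_{ℓ+1})} + ‖w‖_{Z¹(a_{ℓ+1})}^{p-1}` (applied to
differences). -/
def dTwo (p q : ℝ) (ℓ : ℕ) (w : ℝ → ℝ → ℝ) : ℝ :=
  Znorm 2 (aseq (p - 1) (q * (p - 1) - 1) (ℓ + 1)) w +
    Znorm 1 (aseq (p - 1) (q * (p - 1) - 1) (ℓ + 1)) w ^ (p - 1)

/-- Membership in the metric ball `D_ε` around `(w_{ℓ+1}, v_{ℓ+1})`. -/
def memD (p q ε : ℝ) (ℓ : ℕ) (fg1 fg2 : (ℝ → ℝ) × (ℝ → ℝ)) (u₁ u₂ : ℝ → ℝ → ℝ) : Prop :=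
  memX 2 u₁ ∧ memX 2 u₂ ∧
  BddAbove (ZSet 2 ((p - 1) * aseq (p - 1) (q * (p - 1) - 1) (ℓ + 1))
    (u₁ - witer p q fg1 fg2 (ℓ + 1))) ∧
  BddAbove (ZSet 1 ((p - 1) * aseq (p - 1) (q * (p - 1) - 1) (ℓ + 1))
    (u₁ - witer p q fg1 fg2 (ℓ + 1))) ∧
  BddAbove (ZSet 2 (aseq (p - 1) (q * (p - 1) - 1) (ℓ + 1))
    (u₂ - viter p q fg1 fg2 (ℓ + 1))) ∧
  BddAbove (ZSet 1 (aseq (p - 1) (q * (p - 1) - 1) (ℓ + 1))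
    (u₂ - viter p q fg1 fg2 (ℓ + 1))) ∧
  dOne p q ℓ (u₁ - witer p q fg1 fg2 (ℓ + 1)) + dTwo p q ℓ (u₂ - viter p q fg1 fg2 (ℓ + 1))
    ≤ ε ^ ((p - 1) * (q + (ℓ : ℝ) * (p + q - 2)))


/-- Interior regularity class used for all functions in the iteration. -/
structure Reg (u : ℝ → ℝ → ℝ) : Prop where
  even : ∀ r t, 0 < t → u (-r) t = u r t
  dr : ∀ r t, 0 < r → 0 ≤ t → DifferentiableAt ℝ (fun r' => u r' t) r
  drr : ∀ r t, 0 < r → 0 ≤ t → DifferentiableAt ℝ (fun r' => pdr u r' t) r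
  dt : ∀ r t, 0 < r → 0 < t → DifferentiableAt ℝ (fun t' => u r t') t
  dtr : ∀ r t, 0 < r → 0 < t → DifferentiableAt ℝ (fun r' => pdt u r' t) r
  dtt : ∀ r t, 0 < r → 0 < t → DifferentiableAt ℝ (fun t' => pdt u r t') t
  ct : ContinuousOn (fun z : ℝ × ℝ => pdt u z.1 z.2) (Set.Ioi 0 ×ˢ Set.Ioi 0)

/-- The part of the brackets that only involves radial derivatives. -/
def rpart1 (u : ℝ → ℝ → ℝ) (r t : ℝ) : ℝ := |u r t| + r * |pdr u r t|

def rpart2 (u : ℝ → ℝ → ℝ) (r t : ℝ) : ℝ :=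
  |u r t| + (1 + r) * |pdr u r t| + r * |pdr (pdr u) r t|

lemma Reg.pdt_even {u} (hu : Reg u) (r t : ℝ) (ht : 0 < t) : pdt u (-r) t = pdt u r t := by
  unfold pdt
  apply Filter.EventuallyEq.deriv_eq
  filter_upwards [lt_mem_nhds ht] with s hs using hu.even r s hs

section addsub
variable {u v : ℝ → ℝ → ℝ} {r t : ℝ}

lemma pdr_add (hu : Reg u) (hv : Reg v) (hr : 0 < r) (ht : 0 ≤ t) :
    pdr (u + v) r t = pdr u r t + pdr v r t := by
  unfold pdr
  exact deriv_add (hu.dr r t hr ht) (hv.dr r t hr ht)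

lemma pdt_add (hu : Reg u) (hv : Reg v) (hr : 0 < r) (ht : 0 < t) :
    pdt (u + v) r t = pdt u r t + pdt v r t := by
  unfold pdt
  exact deriv_add (hu.dt r t hr ht) (hv.dt r t hr ht)

lemma pdr_add_ev (hu : Reg u) (hv : Reg v) (hr : 0 < r) (ht : 0 ≤ t) :
    (fun r' => pdr (u + v) r' t) =ᶠ[nhds r] (fun r' => pdr u r' t) + (fun r' => pdr v r' t) := by
  filter_upwards [lt_mem_nhds hr] with s hs using pdr_add hu hv hs ht

lemma pdt_add_ev (hu : Reg u) (hv : Reg v) (hr : 0 < r) (ht : 0 < t) :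
    (fun r' => pdt (u + v) r' t) =ᶠ[nhds r] (fun r' => pdt u r' t) + (fun r' => pdt v r' t) := by
  filter_upwards [lt_mem_nhds hr] with s hs using pdt_add hu hv hs ht

lemma pdt_add_ev' (hu : Reg u) (hv : Reg v) (hr : 0 < r) (ht : 0 < t) :
    (fun t' => pdt (u + v) r t') =ᶠ[nhds t] (fun t' => pdt u r t') + (fun t' => pdt v r t') := by
  filter_upwards [lt_mem_nhds ht] with s hs using pdt_add hu hv hr hs

lemma pdrr_add (hu : Reg u) (hv : Reg v) (hr : 0 < r) (ht : 0 ≤ t) :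
    pdr (pdr (u + v)) r t = pdr (pdr u) r t + pdr (pdr v) r t := by
  have h := (pdr_add_ev hu hv hr ht).deriv_eq
  rw [deriv_add (hu.drr r t hr ht) (hv.drr r t hr ht)] at h
  exact h

lemma pdrt_add (hu : Reg u) (hv : Reg v) (hr : 0 < r) (ht : 0 < t) :
    pdr (pdt (u + v)) r t = pdr (pdt u) r t + pdr (pdt v) r t := by
  have h := (pdt_add_ev hu hv hr ht).deriv_eq
  rw [deriv_add (hu.dtr r t hr ht) (hv.dtr r t hr ht)] at h
  exact h

lemma pdtt_add (hu : Reg u) (hv : Reg v) (hr : 0 < r) (ht : 0 < t) :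
    pdt (pdt (u + v)) r t = pdt (pdt u) r t + pdt (pdt v) r t := by
  have h := (pdt_add_ev' hu hv hr ht).deriv_eq
  rw [deriv_add (hu.dtt r t hr ht) (hv.dtt r t hr ht)] at h
  exact h

lemma Reg.add (hu : Reg u) (hv : Reg v) : Reg (u + v) where
  even r t ht := by simp [hu.even r t ht, hv.even r t ht]
  dr r t hr ht := (hu.dr r t hr ht).add (hv.dr r t hr ht)
  drr r t hr ht := ((hu.drr r t hr ht).add (hv.drr r t hr ht)).congr_of_eventuallyEq
    (pdr_add_ev hu hv hr ht)
  dt r t hr ht := (hu.dt r t hr ht).add (hv.dt r t hr ht)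
  dtr r t hr ht := ((hu.dtr r t hr ht).add (hv.dtr r t hr ht)).congr_of_eventuallyEq
    (pdt_add_ev hu hv hr ht)
  dtt r t hr ht := ((hu.dtt r t hr ht).add (hv.dtt r t hr ht)).congr_of_eventuallyEq
    (pdt_add_ev' hu hv hr ht)
  ct := (hu.ct.add hv.ct).congr (fun z hz => pdt_add hu hv hz.1 hz.2)

lemma pdr_neg (u : ℝ → ℝ → ℝ) : pdr (-u) = -pdr u := by
  funext r t; unfold pdr; exact deriv.neg

lemma pdt_neg (u : ℝ → ℝ → ℝ) : pdt (-u) = -pdt u := by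
  funext r t; unfold pdt; exact deriv.neg

lemma Reg.neg (hu : Reg u) : Reg (-u) where
  even r t ht := by simp [hu.even r t ht]
  dr r t hr ht := (hu.dr r t hr ht).neg
  drr r t hr ht := by rw [pdr_neg]; exact (hu.drr r t hr ht).neg
  dt r t hr ht := (hu.dt r t hr ht).neg
  dtr r t hr ht := by rw [pdt_neg]; exact (hu.dtr r t hr ht).neg
  dtt r t hr ht := by rw [pdt_neg]; exact (hu.dtt r t hr ht).neg
  ct := by rw [pdt_neg]; exact hu.ct.neg

lemma Reg.sub (hu : Reg u) (hv : Reg v) : Reg (u - v) := by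
  rw [sub_eq_add_neg]; exact hu.add hv.neg

lemma bracket1_neg : bracket1 (-u) r t = bracket1 u r t := by
  simp [bracket1, pdr_neg, pdt_neg]

lemma bracket2_neg : bracket2 (-u) r t = bracket2 u r t := by
  simp [bracket2, pdr_neg, pdt_neg]

lemma rpart1_neg : rpart1 (-u) r t = rpart1 u r t := by
  simp [rpart1, pdr_neg]

lemma rpart2_neg : rpart2 (-u) r t = rpart2 u r t := by
  simp [rpart2, pdr_neg]

lemma bracket1_add (hu : Reg u) (hv : Reg v) (hr : 0 < r) (ht : 0 < t) :
    bracket1 (u + v) r t ≤ bracket1 u r t + bracket1 v r t := by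
  unfold bracket1
  rw [pdr_add hu hv hr ht.le, pdt_add hu hv hr ht]
  have h1 := abs_add_le (u r t) (v r t)
  have h2 := mul_le_mul_of_nonneg_left (abs_add_le (pdr u r t) (pdr v r t)) hr.le
  have h3 := mul_le_mul_of_nonneg_left (abs_add_le (pdt u r t) (pdt v r t)) hr.le
  simp only [Pi.add_apply]
  linarith

lemma bracket2_add (hu : Reg u) (hv : Reg v) (hr : 0 < r) (ht : 0 < t) :
    bracket2 (u + v) r t ≤ bracket2 u r t + bracket2 v r t := by
  unfold bracket2
  rw [pdr_add hu hv hr ht.le, pdt_add hu hv hr ht, pdrr_add hu hv hr ht.le,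
    pdrt_add hu hv hr ht, pdtt_add hu hv hr ht]
  have hr1 : 0 ≤ 1 + r := by linarith
  have h1 := abs_add_le (u r t) (v r t)
  have h2 := mul_le_mul_of_nonneg_left (abs_add_le (pdr u r t) (pdr v r t)) hr1
  have h3 := mul_le_mul_of_nonneg_left (abs_add_le (pdt u r t) (pdt v r t)) hr1
  have h4 := mul_le_mul_of_nonneg_left (abs_add_le (pdr (pdr u) r t) (pdr (pdr v) r t)) hr.le
  have h5 := mul_le_mul_of_nonneg_left (abs_add_le (pdr (pdt u) r t) (pdr (pdt v) r t)) hr.le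
  have h6 := mul_le_mul_of_nonneg_left (abs_add_le (pdt (pdt u) r t) (pdt (pdt v) r t)) hr.le
  simp only [Pi.add_apply]
  linarith

lemma rpart1_add (hu : Reg u) (hv : Reg v) (hr : 0 < r) (ht : 0 ≤ t) :
    rpart1 (u + v) r t ≤ rpart1 u r t + rpart1 v r t := by
  unfold rpart1
  rw [pdr_add hu hv hr ht]
  have h1 := abs_add_le (u r t) (v r t)
  have h2 := mul_le_mul_of_nonneg_left (abs_add_le (pdr u r t) (pdr v r t)) hr.le
  simp only [Pi.add_apply]
  linarith

lemma rpart2_add (hu : Reg u) (hv : Reg v) (hr : 0 < r) (ht : 0 ≤ t) :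
    rpart2 (u + v) r t ≤ rpart2 u r t + rpart2 v r t := by
  unfold rpart2
  rw [pdr_add hu hv hr ht, pdrr_add hu hv hr ht]
  have hr1 : 0 ≤ 1 + r := by linarith
  have h1 := abs_add_le (u r t) (v r t)
  have h2 := mul_le_mul_of_nonneg_left (abs_add_le (pdr u r t) (pdr v r t)) hr1
  have h4 := mul_le_mul_of_nonneg_left (abs_add_le (pdr (pdr u) r t) (pdr (pdr v) r t)) hr.le
  simp only [Pi.add_apply]
  linarith

lemma bracket1_nonneg (hr : 0 < r) : 0 ≤ bracket1 u r t := by unfold bracket1; positivity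
lemma bracket2_nonneg (hr : 0 < r) : 0 ≤ bracket2 u r t := by unfold bracket2; positivity

lemma rpart1_le (hr : 0 < r) : rpart1 u r t ≤ bracket1 u r t := by
  unfold rpart1 bracket1
  have : 0 ≤ r * |pdt u r t| := by positivity
  linarith

lemma rpart2_le (hr : 0 < r) : rpart2 u r t ≤ bracket2 u r t := by
  unfold rpart2 bracket2
  have h1 : 0 ≤ (1 + r) * |pdt u r t| := by positivity
  have h2 : 0 ≤ r * |pdr (pdt u) r t| := by positivity
  have h3 : 0 ≤ r * |pdt (pdt u) r t| := by positivity
  linarith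

lemma bracket1_le_bracket2 (hr : 0 < r) : bracket1 u r t ≤ bracket2 u r t := by
  unfold bracket1 bracket2
  have h1 : 0 ≤ |pdr u r t| + |pdt u r t| := by positivity
  have h2 : 0 ≤ r * (|pdr (pdr u) r t| + |pdr (pdt u) r t| + |pdt (pdt u) r t|) := by positivity
  linarith
end addsub

/-- At `t = 0` the two-sided derivative (or its junk value) is controlled by interior values. -/
lemma abs_deriv_zero_le {f : ℝ → ℝ} {δ M : ℝ} (hδ : 0 < δ)
    (hd : ∀ t, 0 < t → t < δ → DifferentiableAt ℝ f t)
    (hM : ∀ t, 0 < t → t < δ → |deriv f t| ≤ M) : |deriv f 0| ≤ M := by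
  have hM0 : 0 ≤ M := (abs_nonneg _).trans (hM (δ/2) (by linarith) (by linarith))
  by_cases h : DifferentiableAt ℝ f 0
  · have h1 := h.hasDerivAt.tendsto_slope_zero_right
    refine le_of_tendsto h1.abs ?_
    have : Set.Ioo (0:ℝ) δ ∈ nhdsWithin (0:ℝ) (Set.Ioi 0) := Ioo_mem_nhdsGT hδ
    filter_upwards [this] with t ht
    obtain ⟨c, hc, hc'⟩ := exists_deriv_eq_slope f ht.1
      (fun x hx => by
        rcases eq_or_lt_of_le hx.1 with h0 | h0
        · rw [← h0]; exact h.continuousAt.continuousWithinAt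
        · exact (hd x h0 (hx.2.trans_lt ht.2)).continuousAt.continuousWithinAt)
      (fun x hx => (hd x hx.1 (hx.2.trans ht.2)).differentiableWithinAt)
    have := hM c hc.1 (hc.2.trans ht.2)
    rw [hc'] at this
    simpa [div_eq_inv_mul] using this
  · rw [deriv_zero_of_not_differentiableAt h]; simpa using hM0

lemma abs_deriv_le_of_dich {g gp : ℝ → ℝ} {r δ L : ℝ} (hδ : 0 < δ) (hL : 0 ≤ L)
    (hg : ∀ x, |x - r| < δ → g x = gp x ∨ g x = 0)
    (hlip : ∀ x, |x - r| < δ → |gp x - gp r| ≤ L * |x - r|) : |deriv g r| ≤ L := by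
  by_cases h : DifferentiableAt ℝ g r
  swap
  · rw [deriv_zero_of_not_differentiableAt h]; simpa using hL
  have hball : ∀ᶠ x in nhds r, |x - r| < δ := by
    have := Metric.ball_mem_nhds r hδ
    filter_upwards [this] with x hx using by simpa [Real.dist_eq] using hx
  have hgpc : ContinuousAt gp r := by
    rw [Metric.continuousAt_iff]
    intro ε hε
    refine ⟨min δ (ε / (L + 1)), by positivity, fun x hx => ?_⟩
    rw [Real.dist_eq] at hx ⊢
    have h1 := hlip x (hx.trans_le (min_le_left _ _))
    have h2 := hx.trans_le (min_le_right _ _)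
    rw [lt_div_iff₀ (by positivity)] at h2
    nlinarith [abs_nonneg (x - r)]
  have key : ∀ᶠ x in nhds r, |g x - g r| ≤ L * |x - r| := by
    by_cases h0 : g r = 0
    · by_cases h1 : gp r = 0
      · filter_upwards [hball] with x hx
        rcases hg x hx with h2 | h2
        · have := hlip x hx; rw [h2, h0]; rwa [h1] at this
        · rw [h2, h0]; simp only [sub_self, abs_zero]; positivity
      · have hc := (h.continuousAt.sub hgpc)
        have hne : ∀ᶠ x in nhds r, g x - gp x ≠ 0 := by
          refine hc.eventually_ne ?_
          simpa [h0] using h1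
        filter_upwards [hball, hne] with x hx hx2
        rcases hg x hx with h2 | h2
        · exact absurd (sub_eq_zero.2 h2) hx2
        · rw [h2, h0]; simp only [sub_self, abs_zero]; positivity
    · have hne := h.continuousAt.eventually_ne h0
      filter_upwards [hball, hne] with x hx hx2
      have e1 : g x = gp x := (hg x hx).resolve_right hx2
      have e2 : g r = gp r := (hg r (by simpa using hδ)).resolve_right h0
      rw [e1, e2]; exact hlip x hx
  have := h.hasDerivAt.le_of_lip' hL (by simpa [Real.norm_eq_abs] using key)
  simpa [Real.norm_eq_abs] using this

/-- Passing to the limit `t → 0+` in the mixed derivative. -/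
lemma abs_pdr_pdt_zero_le {u : ℝ → ℝ → ℝ} (hu : Reg u) {r δ L K : ℝ} (hδ : 0 < δ) (hδr : δ < r)
    (hL : ∀ x t, |x - r| < δ → 0 < t → t < δ → |pdr (pdt u) x t| ≤ L)
    (hK : ∀ x t, |x - r| < δ → 0 < t → t < δ → |pdt (pdt u) x t| ≤ K) :
    |pdr (pdt u) r 0| ≤ L := by
  have hL0 : 0 ≤ L := (abs_nonneg _).trans (hL r (δ/2) (by simpa using hδ) (by linarith) (by linarith))
  have hK0 : 0 ≤ K := (abs_nonneg _).trans (hK r (δ/2) (by simpa using hδ) (by linarith) (by linarith))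
  have hpos : ∀ x, |x - r| < δ → 0 < x := fun x hx => by
    have := (abs_lt.1 hx).1; linarith
  -- Lipschitz in time
  have hlipt : ∀ x, |x - r| < δ → ∀ s ∈ Set.Ioo (0:ℝ) δ, ∀ t ∈ Set.Ioo (0:ℝ) δ,
      |pdt u x t - pdt u x s| ≤ K * |t - s| := by
    intro x hx s hs t ht
    exact (convex_Ioo (0:ℝ) δ).norm_image_sub_le_of_norm_deriv_le
      (f := fun t' => pdt u x t')
      (fun y hy => hu.dtt x y (hpos x hx) hy.1)
      (fun y hy => hK x y hx hy.1 hy.2) hs ht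
  have hlim : ∀ x, |x - r| < δ → ∃ l, Tendsto (fun t => pdt u x t) (nhdsWithin 0 (Set.Ioi 0)) (nhds l) := by
    intro x hx
    have hc : Cauchy (Filter.map (fun t => pdt u x t) (nhdsWithin (0:ℝ) (Set.Ioi 0))) := by
      rw [Metric.cauchy_iff]
      refine ⟨inferInstance, fun ε hε => ?_⟩
      have hm : 0 < min δ (ε / (K + 1)) := by positivity
      refine ⟨Set.image (fun t => pdt u x t) (Set.Ioo 0 (min δ (ε / (K+1)))),
        image_mem_map (Ioo_mem_nhdsGT hm), ?_⟩
      rintro _ ⟨s, hs, rfl⟩ _ ⟨t, ht, rfl⟩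
      rw [Real.dist_eq]
      have h1 := hlipt x hx t ⟨ht.1, ht.2.trans_le (min_le_left _ _)⟩ s ⟨hs.1, hs.2.trans_le (min_le_left _ _)⟩
      have h2 : |s - t| < ε / (K+1) := by
        have := hs.2.trans_le (min_le_right _ _)
        have := ht.2.trans_le (min_le_right _ _)
        rw [abs_lt]; constructor <;> linarith [hs.1, ht.1]
      rw [lt_div_iff₀ (by positivity)] at h2
      nlinarith [abs_nonneg (s - t)]
    exact CompleteSpace.complete hc
  choose! gp hgp using hlim
  refine abs_deriv_le_of_dich (g := fun x => pdt u x 0) (gp := gp) hδ hL0 ?_ ?_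
  · intro x hx
    by_cases h : DifferentiableAt ℝ (fun t' => u x t') 0
    · left
      have h1 := h.hasDerivAt.tendsto_slope_zero_right
      refine tendsto_nhds_unique h1 ?_
      -- slopes are values of pdt at intermediate points
      have hev : ∀ᶠ t in nhdsWithin (0:ℝ) (Set.Ioi 0), ∃ c ∈ Set.Ioo 0 t,
          pdt u x c = t⁻¹ • (u x (0 + t) - u x 0) := by
        filter_upwards [Ioo_mem_nhdsGT hδ] with t ht
        obtain ⟨c, hc, hc'⟩ := exists_deriv_eq_slope (fun t' => u x t') ht.1
          (fun y hy => by
            rcases eq_or_lt_of_le hy.1 with h0 | h0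
            · rw [← h0]; exact h.continuousAt.continuousWithinAt
            · exact (hu.dt x y (hpos x hx) h0).continuousAt.continuousWithinAt)
          (fun y hy => (hu.dt x y (hpos x hx) hy.1).differentiableWithinAt)
        refine ⟨c, hc, ?_⟩
        unfold pdt
        rw [hc']; simp [div_eq_inv_mul]
      rw [Metric.tendsto_nhds]
      intro ε hε
      have h2 := (Metric.tendsto_nhds.1 (hgp x hx)) ε hε
      obtain ⟨η, hη, hη2⟩ := (mem_nhdsGT_iff_exists_Ioo_subset).1 h2
      filter_upwards [hev, Ioo_mem_nhdsGT hη] with t ht ht2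
      obtain ⟨c, hc, hc'⟩ := ht
      rw [← hc']
      exact hη2 ⟨hc.1, hc.2.trans ht2.2⟩
    · right
      exact deriv_zero_of_not_differentiableAt h
  · intro x hx
    have h1 := ((hgp x hx).sub (hgp r (by simpa using hδ))).abs
    refine le_of_tendsto h1 ?_
    filter_upwards [Ioo_mem_nhdsGT hδ] with t ht
    have hball : ∀ y, y ∈ Metric.ball r δ ↔ |y - r| < δ := fun y => by
      rw [Metric.mem_ball, Real.dist_eq]
    exact (convex_ball r δ).norm_image_sub_le_of_norm_deriv_le
      (f := fun r' => pdt u r' t)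
      (fun y hy => hu.dtr y t (hpos y ((hball y).1 hy)) ht.1)
      (fun y hy => hL y t ((hball y).1 hy) ht.1 ht.2) ((hball r).2 (by simpa using hδ)) ((hball x).2 hx)


/-- d'Alembert structure: `Q` is transported along characteristics with source `h`. -/
structure QD (h Q Qc : ℝ → ℝ → ℝ) : Prop where
  hodd : ∀ x s, 0 < s → h (-x) s = - h x s
  hcont : ContinuousOn (fun z : ℝ × ℝ => h z.1 z.2) (Set.univ ×ˢ Set.Ioi 0)
  hbd : ∃ M, ∀ x s, 0 < s → |h x s| ≤ M
  dQ : ∀ c t, 0 ≤ t → HasDerivAt (fun c => Q c t) (Qc c t) c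
  bQc : ∀ T, ∃ L, ∀ c t, 0 ≤ t → t ≤ T → |Qc c t| ≤ L
  step : ∀ c t t₀, 0 ≤ t → 0 ≤ t₀ → Q c t - Q c t₀ = -∫ s in t₀..t, h (s + c) s

def UQ (Q : ℝ → ℝ → ℝ) (r t : ℝ) : ℝ := (1/2) * ∫ x in (-r)..r, Q (x - t) t

section QDsec
variable {h Q Qc : ℝ → ℝ → ℝ}

lemma QD.contc (H : QD h Q Qc) {t : ℝ} (ht : 0 ≤ t) : Continuous (fun c => Q c t) :=
  continuous_iff_continuousAt.2 fun c => (H.dQ c t ht).continuousAt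

lemma QD.contshift (H : QD h Q Qc) {t : ℝ} (ht : 0 ≤ t) : Continuous (fun x => Q (x - t) t) :=
  (H.contc ht).comp (continuous_id.sub continuous_const)

lemma QD.U_r (H : QD h Q Qc) (r : ℝ) {t : ℝ} (ht : 0 ≤ t) :
    HasDerivAt (fun r => UQ Q r t) ((1/2) * (Q (r - t) t + Q (-r - t) t)) r := by
  have hc := H.contshift ht
  have h0 : ∀ r : ℝ, HasDerivAt (fun r => ∫ x in (0:ℝ)..r, Q (x - t) t) (Q (r - t) t) r := fun r =>
    intervalIntegral.integral_hasDerivAt_right (hc.intervalIntegrable _ _)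
      (hc.stronglyMeasurableAtFilter _ _) hc.continuousAt
  have h1 : HasDerivAt (fun r => ∫ x in (0:ℝ)..(-r), Q (x - t) t) (Q (-r - t) t * (-1)) r :=
    (h0 (-r)).comp r (hasDerivAt_neg r)
  have h2 := ((h0 r).sub h1).const_mul (1/2 : ℝ)
  refine (h2.congr_of_eventuallyEq ?_).congr_deriv ?_
  · filter_upwards with r
    simp only [UQ, Pi.sub_apply]
    rw [intervalIntegral.integral_interval_sub_left (hc.intervalIntegrable _ _)
      (hc.intervalIntegrable _ _)]
  · ring

lemma QD.dshift_m (H : QD h Q Qc) (r : ℝ) {t : ℝ} (ht : 0 ≤ t) :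
    HasDerivAt (fun r => Q (-r - t) t) (-Qc (-r - t) t) r := by
  have := (H.dQ (-r - t) t ht).comp r ((hasDerivAt_neg r).sub_const t)
  exact this.congr_deriv (by ring)

lemma QD.dshift_p (H : QD h Q Qc) (r : ℝ) {t : ℝ} (ht : 0 ≤ t) :
    HasDerivAt (fun r => Q (r - t) t) (Qc (r - t) t) r := by
  have := (H.dQ (r - t) t ht).comp r ((hasDerivAt_id r).sub_const t)
  exact this.congr_deriv (by ring)

lemma QD.U_rr (H : QD h Q Qc) (r : ℝ) {t : ℝ} (ht : 0 ≤ t) :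
    HasDerivAt (fun r => (1/2) * (Q (r - t) t + Q (-r - t) t))
      ((1/2) * (Qc (r - t) t - Qc (-r - t) t)) r := by
  have := ((H.dshift_p r ht).add (H.dshift_m r ht)).const_mul (1/2 : ℝ)
  rw [← sub_eq_add_neg] at this
  exact this

lemma QD.U_tr (H : QD h Q Qc) (r : ℝ) {t : ℝ} (ht : 0 ≤ t) :
    HasDerivAt (fun r => (1/2) * (Q (-r - t) t - Q (r - t) t))
      (-(1/2) * (Qc (-r - t) t + Qc (r - t) t)) r := by
  have := ((H.dshift_m r ht).sub (H.dshift_p r ht)).const_mul (1/2 : ℝ)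
  refine this.congr_deriv ?_
  ring

lemma QD.hcontAt (H : QD h Q Qc) (x : ℝ) {t : ℝ} (ht : 0 < t) :
    ContinuousAt (fun z : ℝ × ℝ => h z.1 z.2) (x, t) :=
  H.hcont.continuousAt (prod_mem_nhds univ_mem (Ioi_mem_nhds ht))

lemma QD.hcontx (H : QD h Q Qc) {t : ℝ} (ht : 0 < t) : Continuous (fun x => h x t) :=
  continuous_iff_continuousAt.2 fun x =>
    (H.hcontAt x ht).comp (f := fun x : ℝ => (x, t)) (by fun_prop)

lemma QD.dtQ (H : QD h Q Qc) (x : ℝ) {t : ℝ} (ht : 0 < t) :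
    HasDerivAt (fun t => Q (x - t) t) (-Qc (x - t) t - h x t) t := by
  have h1 : HasDerivAt (fun τ => Q (x - τ) t) (-Qc (x - t) t) t := by
    have := (H.dQ (x - t) t ht.le).comp t ((hasDerivAt_id t).const_sub x)
    exact this.congr_deriv (by ring)
  have h2 : HasDerivAt (fun τ => Q (x - τ) τ - Q (x - τ) t) (-h x t) t := by
    rw [hasDerivAt_iff_isLittleO]
    rw [Asymptotics.isLittleO_iff]
    intro c hc
    have hca := Metric.continuousAt_iff.1 (H.hcontAt x ht) c hc
    obtain ⟨δ, hδ, hb⟩ := hca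
    have hmem : Metric.ball t (min (δ/2) t) ∈ nhds t :=
      Metric.ball_mem_nhds t (by positivity)
    filter_upwards [hmem] with τ hτ
    rw [Metric.mem_ball, Real.dist_eq] at hτ
    have hτ1 : |τ - t| < δ/2 := lt_of_lt_of_le hτ (min_le_left _ _)
    have hτ2 : |τ - t| < t := lt_of_lt_of_le hτ (min_le_right _ _)
    have hτ0 : 0 < τ := by have := (abs_lt.1 hτ2).1; linarith
    rw [H.step (x - τ) τ t hτ0.le ht.le]
    have e : -(∫ s in t..τ, h (s + (x - τ)) s) - (Q (x - t) t - Q (x - t) t) - (τ - t) • -h x t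
        = -(∫ s in t..τ, (h (s + (x - τ)) s - h x t)) := by
      rw [intervalIntegral.integral_sub, intervalIntegral.integral_const]
      · simp only [smul_eq_mul]; ring
      · apply ContinuousOn.intervalIntegrable
        intro s hs
        have hs0 : 0 < s := by
          rcases Set.mem_uIcc.1 hs with h' | h' <;> linarith [h'.1]
        exact ((H.hcontAt (s + (x - τ)) hs0).comp (f := fun s : ℝ => (s + (x - τ), s))
          (by fun_prop)).continuousWithinAt
      · exact intervalIntegrable_const
    rw [e, norm_neg, Real.norm_eq_abs (τ - t)]
    have hbound := intervalIntegral.norm_integral_le_of_norm_le_const (a := t) (b := τ) (C := c)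
      (f := fun s => h (s + (x - τ)) s - h x t) ?_
    · exact hbound
    · intro s hs
      have hs' : |s - t| ≤ |τ - t| ∧ |s - τ| ≤ |τ - t| := by
        rcases Set.mem_uIoc.1 hs with h' | h'
        · constructor
          · rw [abs_of_nonneg (by linarith), abs_of_nonneg (by linarith)]; linarith
          · rw [abs_of_nonpos (by linarith), abs_of_nonneg (by linarith)]; linarith
        · constructor
          · rw [abs_of_nonpos (by linarith), abs_of_nonpos (by linarith)]; linarith
          · rw [abs_of_nonneg (by linarith), abs_of_nonpos (by linarith)]; linarith
      have := @hb (s + (x - τ), s) (by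
        rw [Prod.dist_eq, Real.dist_eq, Real.dist_eq]
        refine max_lt ?_ ?_
        · have : s + (x - τ) - x = s - τ := by ring
          simp only [this]; linarith [hs'.2]
        · simp only; linarith [hs'.1])
      rw [Real.dist_eq] at this
      exact this.le
  have := h1.add h2
  refine (this.congr_of_eventuallyEq ?_).congr_deriv ?_
  · filter_upwards with τ; simp
  · ring

lemma QD.hodd_int (H : QD h Q Qc) (r : ℝ) {t : ℝ} (ht : 0 < t) : ∫ x in (-r)..r, h x t = 0 := by
  have h1 : ∫ x in (-r)..r, h (-x) t = ∫ x in (-r)..r, h x t := by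
    rw [intervalIntegral.integral_comp_neg (fun x => h x t)]; simp
  have h2 : ∫ x in (-r)..r, h (-x) t = -∫ x in (-r)..r, h x t := by
    rw [← intervalIntegral.integral_neg]
    refine intervalIntegral.integral_congr fun x _ => H.hodd x t ht
  linarith

lemma QD.U_t (H : QD h Q Qc) (r : ℝ) {t : ℝ} (ht : 0 < t) :
    HasDerivAt (fun t => UQ Q r t) ((1/2) * (Q (-r - t) t - Q (r - t) t)) t := by
  obtain ⟨M, hM⟩ := H.hbd
  obtain ⟨L, hL⟩ := H.bQc (2*t)
  have hmeasQc : Measurable (fun x => Qc (x - t) t) := by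
    have : (fun x => Qc (x - t) t) = fun x => deriv (fun c => Q c t) (x - t) := by
      funext x; exact (H.dQ (x - t) t ht.le).deriv.symm
    rw [this]
    exact (measurable_deriv _).comp (measurable_id.sub_const t)
  have key := intervalIntegral.hasDerivAt_integral_of_dominated_loc_of_deriv_le
    (μ := volume) (F := fun t x => Q (x - t) t) (F' := fun t x => -Qc (x - t) t - h x t) (x₀ := t)
    (s := Metric.ball t t) (a := -r) (b := r) (bound := fun _ => L + M)
    (Metric.ball_mem_nhds t ht) ?_ ?_ ?_ ?_ ?_ ?_
  · have hintgr : ∫ x in (-r)..r, (-Qc (x - t) t - h x t) = Q (-r - t) t - Q (r - t) t := by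
      have i1 : IntervalIntegrable (fun x => Qc (x - t) t) volume (-r) r := by
        apply (intervalIntegrable_const (c := L)).mono_fun
        · exact hmeasQc.aestronglyMeasurable
        · filter_upwards with x
          rw [Real.norm_eq_abs]
          exact (hL _ _ ht.le (by linarith)).trans (le_abs_self _)
      have i2 : IntervalIntegrable (fun x => h x t) volume (-r) r :=
        (H.hcontx ht).intervalIntegrable _ _
      rw [intervalIntegral.integral_sub (f := fun x => -Qc (x - t) t) i1.neg i2, H.hodd_int r ht, intervalIntegral.integral_neg,
        intervalIntegral.integral_eq_sub_of_hasDerivAt (f := fun x => Q (x - t) t)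
          (fun x _ => H.dshift_p x ht.le) i1]
      ring
    have := key.2.const_mul (1/2 : ℝ)
    rw [hintgr] at this
    exact this
  · filter_upwards [lt_mem_nhds ht] with τ hτ
    exact (H.contshift hτ.le).aestronglyMeasurable
  · exact (H.contshift ht.le).intervalIntegrable _ _
  · exact (hmeasQc.neg.aestronglyMeasurable.sub (H.hcontx ht).aestronglyMeasurable)
  · filter_upwards with x _ τ hτ
    rw [Metric.mem_ball, Real.dist_eq, abs_lt] at hτ
    have a1 := hL (x - τ) τ (by linarith) (by linarith)
    have a2 := hM x τ (by linarith)
    rw [Real.norm_eq_abs]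
    calc |-Qc (x - τ) τ - h x τ| ≤ |-Qc (x - τ) τ| + |h x τ| := abs_sub _ _
      _ ≤ L + M := by rw [abs_neg]; linarith
  · exact intervalIntegrable_const
  · filter_upwards with x _ τ hτ
    rw [Metric.mem_ball, Real.dist_eq, abs_lt] at hτ
    exact H.dtQ x (by linarith)

lemma QD.U_tt (H : QD h Q Qc) (r : ℝ) {t : ℝ} (ht : 0 < t) :
    HasDerivAt (fun t => (1/2) * (Q (-r - t) t - Q (r - t) t))
      ((1/2) * (Qc (r - t) t - Qc (-r - t) t) + h r t) t := by
  have := ((H.dtQ (-r) ht).sub (H.dtQ r ht)).const_mul (1/2 : ℝ)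
  refine this.congr_deriv ?_
  rw [H.hodd r t ht]; ring

lemma QD.joint (H : QD h Q Qc) (T : ℝ) : ∃ L, 0 ≤ L ∧ ∀ c c' t t', 0 ≤ t → 0 ≤ t' → t ≤ T → t' ≤ T →
    |Q c t - Q c' t'| ≤ L * (|c - c'| + |t - t'|) := by
  obtain ⟨M, hM⟩ := H.hbd
  obtain ⟨L, hL⟩ := H.bQc T
  refine ⟨|L| + |M|, by positivity, fun c c' t t' ht ht' hT hT' => ?_⟩
  have h1 : |Q c t - Q c' t| ≤ |L| * |c - c'| := by
    have := Convex.norm_image_sub_le_of_norm_hasDerivWithin_le (f := fun c => Q c t)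
      (f' := fun c => Qc c t) (C := |L|) (s := Set.univ) (x := c') (y := c)
      (fun x _ => (H.dQ x t ht).hasDerivWithinAt)
      (fun x _ => (hL x t ht hT).trans (le_abs_self _)) convex_univ trivial trivial
    simpa [Real.norm_eq_abs] using this
  have h2 : |Q c' t - Q c' t'| ≤ |M| * |t - t'| := by
    rw [H.step c' t t' ht ht', abs_neg]
    refine intervalIntegral.norm_integral_le_of_norm_le_const (f := fun s => h (s + c') s) fun s hs => ?_
    have hs0 : 0 < s := by
      rcases Set.mem_uIoc.1 hs with h' | h' <;> linarith [h'.1]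
    exact (hM _ s hs0).trans (le_abs_self _)
  have h3 := abs_sub_le (Q c t) (Q c' t) (Q c' t')
  nlinarith [abs_nonneg L, abs_nonneg M, abs_nonneg (c - c'), abs_nonneg (t - t'),
    mul_nonneg (abs_nonneg L) (abs_nonneg (t - t')), mul_nonneg (abs_nonneg M) (abs_nonneg (c-c'))]

lemma QD.contQ (H : QD h Q Qc) : ContinuousOn (fun z : ℝ × ℝ => Q z.1 z.2) (Set.univ ×ˢ Set.Ioi 0) := by
  rintro ⟨c, t⟩ hz
  have ht : 0 < t := hz.2
  apply ContinuousAt.continuousWithinAt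
  obtain ⟨L, hL0, hL⟩ := H.joint (t + 1)
  rw [ContinuousAt, tendsto_iff_dist_tendsto_zero]
  have hlim : Tendsto (fun z : ℝ × ℝ => L * (|z.1 - c| + |z.2 - t|)) (nhds (c, t)) (nhds 0) := by
    have : Continuous (fun z : ℝ × ℝ => L * (|z.1 - c| + |z.2 - t|)) := by fun_prop
    have := this.tendsto (c, t)
    simpa using this
  refine squeeze_zero' (Eventually.of_forall fun _ => dist_nonneg) ?_ hlim
  have hmem : (Set.univ ×ˢ Set.Ioo 0 (t+1) : Set (ℝ × ℝ)) ∈ nhds (c, t) :=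
    prod_mem_nhds univ_mem (Ioo_mem_nhds ht (by linarith))
  filter_upwards [hmem] with z hz
  exact hL z.1 c z.2 t hz.2.1.le ht.le hz.2.2.le (by linarith)

end QDsec


section URsec
variable {h Q Qc u : ℝ → ℝ → ℝ}

/-- `u = U/r`. -/
structure UR (Q u : ℝ → ℝ → ℝ) : Prop where
  eq : ∀ r t, 0 < r → 0 ≤ t → u r t = UQ Q r t / r
  even : ∀ r t, 0 < t → u (-r) t = u r t

lemma UR.h_dr (E : UR Q u) (H : QD h Q Qc) {r t : ℝ} (hr : 0 < r) (ht : 0 ≤ t) :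
    HasDerivAt (fun r' => u r' t) (((1/2) * (Q (r - t) t + Q (-r - t) t) * r - UQ Q r t) / r^2) r := by
  have := (H.U_r r ht).div (hasDerivAt_id r) hr.ne'
  refine (this.congr_of_eventuallyEq ?_).congr_deriv ?_
  · filter_upwards [lt_mem_nhds hr] with x hx using E.eq x t hx ht
  · simp

lemma UR.pdr_eq (E : UR Q u) (H : QD h Q Qc) {r t : ℝ} (hr : 0 < r) (ht : 0 ≤ t) :
    pdr u r t = ((1/2) * (Q (r - t) t + Q (-r - t) t) * r - UQ Q r t) / r^2 :=
  (E.h_dr H hr ht).deriv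

lemma UR.h_drr (E : UR Q u) (H : QD h Q Qc) {r t : ℝ} (hr : 0 < r) (ht : 0 ≤ t) :
    HasDerivAt (fun r' => pdr u r' t)
      ((1/2) * (Qc (r - t) t - Qc (-r - t) t) / r - 2 * pdr u r t / r) r := by
  have := (((H.U_rr r ht).mul (hasDerivAt_id r)).sub (H.U_r r ht)).div
    ((hasDerivAt_id r).pow 2) (by simp [hr.ne'])
  refine (this.congr_of_eventuallyEq ?_).congr_deriv ?_
  · filter_upwards [lt_mem_nhds hr] with x hx
    rw [E.pdr_eq H hx ht]; simp
  · rw [E.pdr_eq H hr ht]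
    simp only [id, Pi.mul_apply, Pi.sub_apply, Pi.pow_apply]
    field_simp
    ring

lemma UR.h_dt (E : UR Q u) (H : QD h Q Qc) {r t : ℝ} (hr : 0 < r) (ht : 0 < t) :
    HasDerivAt (fun t' => u r t') ((1/2) * (Q (-r - t) t - Q (r - t) t) / r) t := by
  have := (H.U_t r ht).div_const r
  refine (this.congr_of_eventuallyEq ?_)
  filter_upwards [lt_mem_nhds ht] with x hx using E.eq r x hr hx.le

lemma UR.pdt_eq (E : UR Q u) (H : QD h Q Qc) {r t : ℝ} (hr : 0 < r) (ht : 0 < t) :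
    pdt u r t = (1/2) * (Q (-r - t) t - Q (r - t) t) / r := (E.h_dt H hr ht).deriv

lemma UR.h_dtr (E : UR Q u) (H : QD h Q Qc) {r t : ℝ} (hr : 0 < r) (ht : 0 < t) :
    HasDerivAt (fun r' => pdt u r' t)
      (-(1/2) * (Qc (-r - t) t + Qc (r - t) t) / r - pdt u r t / r) r := by
  have := (H.U_tr r ht.le).div (hasDerivAt_id r) hr.ne'
  refine (this.congr_of_eventuallyEq ?_).congr_deriv ?_
  · filter_upwards [lt_mem_nhds hr] with x hx using E.pdt_eq H hx ht
  · rw [E.pdt_eq H hr ht]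
    simp only [id]
    field_simp

lemma UR.h_dtt (E : UR Q u) (H : QD h Q Qc) {r t : ℝ} (hr : 0 < r) (ht : 0 < t) :
    HasDerivAt (fun t' => pdt u r t')
      (((1/2) * (Qc (r - t) t - Qc (-r - t) t) + h r t) / r) t := by
  have := (H.U_tt r ht).div_const r
  refine (this.congr_of_eventuallyEq ?_)
  filter_upwards [lt_mem_nhds ht] with x hx using E.pdt_eq H hr hx

lemma UR.reg (E : UR Q u) (H : QD h Q Qc) : Reg u where
  even := E.even
  dr r t hr ht := (E.h_dr H hr ht).differentiableAt
  drr r t hr ht := (E.h_drr H hr ht).differentiableAt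
  dt r t hr ht := (E.h_dt H hr ht).differentiableAt
  dtr r t hr ht := (E.h_dtr H hr ht).differentiableAt
  dtt r t hr ht := (E.h_dtt H hr ht).differentiableAt
  ct := by
    have h1 : ContinuousOn (fun z : ℝ × ℝ => (1/2) * (Q (-z.1 - z.2) z.2 - Q (z.1 - z.2) z.2) / z.1)
        (Set.Ioi 0 ×ˢ Set.Ioi 0) := by
      have c1 : ContinuousOn (fun z : ℝ × ℝ => Q (-z.1 - z.2) z.2) (Set.Ioi 0 ×ˢ Set.Ioi 0) :=
        H.contQ.comp (f := fun z : ℝ × ℝ => (-z.1 - z.2, z.2)) (by fun_prop) (fun z hz => ⟨trivial, hz.2⟩)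
      have c2 : ContinuousOn (fun z : ℝ × ℝ => Q (z.1 - z.2) z.2) (Set.Ioi 0 ×ˢ Set.Ioi 0) :=
        H.contQ.comp (f := fun z : ℝ × ℝ => (z.1 - z.2, z.2)) (by fun_prop) (fun z hz => ⟨trivial, hz.2⟩)
      exact (continuousOn_const.mul (c1.sub c2)).div continuousOn_fst (fun z hz => (ne_of_gt hz.1))
    exact h1.congr fun z hz => E.pdt_eq H hz.1 hz.2

/-- Bounds on `U, Q, Qc, h` at a fixed time. -/
structure QB (h Q Qc : ℝ → ℝ → ℝ) (t : ℝ) (W : ℝ → ℝ) (C₀ N₁ N₂ : ℝ) : Prop where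
  C0 : 1 ≤ C₀
  N1 : 0 ≤ N₁
  N2 : 0 ≤ N₂
  W0 : ∀ r, 0 < r → 0 ≤ W r
  WC : ∀ x r, 0 < x → x ≤ r → r ≤ 1 → W x ≤ C₀ * W r
  bU : ∀ r, 0 < r → |UQ Q r t| ≤ N₁ * r * W r
  bQp : ∀ r, 0 < r → |Q (r - t) t| ≤ N₁ * W r
  bQm : ∀ r, 0 < r → |Q (-r - t) t| ≤ N₁ * W r
  bQcp : ∀ r, 0 < r → |Qc (r - t) t| ≤ N₂ * W r
  bQcm : ∀ r, 0 < r → |Qc (-r - t) t| ≤ N₂ * W r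
  bh : ∀ r, 0 < r → 0 < t → |h r t| ≤ N₁ * W r

variable {t C₀ N₁ N₂ : ℝ} {W : ℝ → ℝ}

lemma abs_half_add {a b B : ℝ} (ha : |a| ≤ B) (hb : |b| ≤ B) : |(1/2) * (a + b)| ≤ B := by
  rw [abs_le] at *; constructor <;> linarith [ha.1, ha.2, hb.1, hb.2]

lemma abs_half_sub {a b B : ℝ} (ha : |a| ≤ B) (hb : |b| ≤ B) : |(1/2) * (a - b)| ≤ B := by
  rw [abs_le] at *; constructor <;> linarith [ha.1, ha.2, hb.1, hb.2]

lemma QB.u_bd (B : QB h Q Qc t W C₀ N₁ N₂) (E : UR Q u) (ht : 0 ≤ t) {r : ℝ} (hr : 0 < r) :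
    |u r t| ≤ N₁ * W r := by
  rw [E.eq r t hr ht, abs_div, abs_of_pos hr, div_le_iff₀ hr]
  linarith [B.bU r hr]

lemma QB.pdr_bd1 (B : QB h Q Qc t W C₀ N₁ N₂) (E : UR Q u) (H : QD h Q Qc) (ht : 0 ≤ t) {r : ℝ}
    (hr : 0 < r) : r * |pdr u r t| ≤ 2 * N₁ * W r := by
  have e : r * |pdr u r t| = |(1/2) * (Q (r - t) t + Q (-r - t) t) - u r t| := by
    rw [← abs_of_pos hr, ← abs_mul, abs_of_pos hr, E.pdr_eq H hr ht, E.eq r t hr ht]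
    congr 1; field_simp
  rw [e]
  have h1 := abs_half_add (B.bQp r hr) (B.bQm r hr)
  have h2 := B.u_bd E ht hr
  linarith [abs_sub ((1/2) * (Q (r - t) t + Q (-r - t) t)) (u r t)]

lemma QB.pdr_bd2 (B : QB h Q Qc t W C₀ N₁ N₂) (E : UR Q u) (H : QD h Q Qc) (ht : 0 ≤ t) {r : ℝ}
    (hr : 0 < r) : |pdr u r t| ≤ (2 * N₁ + C₀ * N₂) * W r ∧
      (1 + r) * |pdr u r t| ≤ (4 * N₁ + 2 * C₀ * N₂) * W r := by
  have hW := B.W0 r hr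
  have hN2 := B.N2
  have hN1 := B.N1
  have hC := B.C0
  by_cases h1 : 1 < r
  · have := B.pdr_bd1 E H ht hr
    have h3 : 0 ≤ C₀ * N₂ * W r := by positivity
    constructor <;> nlinarith [abs_nonneg (pdr u r t)]
  · push Not at h1
    obtain ⟨x, ⟨hx0, hxr⟩, hx⟩ := exists_hasDerivAt_eq_slope
      (fun r => (1/2) * (Q (r - t) t + Q (-r - t) t) * r - UQ Q r t)
      (fun r => (1/2) * (Qc (r - t) t - Qc (-r - t) t) * r) hr
      (fun x _ => ((((H.U_rr x ht).mul (hasDerivAt_id x)).sub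
        (H.U_r x ht)).continuousAt).continuousWithinAt)
      (fun x _ => (((H.U_rr x ht).mul (hasDerivAt_id x)).sub
        (H.U_r x ht)).congr_deriv (by simp only [id]; ring))
    have hU0 : UQ Q 0 t = 0 := by simp [UQ]
    simp only [mul_zero, hU0, sub_zero] at hx
    have e : pdr u r t = (1/2) * (Qc (x - t) t - Qc (-x - t) t) * x / r := by
      rw [E.pdr_eq H hr ht, hx]; field_simp
    have hb := abs_half_sub (B.bQcp x hx0) (B.bQcm x hx0)
    have hw := B.WC x r hx0 hxr.le h1
    have hb' : |pdr u r t| ≤ C₀ * N₂ * W r := by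
      rw [e, abs_div, abs_mul, abs_of_pos hx0, abs_of_pos hr, div_le_iff₀ hr]
      have : N₂ * W x ≤ C₀ * N₂ * W r := by nlinarith
      exact mul_le_mul (hb.trans this) hxr.le hx0.le (by positivity)
    have h3 : 0 ≤ N₁ * W r := by positivity
    constructor <;> nlinarith [abs_nonneg (pdr u r t)]

lemma QB.rpart1_bd (B : QB h Q Qc t W C₀ N₁ N₂) (E : UR Q u) (H : QD h Q Qc) (ht : 0 ≤ t) {r : ℝ}
    (hr : 0 < r) : rpart1 u r t ≤ 3 * N₁ * W r := by
  unfold rpart1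
  linarith [B.u_bd E ht hr, B.pdr_bd1 E H ht hr]

lemma QB.rpart2_bd (B : QB h Q Qc t W C₀ N₁ N₂) (E : UR Q u) (H : QD h Q Qc) (ht : 0 ≤ t) {r : ℝ}
    (hr : 0 < r) : rpart2 u r t ≤ (9 * N₁ + 5 * C₀ * N₂) * W r := by
  have h1 := B.u_bd E ht hr
  obtain ⟨h2', h2⟩ := B.pdr_bd2 E H ht hr
  have h3 : r * |pdr (pdr u) r t| ≤ N₂ * W r + (4 * N₁ + 2 * C₀ * N₂) * W r := by
    have e : r * |pdr (pdr u) r t| = |(1/2) * (Qc (r - t) t - Qc (-r - t) t) - 2 * pdr u r t| := by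
      rw [← abs_of_pos hr, ← abs_mul, abs_of_pos hr,
        show pdr (pdr u) r t = _ from (E.h_drr H hr ht).deriv]
      congr 1; field_simp
    rw [e]
    have hb := abs_half_sub (B.bQcp r hr) (B.bQcm r hr)
    have := abs_sub ((1/2) * (Qc (r - t) t - Qc (-r - t) t)) (2 * pdr u r t)
    rw [abs_mul 2, abs_two] at this
    linarith
  have h4 : N₂ * W r ≤ C₀ * N₂ * W r := by
    have : 0 ≤ N₂ * W r := mul_nonneg B.N2 (B.W0 r hr)
    nlinarith [B.C0]
  unfold rpart2
  linarith

lemma QB.pdt_bd1 (B : QB h Q Qc t W C₀ N₁ N₂) (E : UR Q u) (H : QD h Q Qc) (ht : 0 < t) {r : ℝ}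
    (hr : 0 < r) : r * |pdt u r t| ≤ N₁ * W r := by
  rw [← abs_of_pos hr, ← abs_mul, abs_of_pos hr, E.pdt_eq H hr ht, mul_div_cancel₀ _ hr.ne']
  exact abs_half_sub (B.bQm r hr) (B.bQp r hr)

lemma QB.pdt_bd2 (B : QB h Q Qc t W C₀ N₁ N₂) (E : UR Q u) (H : QD h Q Qc) (ht : 0 < t) {r : ℝ}
    (hr : 0 < r) : |pdt u r t| ≤ (N₁ + C₀ * N₂) * W r ∧
      (1 + r) * |pdt u r t| ≤ (2 * N₁ + 2 * C₀ * N₂) * W r := by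
  have hW := B.W0 r hr
  have hN2 := B.N2
  have hN1 := B.N1
  have hC := B.C0
  have h3 : 0 ≤ C₀ * N₂ * W r := by positivity
  have h3' : 0 ≤ N₁ * W r := by positivity
  have hb := B.pdt_bd1 E H ht hr
  by_cases h1 : 1 < r
  · constructor <;> nlinarith [abs_nonneg (pdt u r t)]
  · push Not at h1
    obtain ⟨x, ⟨hx0, hxr⟩, hx⟩ := exists_hasDerivAt_eq_slope
      (fun r => (1/2) * (Q (-r - t) t - Q (r - t) t))
      (fun r => -(1/2) * (Qc (-r - t) t + Qc (r - t) t)) hr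
      (fun x _ => ((H.U_tr x ht.le).continuousAt).continuousWithinAt)
      (fun x _ => H.U_tr x ht.le)
    simp only [neg_zero, sub_self, mul_zero, sub_zero] at hx
    have e : pdt u r t = -((1/2) * (Qc (-x - t) t + Qc (x - t) t)) := by
      rw [E.pdt_eq H hr ht, ← hx]; ring
    have hb2 := abs_half_add (B.bQcm x hx0) (B.bQcp x hx0)
    have hw := B.WC x r hx0 hxr.le h1
    have hb' : |pdt u r t| ≤ C₀ * N₂ * W r := by
      rw [e, abs_neg]
      refine hb2.trans ?_
      nlinarith
    constructor <;> nlinarith [abs_nonneg (pdt u r t)]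

lemma QB.bracket1_bd (B : QB h Q Qc t W C₀ N₁ N₂) (E : UR Q u) (H : QD h Q Qc) (ht : 0 < t) {r : ℝ}
    (hr : 0 < r) : bracket1 u r t ≤ 4 * N₁ * W r := by
  have := B.rpart1_bd E H ht.le hr
  have h2 := B.pdt_bd1 E H ht hr
  unfold rpart1 at this
  unfold bracket1
  linarith

lemma QB.bracket2_bd (B : QB h Q Qc t W C₀ N₁ N₂) (E : UR Q u) (H : QD h Q Qc) (ht : 0 < t) {r : ℝ}
    (hr : 0 < r) : bracket2 u r t ≤ (14 * N₁ + 12 * C₀ * N₂) * W r := by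
  have h0 := B.rpart2_bd E H ht.le hr
  obtain ⟨h1, h2⟩ := B.pdt_bd2 E H ht hr
  have h3 : r * |pdr (pdt u) r t| ≤ N₂ * W r + (N₁ + C₀ * N₂) * W r := by
    have e : r * |pdr (pdt u) r t| = |-((1/2) * (Qc (-r - t) t + Qc (r - t) t)) - pdt u r t| := by
      rw [← abs_of_pos hr, ← abs_mul, abs_of_pos hr,
        show pdr (pdt u) r t = _ from (E.h_dtr H hr ht).deriv]
      congr 1; field_simp
    rw [e]
    have hb := abs_half_add (B.bQcm r hr) (B.bQcp r hr)
    have := abs_sub (-((1/2) * (Qc (-r - t) t + Qc (r - t) t))) (pdt u r t)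
    rw [abs_neg] at this
    linarith
  have h4 : r * |pdt (pdt u) r t| ≤ N₂ * W r + N₁ * W r := by
    have e : r * |pdt (pdt u) r t| = |(1/2) * (Qc (r - t) t - Qc (-r - t) t) + h r t| := by
      rw [← abs_of_pos hr, ← abs_mul, abs_of_pos hr,
        show pdt (pdt u) r t = _ from (E.h_dtt H hr ht).deriv]
      congr 1; field_simp
    rw [e]
    have hb := abs_half_sub (B.bQcp r hr) (B.bQcm r hr)
    have := abs_add_le ((1/2) * (Qc (r - t) t - Qc (-r - t) t)) (h r t)
    linarith [B.bh r hr ht]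
  have h5 : N₂ * W r ≤ C₀ * N₂ * W r := by
    have : 0 ≤ N₂ * W r := mul_nonneg B.N2 (B.W0 r hr)
    nlinarith [B.C0]
  unfold rpart2 at h0
  unfold bracket2
  have h6 : 0 ≤ N₁ * W r := mul_nonneg B.N1 (B.W0 r hr)
  nlinarith [mul_nonneg (mul_nonneg (by linarith [B.C0] : 0 ≤ C₀) B.N2) (B.W0 r hr)]

end URsec


section Ksec
variable {ν ε : ℝ} {fg : (ℝ → ℝ) × (ℝ → ℝ)}

def KQ (fg : (ℝ → ℝ) × (ℝ → ℝ)) (c : ℝ) (_ : ℝ) : ℝ :=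
  deriv (fun r => r * fg.1 r) c - c * fg.2 c
def KQc (fg : (ℝ → ℝ) × (ℝ → ℝ)) (c : ℝ) (_ : ℝ) : ℝ :=
  deriv (deriv (fun r => r * fg.1 r)) c - deriv (fun r => r * fg.2 r) c

lemma memY.tn (hY : memY ν ε fg) {r : ℝ} (hr : 0 < r) : tnorm fg r ≤ ε * (1 + r) ^ (-ν) := by
  have h := hY.2.2.2.2.2.2 r hr
  have hp : 0 < (1 + r) ^ ν := by positivity
  rw [Real.rpow_neg (by linarith), ← div_eq_mul_inv, le_div_iff₀ hp]
  linarith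

lemma memY.eps (hY : memY ν ε fg) : 0 ≤ ε := by
  have h := hY.2.2.2.2.2.2 1 one_pos
  have : 0 ≤ tnorm fg 1 := by unfold tnorm tripleNorm; positivity
  exact le_trans (by positivity) h

lemma memY.dF1 (hY : memY ν ε fg) (c : ℝ) :
    HasDerivAt (fun r => r * fg.1 r) (fg.1 c + c * deriv fg.1 c) c := by
  have h1 : DifferentiableAt ℝ fg.1 c := hY.1.differentiable one_ne_zero c
  have := (hasDerivAt_id c).mul h1.hasDerivAt
  exact this.congr_deriv (by simp)

lemma memY.ddF1 (hY : memY ν ε fg) (c : ℝ) : HasDerivAt (deriv (fun r => r * fg.1 r))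
    (deriv (deriv (fun r => r * fg.1 r)) c) c := by
  have h := hY.2.2.2.2.1
  have h1 : ContDiff ℝ 1 (deriv (fun r => r * fg.1 r)) := by
    have : ContDiff ℝ (1 + 1) (fun r => r * fg.1 r) := by convert h using 1; norm_num
    exact (contDiff_succ_iff_deriv.1 this).2.2
  exact (h1.differentiable one_ne_zero c).hasDerivAt

lemma memY.cF2 (hY : memY ν ε fg) : Continuous (deriv (deriv (fun r => r * fg.1 r))) := by
  have h := hY.2.2.2.2.1
  have h1 : ContDiff ℝ 1 (deriv (fun r => r * fg.1 r)) := by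
    have : ContDiff ℝ (1 + 1) (fun r => r * fg.1 r) := by convert h using 1; norm_num
    exact (contDiff_succ_iff_deriv.1 this).2.2
  exact h1.continuous_deriv le_rfl

lemma memY.dG1 (hY : memY ν ε fg) (c : ℝ) : HasDerivAt (fun r => r * fg.2 r)
    (deriv (fun r => r * fg.2 r) c) c :=
  (hY.2.2.2.2.2.1.differentiable one_ne_zero c).hasDerivAt

lemma memY.cG1 (hY : memY ν ε fg) : Continuous (deriv (fun r => r * fg.2 r)) :=
  hY.2.2.2.2.2.1.continuous_deriv le_rfl

lemma memY.pos_bd (hY : memY ν ε fg) {c : ℝ} (hc : 0 < c) :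
    |deriv (fun r => r * fg.1 r) c| ≤ ε * (1 + c) ^ (-ν) ∧ |c * fg.2 c| ≤ ε * (1 + c) ^ (-ν) ∧
    |deriv (deriv (fun r => r * fg.1 r)) c| ≤ 2 * (ε * (1 + c) ^ (-ν)) ∧
    |deriv (fun r => r * fg.2 r) c| ≤ ε * (1 + c) ^ (-ν) ∧ |fg.1 c| ≤ ε * (1 + c) ^ (-ν) := by
  have ht := hY.tn hc
  set B := ε * (1 + c) ^ (-ν)
  unfold tnorm tripleNorm at ht
  have a1 := abs_nonneg (fg.1 c)
  have a2 := abs_nonneg (deriv fg.1 c)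
  have a3 := abs_nonneg (fg.2 c)
  have a4 := mul_nonneg hc.le (abs_nonneg (deriv (deriv fg.1) c))
  have a5 := mul_nonneg hc.le (abs_nonneg (deriv fg.2 c))
  have a6 := mul_nonneg hc.le a2
  have a7 := mul_nonneg hc.le a3
  have hdd : DifferentiableAt ℝ (deriv fg.1) c := by
    have e : deriv fg.1 =ᶠ[nhds c] fun x => (deriv (fun r => r * fg.1 r) x - fg.1 x) / x := by
      filter_upwards [lt_mem_nhds hc] with x hx
      rw [(hY.dF1 x).deriv]; field_simp; ring
    refine DifferentiableAt.congr_of_eventuallyEq ?_ e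
    exact (((hY.ddF1 c).differentiableAt).sub (hY.1.differentiable one_ne_zero c)).div
      differentiableAt_id hc.ne'
  have hdg : DifferentiableAt ℝ fg.2 c := by
    have e : fg.2 =ᶠ[nhds c] fun x => (x * fg.2 x) / x := by
      filter_upwards [lt_mem_nhds hc] with x hx
      field_simp
    refine DifferentiableAt.congr_of_eventuallyEq ?_ e
    exact (hY.dG1 c).differentiableAt.div differentiableAt_id hc.ne'
  have e1 : deriv (fun r => r * fg.1 r) = fun c => fg.1 c + c * deriv fg.1 c := by
    funext x; exact (hY.dF1 x).deriv
  have e2 : deriv (deriv (fun r => r * fg.1 r)) c = 2 * deriv fg.1 c + c * deriv (deriv fg.1) c := by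
    rw [e1]
    have := (hY.1.differentiable one_ne_zero c).hasDerivAt.add
      ((hasDerivAt_id c).mul hdd.hasDerivAt)
    refine (this.congr_deriv ?_).deriv
    simp only [id]; ring
  have e3 : deriv (fun r => r * fg.2 r) c = fg.2 c + c * deriv fg.2 c := by
    have := (hasDerivAt_id c).mul hdg.hasDerivAt
    refine (this.congr_deriv ?_).deriv
    simp only [id]; ring
  refine ⟨?_, ?_, ?_, ?_, ?_⟩
  · rw [e1]
    refine (abs_add_le _ _).trans ?_
    rw [abs_mul, abs_of_pos hc]; linarith
  · rw [abs_mul, abs_of_pos hc]; linarith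
  · rw [e2]
    refine (abs_add_le _ _).trans ?_
    rw [abs_mul, abs_mul, abs_of_pos hc, abs_two]; linarith
  · rw [e3]
    refine (abs_add_le _ _).trans ?_
    rw [abs_mul, abs_of_pos hc]; linarith
  · linarith

lemma memY.F1odd (hY : memY ν ε fg) (x : ℝ) : (-x) * fg.1 (-x) = -(x * fg.1 x) := by
  rw [hY.2.2.1]; ring
lemma memY.G1odd (hY : memY ν ε fg) (x : ℝ) : (-x) * fg.2 (-x) = -(x * fg.2 x) := by
  rw [hY.2.2.2.1]; ring

lemma deriv_odd {f : ℝ → ℝ} (hf : ∀ x, f (-x) = - f x) (x : ℝ) : deriv f (-x) = deriv f x := by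
  have h1 : deriv (fun x => f (-x)) x = - deriv f (-x) := deriv_comp_neg f x
  have h2 : (fun x => f (-x)) = fun x => - f x := funext hf
  rw [h2, deriv.fun_neg] at h1
  linarith

lemma deriv_even {f : ℝ → ℝ} (hf : ∀ x, f (-x) = f x) (x : ℝ) : deriv f (-x) = - deriv f x := by
  have h1 : deriv (fun x => f (-x)) x = - deriv f (-x) := deriv_comp_neg f x
  have h2 : (fun x => f (-x)) = fun x => f x := funext hf
  rw [h2] at h1
  linarith

lemma memY.bd (hY : memY ν ε fg) (c : ℝ) :
    |deriv (fun r => r * fg.1 r) c| ≤ ε * (1 + |c|) ^ (-ν) ∧ |c * fg.2 c| ≤ ε * (1 + |c|) ^ (-ν) ∧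
    |deriv (deriv (fun r => r * fg.1 r)) c| ≤ 2 * (ε * (1 + |c|) ^ (-ν)) ∧
    |deriv (fun r => r * fg.2 r) c| ≤ ε * (1 + |c|) ^ (-ν) ∧ |fg.1 c| ≤ ε * (1 + |c|) ^ (-ν) := by
  have hpos := fun c (hc : 0 < c) => hY.pos_bd hc
  -- the bound is a closed condition
  have hcont : Continuous fun c : ℝ => ε * (1 + |c|) ^ (-ν) := by
    refine continuous_const.mul (Continuous.rpow_const (by fun_prop) fun x => Or.inl ?_)
    positivity
  have hcF1 : Continuous (deriv (fun r => r * fg.1 r)) :=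
    continuous_iff_continuousAt.2 fun c => (hY.ddF1 c).continuousAt
  have hcl : ∀ c : ℝ, 0 ≤ c → _ := fun c (hc : 0 ≤ c) => by
    have hmem : c ∈ closure (Set.Ioi (0:ℝ)) := by rw [closure_Ioi]; exact hc
    have hclosed : IsClosed {c : ℝ | |deriv (fun r => r * fg.1 r) c| ≤ ε * (1 + |c|) ^ (-ν) ∧
        |c * fg.2 c| ≤ ε * (1 + |c|) ^ (-ν) ∧
        |deriv (deriv (fun r => r * fg.1 r)) c| ≤ 2 * (ε * (1 + |c|) ^ (-ν)) ∧
        |deriv (fun r => r * fg.2 r) c| ≤ ε * (1 + |c|) ^ (-ν) ∧ |fg.1 c| ≤ ε * (1 + |c|) ^ (-ν)} := by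
      refine (isClosed_le hcF1.abs hcont).inter ((isClosed_le ?_ hcont).inter
        ((isClosed_le hY.cF2.abs (continuous_const.mul hcont)).inter
        ((isClosed_le hY.cG1.abs hcont).inter (isClosed_le hY.1.continuous.abs hcont))))
      exact (continuous_id.mul hY.2.1).abs
    exact hclosed.closure_subset_iff.2 (fun x (hx : 0 < x) => by
      have := hpos x hx
      simp only [Set.mem_setOf_eq, abs_of_pos hx]
      exact this) hmem
  rcases le_total 0 c with hc | hc
  · exact hcl c hc
  · have := hcl (-c) (by linarith)
    have o1 := deriv_odd (f := fun r => r * fg.1 r) hY.F1odd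
    have o2 := deriv_odd (f := fun r => r * fg.2 r) hY.G1odd
    have o3 := deriv_even o1
    simp only [Set.mem_setOf_eq] at this
    rw [o1, o2, o3, hY.G1odd, hY.2.2.1, abs_neg, abs_neg, abs_neg] at this
    exact this

lemma memY.Q_bd (hY : memY ν ε fg) (c t : ℝ) : |KQ fg c t| ≤ 2 * ε * (1 + |c|) ^ (-ν) := by
  have := hY.bd c
  unfold KQ
  refine (abs_sub _ _).trans ?_
  linarith [this.1, this.2.1]

lemma memY.Qc_bd (hY : memY ν ε fg) (c t : ℝ) : |KQc fg c t| ≤ 3 * ε * (1 + |c|) ^ (-ν) := by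
  have := hY.bd c
  unfold KQc
  refine (abs_sub _ _).trans ?_
  linarith [this.2.2.1, this.2.2.2.1]

lemma wt_mono (hν : 0 ≤ ν) {x y : ℝ} (h : |x| ≤ |y|) : (1 + |y|) ^ (-ν) ≤ (1 + |x|) ^ (-ν) :=
  Real.rpow_le_rpow_of_nonpos (by positivity) (by linarith) (by linarith)

lemma memY.QD (hY : memY ν ε fg) (hν : 0 ≤ ν) : QD (fun _ _ => 0) (KQ fg) (KQc fg) where
  hodd := by simp
  hcont := continuousOn_const
  hbd := ⟨0, by simp⟩
  dQ c t _ := (hY.ddF1 c).sub (hY.dG1 c)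
  bQc T := ⟨3 * ε, fun c t _ _ => (hY.Qc_bd c t).trans (by
    have h1 : (1 + |c|) ^ (-ν) ≤ 1 := Real.rpow_le_one_of_one_le_of_nonpos
      (by linarith [abs_nonneg c]) (by linarith)
    have := hY.eps
    nlinarith)⟩
  step c t t₀ _ _ := by simp [KQ]

lemma memY.Kop_eq (hY : memY ν ε fg) (r t : ℝ) : Kop fg r t =
    (1 / (2 * r)) * ((∫ l in (r - t)..(r + t), l * fg.2 l) +
      ((r + t) * fg.1 (r + t) + (r - t) * fg.1 (r - t))) := by
  unfold Kop
  congr 2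
  have hc : Continuous (fun l => l * fg.1 l) := continuous_id.mul hY.1.continuous
  have h0 : ∀ r : ℝ, HasDerivAt (fun r => ∫ x in (0:ℝ)..r, x * fg.1 x) (r * fg.1 r) r := fun r =>
    intervalIntegral.integral_hasDerivAt_right (hc.intervalIntegrable _ _)
      (hc.stronglyMeasurableAtFilter _ _) hc.continuousAt
  have h1 := ((h0 (r + t)).comp t ((hasDerivAt_id t).const_add r)).sub
    ((h0 (r - t)).comp t ((hasDerivAt_id t).const_sub r))
  refine (((h1.congr_of_eventuallyEq ?_).congr_deriv ?_)).deriv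
  · filter_upwards with s
    simp only [Pi.sub_apply, Function.comp, id]
    rw [intervalIntegral.integral_interval_sub_left (hc.intervalIntegrable _ _)
      (hc.intervalIntegrable _ _)]
  · ring

lemma memY.UQ_eq (hY : memY ν ε fg) (r t : ℝ) : UQ (KQ fg) r t =
    (1 / 2) * ((∫ l in (r - t)..(r + t), l * fg.2 l) +
      ((r + t) * fg.1 (r + t) + (r - t) * fg.1 (r - t))) := by
  have hcG : Continuous (fun l => l * fg.2 l) := continuous_id.mul hY.2.1
  have hcF1 : Continuous (deriv (fun r => r * fg.1 r)) :=
    continuous_iff_continuousAt.2 fun c => (hY.ddF1 c).continuousAt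
  unfold UQ
  congr 1
  have e1 : ∫ x in (-r)..r, KQ fg (x - t) t = ∫ x in (-r - t)..(r - t), KQ fg x t :=
    intervalIntegral.integral_comp_sub_right (fun x => KQ fg x t) t
  rw [e1]
  unfold KQ
  rw [intervalIntegral.integral_sub (hcF1.intervalIntegrable _ _) (hcG.intervalIntegrable _ _),
    intervalIntegral.integral_eq_sub_of_hasDerivAt (f := fun r => r * fg.1 r)
      (fun x _ => by rw [(hY.dF1 x).deriv]; exact hY.dF1 x) (hcF1.intervalIntegrable _ _)]
  have e2 : ∫ x in (-r - t)..(r - t), x * fg.2 x = -∫ x in (r - t)..(r + t), x * fg.2 x := by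
    have h1 : ∫ x in (-(r - t))..(r + t), x * fg.2 x = -∫ x in (-(r + t))..(r - t), x * fg.2 x := by
      rw [← intervalIntegral.integral_neg]
      have := intervalIntegral.integral_comp_neg (fun x => x * fg.2 x) (a := -(r+t)) (b := r - t)
      rw [neg_neg] at this
      rw [← this]
      exact intervalIntegral.integral_congr fun x _ => hY.G1odd x
    have h2 : ∫ x in (-(r - t))..(r - t), x * fg.2 x = 0 := by
      have h3 := intervalIntegral.integral_comp_neg (fun x => x * fg.2 x) (a := -(r-t)) (b := r - t)
      have h4 : ∫ x in (-(r-t))..(r - t), (-x) * fg.2 (-x) = -∫ x in (-(r-t))..(r - t), x * fg.2 x := by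
        rw [← intervalIntegral.integral_neg]
        exact intervalIntegral.integral_congr fun x _ => hY.G1odd x
      rw [neg_neg] at h3
      linarith
    have h3 := intervalIntegral.integral_add_adjacent_intervals
      (hcG.intervalIntegrable (μ := volume) (-(r-t)) (r - t)) (hcG.intervalIntegrable (r - t) (r + t))
    rw [h2, zero_add] at h3
    have : -r - t = -(r + t) := by ring
    rw [this, h3]; linarith
  rw [e2]
  have e3 : (-r - t) * fg.1 (-r - t) = -((r + t) * fg.1 (r + t)) := by
    have := hY.F1odd (r + t)
    rw [← this]; ring_nf
  rw [e3]; ring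

lemma memY.UR (hY : memY ν ε fg) : UR (KQ fg) (Kop fg) where
  eq r t hr _ := by
    rw [hY.Kop_eq, hY.UQ_eq]; field_simp
  even r t _ := by
    rw [hY.Kop_eq, hY.Kop_eq]
    have h1 : ∫ x in (-r - t)..(-r + t), x * fg.2 x = -∫ x in (r - t)..(r + t), x * fg.2 x := by
      rw [← intervalIntegral.integral_neg]
      have := intervalIntegral.integral_comp_neg (fun x => x * fg.2 x) (a := r - t) (b := r + t)
      rw [show -r - t = -(r + t) by ring, show -r + t = -(r - t) by ring, ← this]
      exact intervalIntegral.integral_congr fun x _ => hY.G1odd x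
    rw [h1]
    have e3 : (-r - t) * fg.1 (-r - t) = -((r + t) * fg.1 (r + t)) := by
      rw [← hY.F1odd (r + t)]; ring_nf
    have e4 : (-r + t) * fg.1 (-r + t) = -((r - t) * fg.1 (r - t)) := by
      rw [← hY.F1odd (r - t)]; ring_nf
    rw [e3, e4]
    rw [show (2 * -r) = -(2 * r) by ring, div_neg]
    ring

lemma memY.QB (hY : memY ν ε fg) (hν : 0 ≤ ν) {t : ℝ} (ht : 0 ≤ t) :
    QB (fun _ _ => 0) (KQ fg) (KQc fg) t (fun r => (1 + |r - t|) ^ (-ν)) (2 ^ ν) (3 * ε) (3 * ε) where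
  C0 := Real.one_le_rpow (by norm_num) hν
  N1 := by linarith [hY.eps]
  N2 := by linarith [hY.eps]
  W0 r _ := by positivity
  WC x r hx hxr hr := by
    rw [Real.rpow_neg (by positivity), Real.rpow_neg (by positivity), ← div_eq_mul_inv,
      inv_eq_one_div, div_le_div_iff₀ (by positivity) (by positivity), one_mul,
      ← Real.mul_rpow (by norm_num) (by positivity)]
    refine Real.rpow_le_rpow (by positivity) ?_ hν
    have : |r - t| ≤ |x - t| + |r - x| := by
      have := abs_sub_le r x t; linarith
    rw [abs_of_nonneg (by linarith : 0 ≤ r - x)] at this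
    linarith [abs_nonneg (x - t)]
  bQp r _ := (hY.Q_bd _ _).trans (by
    have := hY.eps
    have : 0 ≤ (1 + |r - t|) ^ (-ν) := by positivity
    nlinarith)
  bQm r hr := by
    refine (hY.Q_bd _ _).trans ?_
    have h1 : (1 + |-r - t|) ^ (-ν) ≤ (1 + |r - t|) ^ (-ν) := wt_mono hν (by
      rw [show -r - t = -(r+t) by ring, abs_neg, abs_of_nonneg (by linarith : 0 ≤ r + t)]
      exact abs_le.2 ⟨by linarith, by linarith⟩)
    have := hY.eps
    have : 0 ≤ (1 + |r - t|) ^ (-ν) := by positivity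
    nlinarith
  bQcp r _ := hY.Qc_bd _ _
  bQcm r hr := by
    refine (hY.Qc_bd _ _).trans ?_
    have h1 : (1 + |-r - t|) ^ (-ν) ≤ (1 + |r - t|) ^ (-ν) := wt_mono hν (by
      rw [show -r - t = -(r+t) by ring, abs_neg, abs_of_nonneg (by linarith : 0 ≤ r + t)]
      exact abs_le.2 ⟨by linarith, by linarith⟩)
    have := hY.eps
    nlinarith
  bh r hr _ := by
    simp only [abs_zero]
    have := hY.eps
    positivity
  bU r hr := by
    have hε := hY.eps
    have hw : 0 ≤ (1 + |r - t|) ^ (-ν) := by positivity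
    rcases le_or_gt r t with hrt | hrt
    · unfold UQ
      have := intervalIntegral.norm_integral_le_of_norm_le_const (a := -r) (b := r)
        (C := 2 * ε * (1 + |r - t|) ^ (-ν)) (f := fun x => KQ fg (x - t) t) (fun x hx => by
          rw [Set.uIoc_of_le (by linarith)] at hx
          refine (hY.Q_bd _ _).trans ?_
          refine mul_le_mul_of_nonneg_left (wt_mono hν ?_) (by linarith)
          rw [abs_of_nonpos (by linarith), abs_of_nonpos (by linarith [hx.2])]
          linarith [hx.2])
      rw [Real.norm_eq_abs, show r - -r = 2 * r by ring, abs_of_pos (by linarith : 0 < 2 * r)] at this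
      rw [abs_mul, abs_of_pos (by norm_num : (0:ℝ) < 1/2)]
      nlinarith [mul_nonneg hε (mul_nonneg hr.le hw)]
    · rw [hY.UQ_eq, abs_mul, abs_of_pos (by norm_num : (0:ℝ) < 1/2)]
      have i1 := intervalIntegral.norm_integral_le_of_norm_le_const (a := r - t) (b := r + t)
        (C := ε * (1 + |r - t|) ^ (-ν)) (f := fun x => x * fg.2 x) (fun x hx => by
          rw [Set.uIoc_of_le (by linarith)] at hx
          refine (hY.bd _).2.1.trans ?_
          refine mul_le_mul_of_nonneg_left (wt_mono hν ?_) (by linarith)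
          rw [abs_of_pos (by linarith), abs_of_pos (by linarith [hx.1])]
          linarith [hx.1])
      rw [Real.norm_eq_abs, show r + t - (r - t) = 2 * t by ring,
        abs_of_nonneg (by linarith : 0 ≤ 2 * t)] at i1
      have i2 : |(r + t) * fg.1 (r + t)| ≤ 2 * r * (ε * (1 + |r - t|) ^ (-ν)) := by
        rw [abs_mul, abs_of_pos (by linarith : 0 < r + t)]
        refine mul_le_mul (by linarith) ((hY.bd _).2.2.2.2.trans ?_) (abs_nonneg _) (by linarith)
        refine mul_le_mul_of_nonneg_left (wt_mono hν ?_) (by linarith)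
        rw [abs_of_pos (by linarith), abs_of_pos (by linarith)]
        linarith
      have i3 : |(r - t) * fg.1 (r - t)| ≤ r * (ε * (1 + |r - t|) ^ (-ν)) := by
        rw [abs_mul]
        refine mul_le_mul (by rw [abs_of_pos (by linarith)]; linarith)
          ((hY.bd _).2.2.2.2) (abs_nonneg _) (by linarith)
      have j1 := abs_add_le (∫ l in (r - t)..(r + t), l * fg.2 l)
        ((r + t) * fg.1 (r + t) + (r - t) * fg.1 (r - t))
      have j2 := abs_add_le ((r + t) * fg.1 (r + t)) ((r - t) * fg.1 (r - t))
      have hB : 0 ≤ ε * (1 + |r - t|) ^ (-ν) := by positivity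
      set B := ε * (1 + |r - t|) ^ (-ν)
      have j3 : B * (2 * t) ≤ 2 * r * B := by nlinarith
      have : 3 * ε * r * (1 + |r - t|) ^ (-ν) = 3 * r * B := by simp only [B]; ring
      rw [this]
      nlinarith [mul_nonneg hr.le hB]

lemma memY.Kreg (hY : memY ν ε fg) (hν : 0 ≤ ν) : Reg (Kop fg) := hY.UR.reg (hY.QD hν)

lemma memY.Kbd (hY : memY ν ε fg) (hν : 0 ≤ ν) {r t : ℝ} (hr : 0 < r) (ht : 0 < t) :
    bracket2 (Kop fg) r t ≤ (42 + 36 * 2 ^ ν) * ε * (1 + |r - t|) ^ (-ν) := by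
  have := (hY.QB hν ht.le).bracket2_bd hY.UR (hY.QD hν) ht hr
  linarith

end Ksec


section Srcsec
variable {F : ℝ → ℝ → ℝ} {B : ℝ → ℝ}

def hh (F : ℝ → ℝ → ℝ) (x s : ℝ) : ℝ := x * F x s
def dhh (F : ℝ → ℝ → ℝ) (x s : ℝ) : ℝ := deriv (fun x => hh F x s) x

structure Src (F : ℝ → ℝ → ℝ) (B : ℝ → ℝ) : Prop where
  even : ∀ x s, 0 < s → F (-x) s = F x s
  cont : ContinuousOn (fun z : ℝ × ℝ => F z.1 z.2) (Set.Ioi 0 ×ˢ Set.Ioi 0)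
  diff : ∀ x s, 0 < x → 0 < s → DifferentiableAt ℝ (fun x => F x s) x
  bF : ∀ x s, 0 < x → 0 < s → |F x s| ≤ B s
  bh : ∀ x s, 0 < x → 0 < s → |hh F x s| ≤ B s
  bd : ∀ x s, 0 < x → 0 < s → |dhh F x s| ≤ B s
  bm : ∀ s t, 0 ≤ s → s ≤ t → B t ≤ B s
  bc : ContinuousOn B (Set.Ici 0)

lemma Src.odd (S : Src F B) (x : ℝ) {s : ℝ} (hs : 0 < s) : hh F (-x) s = -hh F x s := by
  unfold hh; rw [S.even x s hs]; ring

lemma Src.B0 (S : Src F B) {s : ℝ} (hs : 0 < s) : 0 ≤ B s :=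
  (abs_nonneg _).trans (S.bF 1 s one_pos hs)

lemma Src.bh' (S : Src F B) (x : ℝ) {s : ℝ} (hs : 0 < s) : |hh F x s| ≤ B s := by
  rcases lt_trichotomy x 0 with hx | hx | hx
  · have := S.bh (-x) s (by linarith) hs
    rwa [S.odd x hs, abs_neg] at this
  · subst hx; simpa [hh] using S.B0 hs
  · exact S.bh x s hx hs

lemma Src.bhx (S : Src F B) (x : ℝ) {s : ℝ} (hs : 0 < s) : |hh F x s| ≤ B s * |x| := by
  rcases lt_trichotomy x 0 with hx | hx | hx
  · have := S.bF (-x) s (by linarith) hs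
    rw [S.even x s hs] at this
    unfold hh; rw [abs_mul, mul_comm]
    exact mul_le_mul_of_nonneg_right this (abs_nonneg _)
  · subst hx; simp [hh]
  · have := S.bF x s hx hs
    unfold hh; rw [abs_mul, mul_comm]
    exact mul_le_mul_of_nonneg_right this (abs_nonneg _)

lemma Src.dpos (S : Src F B) {x s : ℝ} (hx : 0 < x) (hs : 0 < s) :
    HasDerivAt (fun x => hh F x s) (dhh F x s) x := by
  have : DifferentiableAt ℝ (fun x => hh F x s) x :=
    differentiableAt_id.mul (S.diff x s hx hs)
  exact this.hasDerivAt

lemma Src.dne (S : Src F B) {x s : ℝ} (hx : x ≠ 0) (hs : 0 < s) :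
    HasDerivAt (fun x => hh F x s) (dhh F x s) x := by
  rcases lt_or_gt_of_ne hx with hx | hx
  · have h1 := (S.dpos (x := -x) (by linarith) hs).comp x (hasDerivAt_neg x)
    have h2 : DifferentiableAt ℝ (fun x => hh F x s) x := by
      refine (h1.neg.congr_of_eventuallyEq ?_).differentiableAt
      filter_upwards with y
      simp only [Pi.neg_apply, Function.comp]
      rw [S.odd y hs, neg_neg]
    exact h2.hasDerivAt
  · exact S.dpos hx hs

lemma Src.dhh_even (S : Src F B) (x : ℝ) {s : ℝ} (hs : 0 < s) : dhh F (-x) s = dhh F x s :=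
  deriv_odd (fun y => S.odd y hs) x

lemma Src.contAt0 (S : Src F B) {s : ℝ} (hs : 0 < s) :
    ContinuousAt (fun z : ℝ × ℝ => hh F z.1 z.2) (0, s) := by
  rw [ContinuousAt, tendsto_iff_dist_tendsto_zero]
  have hlim : Tendsto (fun z : ℝ × ℝ => B (s/2) * |z.1|) (nhds (0, s)) (nhds 0) := by
    have : Continuous (fun z : ℝ × ℝ => B (s/2) * |z.1|) := by fun_prop
    have := this.tendsto (0, s)
    simpa using this
  refine squeeze_zero' (Eventually.of_forall fun _ => dist_nonneg) ?_ hlim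
  have hmem : (Set.univ ×ˢ Set.Ioi (s/2) : Set (ℝ × ℝ)) ∈ nhds (0, s) :=
    prod_mem_nhds univ_mem (Ioi_mem_nhds (by linarith))
  filter_upwards [hmem] with z hz
  have hz2 : s / 2 < z.2 := hz.2
  have : hh F 0 s = 0 := by simp [hh]
  rw [Real.dist_eq, this, sub_zero]
  refine (S.bhx z.1 (by linarith)).trans ?_
  exact mul_le_mul_of_nonneg_right (S.bm _ _ (by linarith) hz2.le) (abs_nonneg _)

lemma Src.hcont (S : Src F B) :
    ContinuousOn (fun z : ℝ × ℝ => hh F z.1 z.2) (Set.univ ×ˢ Set.Ioi 0) := by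
  have hp : ∀ x s, 0 < x → 0 < s → ContinuousAt (fun z : ℝ × ℝ => hh F z.1 z.2) (x, s) := by
    intro x s hx hs
    have := S.cont.continuousAt (x := (x, s)) (prod_mem_nhds (Ioi_mem_nhds hx) (Ioi_mem_nhds hs))
    exact continuousAt_fst.mul this
  rintro ⟨x, s⟩ hz
  have hs : 0 < s := hz.2
  apply ContinuousAt.continuousWithinAt
  rcases lt_trichotomy x 0 with hx | hx | hx
  · have h1 := (hp (-x) s (by linarith) hs).comp (f := fun z : ℝ × ℝ => (-z.1, z.2)) (x := (x, s))
      (by fun_prop)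
    refine (h1.neg).congr ?_
    have hmem : (Set.univ ×ˢ Set.Ioi 0 : Set (ℝ × ℝ)) ∈ nhds (x, s) :=
      prod_mem_nhds univ_mem (Ioi_mem_nhds hs)
    filter_upwards [hmem] with z hz
    change -hh F (-z.1) z.2 = hh F z.1 z.2
    rw [S.odd _ hz.2, neg_neg]
  · subst hx; exact S.contAt0 hs
  · exact hp x s hx hs

lemma Src.hcontx (S : Src F B) {s : ℝ} (hs : 0 < s) : Continuous (fun x => hh F x s) :=
  continuous_iff_continuousAt.2 fun x =>
    (S.hcont.continuousAt (x := (x, s)) (prod_mem_nhds univ_mem (Ioi_mem_nhds hs))).comp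
      (f := fun x : ℝ => (x, s)) (by fun_prop)

lemma Src.lip (S : Src F B) {s : ℝ} (hs : 0 < s) (x y : ℝ) :
    |hh F x s - hh F y s| ≤ B s * |x - y| := by
  have hB := S.B0 hs
  have hpos : ∀ a b, 0 ≤ a → a < b → |hh F b s - hh F a s| ≤ B s * (b - a) := by
    intro a b ha hab
    obtain ⟨z, hz, hz2⟩ := exists_hasDerivAt_eq_slope (fun x => hh F x s) (fun x => dhh F x s) hab
      (S.hcontx hs).continuousOn (fun x hx => S.dpos (by linarith [hx.1]) hs)
    have h1 := S.bd z s (by linarith [hz.1]) hs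
    rw [hz2, abs_div, abs_of_pos (by linarith : 0 < b - a), div_le_iff₀ (by linarith)] at h1
    exact h1
  have hmain : ∀ a b, a < b → |hh F b s - hh F a s| ≤ B s * (b - a) := by
    intro a b hab
    rcases le_or_gt 0 a with ha | ha
    · exact hpos a b ha hab
    · rcases le_or_gt b 0 with hb | hb
      · have := hpos (-b) (-a) (by linarith) (by linarith)
        rw [S.odd a hs, S.odd b hs] at this
        rw [show -hh F a s - -hh F b s = hh F b s - hh F a s by ring] at this
        linarith
      · have h1 := S.bhx a hs
        have h2 := S.bhx b hs
        rw [abs_of_neg ha] at h1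
        rw [abs_of_pos hb] at h2
        have := abs_sub (hh F b s) (hh F a s)
        linarith
  rcases lt_trichotomy x y with h | h | h
  · rw [abs_sub_comm, abs_sub_comm x y, abs_of_pos (by linarith : 0 < y - x)]; exact hmain x y h
  · subst h; simp
  · rw [abs_of_pos (by linarith : 0 < x - y)]; exact hmain y x h

lemma Src.bd' (S : Src F B) {x s : ℝ} (hx : x ≠ 0) (hs : 0 < s) : |dhh F x s| ≤ B s := by
  rcases lt_or_gt_of_ne hx with hx | hx
  · rw [← S.dhh_even x hs]; exact S.bd (-x) s (by linarith) hs
  · exact S.bd x s hx hs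

variable {I : Set ℝ}

lemma Src.meas (S : Src F B) (hI : MeasurableSet I) (hI0 : I ⊆ Set.Ioi 0) (c : ℝ) :
    AEStronglyMeasurable (fun s => hh F (s + c) s) (volume.restrict I) := by
  refine ContinuousOn.aestronglyMeasurable ?_ hI
  exact S.hcont.comp (f := fun s : ℝ => (s + c, s)) (by fun_prop) (fun s hs => ⟨trivial, hI0 hs⟩)

lemma ae_ne (c : ℝ) (I : Set ℝ) : ∀ᵐ s ∂(volume.restrict I), s + c ≠ 0 := by
  refine ae_restrict_of_ae ?_
  have : ({-c} : Set ℝ)ᶜ ∈ ae (volume : Measure ℝ) := by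
    simp [mem_ae_iff]
  filter_upwards [this] with s hs h
  exact hs (by simp; linarith)

lemma Src.measd (S : Src F B) (hI : MeasurableSet I) (hI0 : I ⊆ Set.Ioi 0) (c : ℝ) :
    AEStronglyMeasurable (fun s => dhh F (s + c) s) (volume.restrict I) := by
  refine aestronglyMeasurable_of_tendsto_ae (ι := ℕ) (atTop)
    (f := fun n s => ((n:ℝ) + 1) * (hh F (s + (c + 1/((n:ℝ)+1))) s - hh F (s + c) s)) ?_ ?_
  · intro n
    exact ((S.meas hI hI0 _).sub (S.meas hI hI0 c)).const_mul _
  · filter_upwards [ae_ne c I, ae_restrict_mem hI] with s hs hsI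
    have hs0 : 0 < s := hI0 hsI
    have h1 := (S.dne hs hs0).tendsto_slope_zero
    have h2 : Tendsto (fun n : ℕ => 1/((n:ℝ)+1)) atTop (nhdsWithin 0 {0}ᶜ) := by
      rw [tendsto_nhdsWithin_iff]
      refine ⟨tendsto_one_div_add_atTop_nhds_zero_nat, Eventually.of_forall fun n => ?_⟩
      have : (0:ℝ) < 1/((n:ℝ)+1) := by positivity
      exact this.ne'
    refine (h1.comp h2).congr fun n => ?_
    simp only [Function.comp, smul_eq_mul, one_div, inv_inv, add_assoc]

lemma Src.hasDeriv (S : Src F B) (hI : MeasurableSet I) (hI0 : I ⊆ Set.Ioi 0)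
    (hB : IntegrableOn B I) (c : ℝ) :
    HasDerivAt (fun c => ∫ s in I, hh F (s + c) s) (∫ s in I, dhh F (s + c) s) c := by
  refine (hasDerivAt_integral_of_dominated_loc_of_lip (F := fun c s => hh F (s + c) s)
    (F' := fun s => dhh F (s + c) s) (bound := B) (s := Set.univ) univ_mem ?_ ?_ ?_ ?_ hB ?_).2
  · exact Eventually.of_forall fun c => S.meas hI hI0 c
  · refine Integrable.mono' hB (S.meas hI hI0 c) ?_
    filter_upwards [ae_restrict_mem hI] with s hs
    exact S.bh' _ (hI0 hs)
  · exact S.measd hI hI0 c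
  · filter_upwards [ae_restrict_mem hI] with s hs
    have hs0 : 0 < s := hI0 hs
    refine LipschitzOnWith.of_dist_le_mul fun x _ y _ => ?_
    rw [Real.dist_eq, Real.dist_eq]
    have := S.lip hs0 (s + x) (s + y)
    rw [show s + x - (s + y) = x - y by ring] at this
    refine this.trans (mul_le_mul_of_nonneg_right ?_ (abs_nonneg _))
    simp [le_abs_self]
  · filter_upwards [ae_ne c I, ae_restrict_mem hI] with s hs hsI
    have := (S.dne hs (hI0 hsI)).comp c ((hasDerivAt_id c).const_add s)
    exact this.congr_deriv (by simp)

lemma Src.int_h (S : Src F B) (hI : MeasurableSet I) (hI0 : I ⊆ Set.Ioi 0)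
    (hB : IntegrableOn B I) (c : ℝ) : IntegrableOn (fun s => hh F (s + c) s) I := by
  refine Integrable.mono' hB (S.meas hI hI0 c) ?_
  filter_upwards [ae_restrict_mem hI] with s hs
  exact S.bh' _ (hI0 hs)

lemma Src.bdQc (S : Src F B) (hI : MeasurableSet I) (hI0 : I ⊆ Set.Ioi 0)
    (hB : IntegrableOn B I) (c : ℝ) : |∫ s in I, dhh F (s + c) s| ≤ ∫ s in I, B s := by
  refine norm_integral_le_of_norm_le (f := fun s => dhh F (s + c) s) hB ?_
  filter_upwards [ae_ne c I, ae_restrict_mem hI] with s hs hsI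
  exact S.bd' hs (hI0 hsI)

/-- Fubini. -/
lemma Src.fubini (S : Src F B) (hI : MeasurableSet I) (hI0 : I ⊆ Set.Ioi 0)
    (hB : IntegrableOn B I) {r : ℝ} (hr : 0 < r) (t : ℝ) :
    ∫ x in (-r)..r, (∫ s in I, hh F (s + (x - t)) s) =
      ∫ s in I, ∫ l in (s - t - r)..(s - t + r), hh F l s := by
  have e1 : ∀ s, ∫ l in (s - t - r)..(s - t + r), hh F l s = ∫ x in Set.Ioc (-r) r, hh F (s + (x - t)) s := by
    intro s
    rw [← intervalIntegral.integral_of_le (by linarith)]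
    have := intervalIntegral.integral_comp_add_left (fun l => hh F l s) (s - t) (a := -r) (b := r)
    rw [show s - t - r = s - t + -r by ring, ← this]
    refine intervalIntegral.integral_congr fun x _ => ?_
    change hh F (s - t + x) s = hh F (s + (x - t)) s
    congr 1; ring
  simp_rw [e1]
  rw [intervalIntegral.integral_of_le (by linarith)]
  refine integral_integral_swap ?_
  rw [Measure.prod_restrict]
  have hm : MeasurableSet (Set.Ioc (-r) r ×ˢ I) := measurableSet_Ioc.prod hI
  have hintgr : IntegrableOn (fun z : ℝ × ℝ => (1:ℝ) * B z.2) (Set.Ioc (-r) r ×ˢ I)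
      (volume.prod volume) := by
    unfold IntegrableOn
    rw [← Measure.prod_restrict]
    exact Integrable.mul_prod (f := fun _ : ℝ => (1:ℝ)) (integrable_const _) hB
  refine Integrable.mono' hintgr ?_ ?_
  · refine ContinuousOn.aestronglyMeasurable ?_ hm
    exact S.hcont.comp (f := fun z : ℝ × ℝ => (z.2 + (z.1 - t), z.2)) (by fun_prop)
      (fun z hz => ⟨trivial, hI0 hz.2⟩)
  · filter_upwards [ae_restrict_mem hm] with z hz
    rw [one_mul]
    exact S.bh' _ (hI0 hz.2)

/-- The operator `R`. -/
def RQ (F : ℝ → ℝ → ℝ) (c t : ℝ) : ℝ := ∫ s in Set.Ioi t, hh F (s + c) s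
def RQc (F : ℝ → ℝ → ℝ) (c t : ℝ) : ℝ := ∫ s in Set.Ioi t, dhh F (s + c) s

lemma Ioi_sub {t : ℝ} (ht : 0 ≤ t) : Set.Ioi t ⊆ Set.Ioi (0:ℝ) := Set.Ioi_subset_Ioi ht

lemma Src.RQD (S : Src F B) (hB : IntegrableOn B (Set.Ioi 0)) : QD (hh F) (RQ F) (RQc F) where
  hodd x s hs := S.odd x hs
  hcont := S.hcont
  hbd := ⟨B 0, fun x s hs => (S.bh' x hs).trans (S.bm 0 s le_rfl hs.le)⟩
  dQ c t ht := S.hasDeriv measurableSet_Ioi (Ioi_sub ht) (hB.mono_set (Ioi_sub ht)) c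
  bQc T := ⟨∫ s in Set.Ioi 0, B s, fun c t ht _ =>
    (S.bdQc measurableSet_Ioi (Ioi_sub ht) (hB.mono_set (Ioi_sub ht)) c).trans (by
      refine setIntegral_mono_set hB ?_ (Filter.Eventually.of_forall (Ioi_sub ht))
      filter_upwards [ae_restrict_mem measurableSet_Ioi] with s hs using S.B0 hs)⟩
  step c t t₀ ht ht₀ := by
    have hb : ∀ t, 0 ≤ t → IntegrableOn (fun s => hh F (s + c) s) (Set.Ioi t) := fun t ht =>
      S.int_h measurableSet_Ioi (Ioi_sub ht) (hB.mono_set (Ioi_sub ht)) c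
    unfold RQ
    rcases le_total t₀ t with h | h
    · have e := intervalIntegral.integral_interval_add_Ioi (hb t₀ ht₀) (hb t ht)
      linarith
    · have e := intervalIntegral.integral_interval_add_Ioi (hb t ht) (hb t₀ ht₀)
      rw [intervalIntegral.integral_symm]
      linarith

lemma Src.RUR (S : Src F B) (hB : IntegrableOn B (Set.Ioi 0)) : UR (RQ F) (Rop F) where
  eq r t hr ht := by
    unfold UQ RQ
    rw [S.fubini measurableSet_Ioi (Ioi_sub ht) (hB.mono_set (Ioi_sub ht)) hr]
    unfold Rop hh
    field_simp
  even r t _ := by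
    unfold Rop
    have : ∀ s, ∫ l in (s - t - -r)..(s - t + -r), l * F l s = -∫ l in (s - t - r)..(s - t + r), l * F l s := by
      intro s
      rw [intervalIntegral.integral_symm]
      congr 3
      ring
    simp_rw [this]
    rw [integral_neg]
    rw [show (2 * -r) = -(2 * r) by ring, div_neg]
    ring

/-- The operator `L`. -/
def LQ (F : ℝ → ℝ → ℝ) (c t : ℝ) : ℝ := -∫ s in Set.Ioc 0 t, hh F (s + c) s
def LQc (F : ℝ → ℝ → ℝ) (c t : ℝ) : ℝ := -∫ s in Set.Ioc 0 t, dhh F (s + c) s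

lemma Ioc_sub {t : ℝ} : Set.Ioc 0 t ⊆ Set.Ioi (0:ℝ) := Set.Ioc_subset_Ioi_self

lemma Src.intB (S : Src F B) (t : ℝ) : IntegrableOn B (Set.Ioc 0 t) := by
  have : IntegrableOn B (Set.Icc 0 t) :=
    (S.bc.mono Set.Icc_subset_Ici_self).integrableOn_Icc
  exact this.mono_set Set.Ioc_subset_Icc_self

lemma Src.LQD (S : Src F B) : QD (hh F) (LQ F) (LQc F) where
  hodd x s hs := S.odd x hs
  hcont := S.hcont
  hbd := ⟨B 0, fun x s hs => (S.bh' x hs).trans (S.bm 0 s le_rfl hs.le)⟩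
  dQ c t _ := (S.hasDeriv measurableSet_Ioc Ioc_sub (S.intB t) c).neg
  bQc T := ⟨∫ s in Set.Ioc 0 T, B s, fun c t ht hT => by
    unfold LQc
    rw [abs_neg]
    refine (S.bdQc measurableSet_Ioc Ioc_sub (S.intB t) c).trans ?_
    refine setIntegral_mono_set (S.intB T) ?_
      (Filter.Eventually.of_forall (Set.Ioc_subset_Ioc_right hT))
    filter_upwards [ae_restrict_mem measurableSet_Ioc] with s hs using S.B0 hs.1⟩
  step c t t₀ ht ht₀ := by
    have hi : ∀ t, 0 ≤ t → IntervalIntegrable (fun s => hh F (s + c) s) volume 0 t := fun t ht => by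
      rw [intervalIntegrable_iff_integrableOn_Ioc_of_le ht]
      exact S.int_h measurableSet_Ioc Ioc_sub (S.intB t) c
    unfold LQ
    rw [← intervalIntegral.integral_of_le ht, ← intervalIntegral.integral_of_le ht₀,
      ← intervalIntegral.integral_interval_sub_left (hi t ht) (hi t₀ ht₀)]
    ring

lemma Src.odd_int (S : Src F B) {s : ℝ} (hs : 0 < s) (a b : ℝ) :
    ∫ x in (-b)..(-a), hh F x s = -∫ x in a..b, hh F x s := by
  rw [← intervalIntegral.integral_comp_neg, ← intervalIntegral.integral_neg]
  exact intervalIntegral.integral_congr fun x _ => S.odd x hs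

lemma Src.LUR (S : Src F B) : UR (LQ F) (Lop F) where
  eq r t hr ht := by
    unfold UQ LQ
    rw [intervalIntegral.integral_neg, S.fubini measurableSet_Ioc Ioc_sub (S.intB t) hr]
    unfold Lop
    rw [intervalIntegral.integral_of_le ht]
    have : ∫ s in Set.Ioc 0 t, ∫ l in (r - (t - s))..(r + (t - s)), l * F l s =
        -∫ s in Set.Ioc 0 t, ∫ l in (s - t - r)..(s - t + r), hh F l s := by
      rw [← integral_neg]
      refine setIntegral_congr_fun measurableSet_Ioc fun s hs => ?_
      have hs0 : 0 < s := hs.1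
      have hc := S.hcontx hs0
      have o1 := S.odd_int hs0 (s - t - r) (s - t + r)
      rw [← o1]
      have o2 : ∫ x in (t - s - r)..(r - (t - s)), hh F x s = 0 := by
        have := S.odd_int hs0 (t - s - r) (r - (t - s))
        rw [show -(r - (t - s)) = t - s - r by ring, show -(t - s - r) = r - (t - s) by ring] at this
        linarith
      have o3 := intervalIntegral.integral_add_adjacent_intervals
        (hc.intervalIntegrable (μ := volume) (t - s - r) (r - (t - s)))
        (hc.intervalIntegrable (r - (t - s)) (r + (t - s)))
      rw [o2, zero_add] at o3
      rw [show -(s - t + r) = t - s - r by ring, show -(s - t - r) = r + (t - s) by ring, ← o3]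
      rfl
    rw [this]
    field_simp
  even r t ht := by
    unfold Lop
    have : ∫ s in (0:ℝ)..t, ∫ l in (-r - (t - s))..(-r + (t - s)), l * F l s =
        -∫ s in (0:ℝ)..t, ∫ l in (r - (t - s))..(r + (t - s)), l * F l s := by
      rw [← intervalIntegral.integral_neg, intervalIntegral.integral_of_le ht.le,
        intervalIntegral.integral_of_le ht.le]
      refine setIntegral_congr_fun measurableSet_Ioc fun s hs => ?_
      have := S.odd_int hs.1 (r - (t - s)) (r + (t - s))
      rw [show -r - (t - s) = -(r + (t - s)) by ring, show -r + (t - s) = -(r - (t - s)) by ring]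
      exact this
    rw [this, show (2 * -r) = -(2 * r) by ring, div_neg]
    ring

end Srcsec


section IntB

def mm (η x : ℝ) : ℝ := (1 + |x|) ^ (-1 - η)

lemma mm_pos (η x : ℝ) : 0 < mm η x := by unfold mm; positivity

lemma mm_int {η : ℝ} (hη : 0 < η) : Integrable (mm η) := by
  have := integrable_one_add_norm (E := ℝ) (μ := volume) (r := 1 + η) (by simp; linarith)
  unfold mm
  simp only [Real.norm_eq_abs] at this
  convert this using 3
  ring

def Imm (η : ℝ) : ℝ := ∫ x, mm η x

lemma Imm_nonneg (η : ℝ) : 0 ≤ Imm η := integral_nonneg fun x => (mm_pos η x).le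

lemma mm_mono {η x y : ℝ} (hη : 0 < η) (h : |x| ≤ |y|) : mm η y ≤ mm η x := by
  unfold mm
  exact Real.rpow_le_rpow_of_nonpos (by positivity) (by linarith) (by linarith)

lemma shift_int {k : ℝ → ℝ} (hk0 : ∀ x, 0 ≤ k x) (hk : Integrable k) (c : ℝ) (I : Set ℝ) :
    IntegrableOn (fun s => k (s + c)) I ∧ ∫ s in I, k (s + c) ≤ ∫ x, k x := by
  have h1 : Integrable (fun s => k (s + c)) := hk.comp_add_right c
  refine ⟨h1.integrableOn, ?_⟩
  rw [← integral_add_right_eq_self k c]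
  exact setIntegral_le_integral h1 (Eventually.of_forall fun x => hk0 _)

lemma mm_int2 {η : ℝ} (hη : 0 < η) (b : ℝ) (I : Set ℝ) :
    IntegrableOn (fun s => mm η (b - 2 * s)) I ∧ ∫ s in I, mm η (b - 2 * s) ≤ Imm η := by
  have h0 := mm_int hη
  have h1 : Integrable (fun s => mm η (b - 2 * s)) := by
    have := (h0.comp_sub_left b).comp_mul_left' (R := 2) (by norm_num)
    exact this
  refine ⟨h1.integrableOn, ?_⟩
  refine (setIntegral_le_integral h1 (Eventually.of_forall fun x => (mm_pos _ _).le)).trans ?_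
  have e : ∫ s, mm η (b - 2 * s) = |(2:ℝ)⁻¹| • ∫ s, mm η (b - s) :=
    Measure.integral_comp_mul_left (fun s => mm η (b - s)) 2
  rw [e, integral_sub_left_eq_self]
  rw [abs_of_pos (by norm_num), smul_eq_mul]
  have := Imm_nonneg η
  unfold Imm at *
  linarith

lemma pow_int {ν a t : ℝ} (hν : 1 < ν) (h : 0 < a + t) :
    IntegrableOn (fun s => (a + s) ^ (-ν)) (Set.Ioi t) ∧
      ∫ s in Set.Ioi t, (a + s) ^ (-ν) = (a + t) ^ (1 - ν) / (ν - 1) := by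
  have hd : ∀ x ∈ Set.Ioi t, HasDerivAt (fun s => (a + s) ^ (1 - ν) / (1 - ν)) ((a + x) ^ (-ν)) x := by
    intro x hx
    have hx' : t < x := hx
    have := (((hasDerivAt_id x).const_add a).rpow_const (p := 1 - ν) (Or.inl (by simp; linarith))).div_const (1 - ν)
    refine this.congr_deriv ?_
    have : 1 - ν ≠ 0 := by linarith
    simp only [id]
    field_simp
    ring_nf
  have hcw : ContinuousWithinAt (fun s => (a + s) ^ (1 - ν) / (1 - ν)) (Set.Ici t) t := by
    apply ContinuousAt.continuousWithinAt
    exact ((continuousAt_const.add continuousAt_id).rpow_const (Or.inl h.ne')).div_const _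
  have hlim : Tendsto (fun s => (a + s) ^ (1 - ν) / (1 - ν)) atTop (nhds 0) := by
    have h1 := (tendsto_rpow_neg_atTop (y := ν - 1) (by linarith)).comp
      (tendsto_atTop_add_const_left atTop a tendsto_id)
    have := h1.div_const (1 - ν)
    simp only [zero_div] at this
    refine this.congr fun s => ?_
    simp [Function.comp]
  have hpos : ∀ x ∈ Set.Ioi t, 0 ≤ (a + x) ^ (-ν) := fun x hx => by
    have hx' : t < x := hx
    exact Real.rpow_nonneg (by linarith) _
  refine ⟨integrableOn_Ioi_deriv_of_nonneg hcw hd hpos hlim, ?_⟩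
  rw [integral_Ioi_of_hasDerivAt_of_nonneg hcw hd hpos hlim]
  have : 1 - ν ≠ 0 := by linarith
  have : ν - 1 ≠ 0 := by linarith
  rw [show 1 - ν = -(ν - 1) by ring, div_neg]
  ring

lemma pow_int_fin {ν t : ℝ} (hν1 : ν < 1) (ht : 0 ≤ t) :
    IntegrableOn (fun s => (1 + s) ^ (-ν)) (Set.Ioc 0 t) ∧
      ∫ s in Set.Ioc 0 t, (1 + s) ^ (-ν) ≤ (1 + t) ^ (1 - ν) / (1 - ν) := by
  have hc : ContinuousOn (fun s : ℝ => (1 + s) ^ (-ν)) (Set.Icc 0 t) := by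
    refine ContinuousOn.rpow_const (by fun_prop) fun x hx => Or.inl ?_
    linarith [hx.1]
  have hi : IntegrableOn (fun s : ℝ => (1 + s) ^ (-ν)) (Set.Ioc 0 t) :=
    hc.integrableOn_Icc.mono_set Set.Ioc_subset_Icc_self
  refine ⟨hi, ?_⟩
  rw [← intervalIntegral.integral_of_le ht]
  have hd : ∀ x ∈ Set.uIcc 0 t, HasDerivAt (fun s => (1 + s) ^ (1 - ν) / (1 - ν)) ((1 + x) ^ (-ν)) x := by
    intro x hx
    rw [Set.uIcc_of_le ht] at hx
    have := (((hasDerivAt_id x).const_add 1).rpow_const (p := 1 - ν) (Or.inl (by simp; linarith [hx.1]))).div_const (1 - ν)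
    refine this.congr_deriv ?_
    have : 1 - ν ≠ 0 := by linarith
    simp only [id]
    field_simp
    ring_nf
  rw [intervalIntegral.integral_eq_sub_of_hasDerivAt hd
    ((intervalIntegrable_iff_integrableOn_Ioc_of_le ht).2 hi)]
  have : 0 ≤ (1 + (0:ℝ)) ^ (1 - ν) / (1 - ν) := by
    have : 0 < 1 - ν := by linarith
    positivity
  linarith

def PhiS (ν η : ℝ) (k : ℝ → ℝ) (x s : ℝ) : ℝ :=
  (1 + |x| + s) ^ (-ν) * (mm η (|x| - s) + k x)

def BR (ν η r t : ℝ) : ℝ := mm η (r - t) * (1 + r + t) ^ (1 - ν) + (1 + r + t) ^ (-ν)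
def BL (ν η r t : ℝ) : ℝ := mm η (r - t) * (1 + r + t) ^ (1 - ν) + (1 + |r - t|) ^ (-ν)

def CR (ν η : ℝ) (k : ℝ → ℝ) : ℝ := 2 ^ ν / (ν - 1) + Imm η + ∫ x, k x
def CL (ν η : ℝ) (k : ℝ → ℝ) : ℝ := 1 / (1 - ν) + Imm η + ∫ x, k x

variable {ν η : ℝ} {k : ℝ → ℝ}

lemma CR_nonneg (hν : 1 < ν) (hk0 : ∀ x, 0 ≤ k x) : 0 ≤ CR ν η k := by
  unfold CR
  have := Imm_nonneg η
  have h2 : 0 ≤ ∫ x, k x := integral_nonneg hk0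
  have : 0 < ν - 1 := by linarith
  positivity

lemma CL_nonneg (hν : ν < 1) (hk0 : ∀ x, 0 ≤ k x) : 0 ≤ CL ν η k := by
  unfold CL
  have := Imm_nonneg η
  have h2 : 0 ≤ ∫ x, k x := integral_nonneg hk0
  have : 0 < 1 - ν := by linarith
  positivity

lemma rp_anti {a b ν : ℝ} (ha : 0 < a) (hab : a ≤ b) (hν : 0 ≤ ν) : b ^ (-ν) ≤ a ^ (-ν) :=
  Real.rpow_le_rpow_of_nonpos ha hab (by linarith)

lemma R_plus (hν : 1 < ν) (hk0 : ∀ x, 0 ≤ k x) (hk : Integrable k)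
    {r t M : ℝ} (hr : 0 < r) (ht : 0 ≤ t) (hM : 0 ≤ M) {φ : ℝ → ℝ}
    (hφ : ∀ᵐ s ∂(volume.restrict (Set.Ioi t)), |φ s| ≤ M * PhiS ν η k (s + (r - t)) s) :
    |∫ s in Set.Ioi t, φ s| ≤ M * (CR ν η k * BR ν η r t) := by
  obtain ⟨i1, e1⟩ := pow_int (ν := ν) (a := 1 + r) (t := t) hν (by linarith)
  obtain ⟨i2, e2⟩ := shift_int hk0 hk (r - t) (Set.Ioi t)
  have hS : 0 < 1 + r + t := by linarith
  have ig : IntegrableOn (fun s => M * (mm η (r - t) * (1 + r + s) ^ (-ν) +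
      (1 + r + t) ^ (-ν) * k (s + (r - t)))) (Set.Ioi t) :=
    ((i1.const_mul _).add (i2.const_mul _)).const_mul _
  refine (norm_integral_le_of_norm_le (f := φ) ig ?_).trans ?_
  · filter_upwards [hφ, ae_restrict_mem measurableSet_Ioi] with s hs hst
    have hst' : t < s := hst
    refine hs.trans (mul_le_mul_of_nonneg_left ?_ hM)
    unfold PhiS
    rw [abs_of_pos (by linarith : 0 < s + (r - t)), show s + (r - t) - s = r - t by ring, mul_add]
    have a1 : (1 + (s + (r - t)) + s) ^ (-ν) ≤ (1 + r + s) ^ (-ν) :=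
      rp_anti (by linarith) (by linarith) (by linarith)
    have a2 : (1 + (s + (r - t)) + s) ^ (-ν) ≤ (1 + r + t) ^ (-ν) :=
      rp_anti (by linarith) (by linarith) (by linarith)
    have b1 := mul_le_mul_of_nonneg_right a1 (mm_pos η (r - t)).le
    have b2 := mul_le_mul_of_nonneg_right a2 (hk0 (s + (r - t)))
    linarith
  · rw [integral_const_mul, integral_add (i1.const_mul _) (i2.const_mul _), integral_const_mul,
      integral_const_mul, e1]
    refine mul_le_mul_of_nonneg_left ?_ hM
    have h2 : 0 ≤ ∫ x, k x := integral_nonneg hk0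
    have h3 := Imm_nonneg η
    have h4 : 0 < ν - 1 := by linarith
    have h5 : 1 / (ν - 1) ≤ 2 ^ ν / (ν - 1) :=
      div_le_div_of_nonneg_right (Real.one_le_rpow (by norm_num) (by linarith)) h4.le
    have c1 : 0 ≤ mm η (r - t) * (1 + r + t) ^ (1 - ν) :=
      mul_nonneg (mm_pos _ _).le (by positivity)
    have c2 : 0 ≤ (1 + r + t) ^ (-ν) := by positivity
    have d1 : mm η (r - t) * ((1 + r + t) ^ (1 - ν) / (ν - 1)) ≤
        CR ν η k * (mm η (r - t) * (1 + r + t) ^ (1 - ν)) := by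
      rw [show mm η (r - t) * ((1 + r + t) ^ (1 - ν) / (ν - 1)) =
        (1 / (ν - 1)) * (mm η (r - t) * (1 + r + t) ^ (1 - ν)) by ring]
      refine mul_le_mul_of_nonneg_right ?_ c1
      unfold CR; linarith
    have d2 : (1 + r + t) ^ (-ν) * ∫ s in Set.Ioi t, k (s + (r - t)) ≤
        CR ν η k * (1 + r + t) ^ (-ν) := by
      rw [mul_comm]
      refine mul_le_mul_of_nonneg_right (e2.trans ?_) c2
      have : 0 ≤ 2 ^ ν / (ν - 1) := by positivity
      unfold CR; linarith
    unfold BR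
    linarith

lemma R_minus (hν : 1 < ν) (hη : 0 < η) (hk0 : ∀ x, 0 ≤ k x) (hk : Integrable k)
    {r t M : ℝ} (hr : 0 < r) (ht : 0 ≤ t) (hM : 0 ≤ M) {φ : ℝ → ℝ}
    (hφ : ∀ᵐ s ∂(volume.restrict (Set.Ioi t)), |φ s| ≤ M * PhiS ν η k (s + (-r - t)) s) :
    |∫ s in Set.Ioi t, φ s| ≤ M * (CR ν η k * BR ν η r t) := by
  obtain ⟨i1, e1⟩ := pow_int (ν := ν) (a := 1 + r) (t := t) hν (by linarith)
  obtain ⟨i2, e2⟩ := shift_int hk0 hk (-r - t) (Set.Ioi t)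
  obtain ⟨i3, e3⟩ := mm_int2 hη (r + t) (Set.Ioi t)
  have hS : 0 < 1 + r + t := by linarith
  have hmD : mm η (r + t) ≤ mm η (r - t) := mm_mono hη (by
    rw [abs_of_pos (by linarith : 0 < r + t)]
    exact abs_le.2 ⟨by linarith, by linarith⟩)
  have ig : IntegrableOn (fun s => M * (2 ^ ν * mm η (r + t) * (1 + r + s) ^ (-ν) +
      (1 + r + t) ^ (-ν) * mm η (r + t - 2 * s) +
      (1 + r + t) ^ (-ν) * k (s + (-r - t)))) (Set.Ioi t) :=
    (((i1.const_mul _).add (i3.const_mul _)).add (i2.const_mul _)).const_mul _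
  refine (norm_integral_le_of_norm_le (f := φ) ig ?_).trans ?_
  · filter_upwards [hφ, ae_restrict_mem measurableSet_Ioi] with s hs hst
    have hst' : t < s := hst
    refine hs.trans (mul_le_mul_of_nonneg_left ?_ hM)
    unfold PhiS
    have p1 : 0 ≤ 2 ^ ν * mm η (r + t) * (1 + r + s) ^ (-ν) :=
      mul_nonneg (mul_nonneg (by positivity) (mm_pos _ _).le) (Real.rpow_nonneg (by linarith) _)
    have p2 : 0 ≤ (1 + r + t) ^ (-ν) * mm η (r + t - 2 * s) :=
      mul_nonneg (by positivity) (mm_pos _ _).le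
    rcases lt_or_ge (s + (-r - t)) 0 with hx | hx
    · rw [abs_of_neg hx, show -(s + (-r - t)) - s = r + t - 2 * s by ring,
        show 1 + -(s + (-r - t)) + s = 1 + r + t by ring, mul_add]
      linarith
    · have hmm : mm η (|s + (-r - t)| - s) = mm η (r + t) := by
        rw [abs_of_nonneg hx, show s + (-r - t) - s = -(r + t) by ring]
        unfold mm; rw [abs_neg]
      rw [hmm, abs_of_nonneg hx, mul_add]
      have a1 : (1 + (s + (-r - t)) + s) ^ (-ν) ≤ 2 ^ ν * (1 + r + s) ^ (-ν) := by
        have : ((1 + r + s) / 2) ^ (-ν) = 2 ^ ν * (1 + r + s) ^ (-ν) := by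
          rw [Real.div_rpow (by linarith) (by norm_num), Real.rpow_neg (by norm_num : (0:ℝ) ≤ 2)]
          field_simp
        rw [← this]
        exact rp_anti (by linarith) (by linarith) (by linarith)
      have a2 : (1 + (s + (-r - t)) + s) ^ (-ν) ≤ (1 + r + t) ^ (-ν) :=
        rp_anti (by linarith) (by linarith) (by linarith)
      have b1 := mul_le_mul_of_nonneg_right a1 (mm_pos η (r + t)).le
      have b2 := mul_le_mul_of_nonneg_right a2 (hk0 (s + (-r - t)))
      linarith
  · rw [integral_const_mul, integral_add (f := fun s => 2 ^ ν * mm η (r + t) * (1 + r + s) ^ (-ν) +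
      (1 + r + t) ^ (-ν) * mm η (r + t - 2 * s)) ((i1.const_mul _).add (i3.const_mul _)) (i2.const_mul _),
      integral_add (i1.const_mul _) (i3.const_mul _), integral_const_mul,
      integral_const_mul, integral_const_mul, e1]
    refine mul_le_mul_of_nonneg_left ?_ hM
    have h2 : 0 ≤ ∫ x, k x := integral_nonneg hk0
    have h3 := Imm_nonneg η
    have h4 : 0 < ν - 1 := by linarith
    have h5 : 0 ≤ 2 ^ ν / (ν - 1) := by positivity
    have c1 : 0 ≤ mm η (r - t) * (1 + r + t) ^ (1 - ν) :=
      mul_nonneg (mm_pos _ _).le (by positivity)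
    have c2 : 0 ≤ (1 + r + t) ^ (-ν) := by positivity
    have d1 : 2 ^ ν * mm η (r + t) * ((1 + r + t) ^ (1 - ν) / (ν - 1)) ≤
        CR ν η k * (mm η (r - t) * (1 + r + t) ^ (1 - ν)) := by
      rw [show 2 ^ ν * mm η (r + t) * ((1 + r + t) ^ (1 - ν) / (ν - 1)) =
        (2 ^ ν / (ν - 1)) * (mm η (r + t) * (1 + r + t) ^ (1 - ν)) by ring]
      refine mul_le_mul ?_ (mul_le_mul_of_nonneg_right hmD (by positivity))
        (mul_nonneg (mm_pos _ _).le (by positivity)) (CR_nonneg hν hk0)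
      unfold CR; linarith
    have d2 : (1 + r + t) ^ (-ν) * (∫ s in Set.Ioi t, mm η (r + t - 2 * s)) +
        (1 + r + t) ^ (-ν) * ∫ s in Set.Ioi t, k (s + (-r - t)) ≤
        CR ν η k * (1 + r + t) ^ (-ν) := by
      rw [← mul_add, mul_comm]
      refine mul_le_mul_of_nonneg_right ?_ c2
      unfold CR; linarith
    unfold BR
    linarith

lemma L_plus (hν0 : 0 ≤ ν) (hν : ν < 1) (hη : 0 < η) (hk0 : ∀ x, 0 ≤ k x) (hk : Integrable k)
    {r t M : ℝ} (hr : 0 < r) (ht : 0 ≤ t) (hM : 0 ≤ M) {φ : ℝ → ℝ}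
    (hφ : ∀ᵐ s ∂(volume.restrict (Set.Ioc 0 t)), |φ s| ≤ M * PhiS ν η k (s + (r - t)) s) :
    |∫ s in Set.Ioc 0 t, φ s| ≤ M * (CL ν η k * BL ν η r t) := by
  obtain ⟨i1, e1⟩ := pow_int_fin (ν := ν) (t := t) hν ht
  obtain ⟨i2, e2⟩ := shift_int hk0 hk (r - t) (Set.Ioc 0 t)
  obtain ⟨i3, e3⟩ := mm_int2 hη (t - r) (Set.Ioc 0 t)
  have ig : IntegrableOn (fun s => M * (mm η (r - t) * (1 + s) ^ (-ν) +
      (1 + |r - t|) ^ (-ν) * mm η (t - r - 2 * s) +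
      (1 + |r - t|) ^ (-ν) * k (s + (r - t)))) (Set.Ioc 0 t) :=
    (((i1.const_mul _).add (i3.const_mul _)).add (i2.const_mul _)).const_mul _
  refine (norm_integral_le_of_norm_le (f := φ) ig ?_).trans ?_
  · filter_upwards [hφ, ae_restrict_mem measurableSet_Ioc] with s hs hst
    obtain ⟨hs0, hst⟩ := hst
    refine hs.trans (mul_le_mul_of_nonneg_left ?_ hM)
    unfold PhiS
    have p1 : 0 ≤ mm η (r - t) * (1 + s) ^ (-ν) :=
      mul_nonneg (mm_pos _ _).le (Real.rpow_nonneg (by linarith) _)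
    have p2 : 0 ≤ (1 + |r - t|) ^ (-ν) * mm η (t - r - 2 * s) :=
      mul_nonneg (by positivity) (mm_pos _ _).le
    rcases lt_or_ge (s + (r - t)) 0 with hx | hx
    · rw [abs_of_neg hx, show -(s + (r - t)) - s = t - r - 2 * s by ring,
        show 1 + -(s + (r - t)) + s = 1 + |r - t| by rw [abs_of_neg (by linarith)]; ring, mul_add]
      linarith
    · rw [abs_of_nonneg hx, show s + (r - t) - s = r - t by ring, mul_add]
      have a1 : (1 + (s + (r - t)) + s) ^ (-ν) ≤ (1 + s) ^ (-ν) :=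
        rp_anti (by linarith) (by linarith) (by linarith)
      have a2 : (1 + (s + (r - t)) + s) ^ (-ν) ≤ (1 + |r - t|) ^ (-ν) := by
        refine rp_anti (by positivity) ?_ (by linarith)
        have : |r - t| ≤ s + (r - t) + s := abs_le.2 ⟨by linarith, by linarith⟩
        linarith
      have b1 := mul_le_mul_of_nonneg_right a1 (mm_pos η (r - t)).le
      have b2 := mul_le_mul_of_nonneg_right a2 (hk0 (s + (r - t)))
      linarith
  · rw [integral_const_mul, integral_add (f := fun s => mm η (r - t) * (1 + s) ^ (-ν) +
      (1 + |r - t|) ^ (-ν) * mm η (t - r - 2 * s)) ((i1.const_mul _).add (i3.const_mul _)) (i2.const_mul _),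
      integral_add (i1.const_mul _) (i3.const_mul _), integral_const_mul,
      integral_const_mul, integral_const_mul]
    refine mul_le_mul_of_nonneg_left ?_ hM
    have h2 : 0 ≤ ∫ x, k x := integral_nonneg hk0
    have h3 := Imm_nonneg η
    have h4 : 0 < 1 - ν := by linarith
    have h5 : 0 ≤ 1 / (1 - ν) := by positivity
    have c1 : 0 ≤ mm η (r - t) * (1 + r + t) ^ (1 - ν) :=
      mul_nonneg (mm_pos _ _).le (by positivity)
    have c2 : 0 ≤ (1 + |r - t|) ^ (-ν) := by positivity
    have d1 : mm η (r - t) * (∫ s in Set.Ioc 0 t, (1 + s) ^ (-ν)) ≤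
        CL ν η k * (mm η (r - t) * (1 + r + t) ^ (1 - ν)) := by
      have f1 : (1 + t) ^ (1 - ν) / (1 - ν) ≤ (1 + r + t) ^ (1 - ν) / (1 - ν) :=
        div_le_div_of_nonneg_right (Real.rpow_le_rpow (by linarith) (by linarith) h4.le) h4.le
      have f2 := mul_le_mul_of_nonneg_left (e1.trans f1) (mm_pos η (r - t)).le
      refine f2.trans ?_
      rw [show mm η (r - t) * ((1 + r + t) ^ (1 - ν) / (1 - ν)) =
        (1 / (1 - ν)) * (mm η (r - t) * (1 + r + t) ^ (1 - ν)) by ring]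
      refine mul_le_mul_of_nonneg_right ?_ c1
      unfold CL; linarith
    have d2 : (1 + |r - t|) ^ (-ν) * (∫ s in Set.Ioc 0 t, mm η (t - r - 2 * s)) +
        (1 + |r - t|) ^ (-ν) * ∫ s in Set.Ioc 0 t, k (s + (r - t)) ≤
        CL ν η k * (1 + |r - t|) ^ (-ν) := by
      rw [← mul_add, mul_comm]
      refine mul_le_mul_of_nonneg_right ?_ c2
      unfold CL; linarith
    unfold BL
    linarith

lemma L_minus (hν0 : 0 ≤ ν) (hν : ν < 1) (hη : 0 < η) (hk0 : ∀ x, 0 ≤ k x) (hk : Integrable k)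
    {r t M : ℝ} (hr : 0 < r) (ht : 0 ≤ t) (hM : 0 ≤ M) {φ : ℝ → ℝ}
    (hφ : ∀ᵐ s ∂(volume.restrict (Set.Ioc 0 t)), |φ s| ≤ M * PhiS ν η k (s + (-r - t)) s) :
    |∫ s in Set.Ioc 0 t, φ s| ≤ M * (CL ν η k * BL ν η r t) := by
  obtain ⟨i2, e2⟩ := shift_int hk0 hk (-r - t) (Set.Ioc 0 t)
  obtain ⟨i3, e3⟩ := mm_int2 hη (r + t) (Set.Ioc 0 t)
  have ig : IntegrableOn (fun s => M * (
      (1 + |r - t|) ^ (-ν) * mm η (r + t - 2 * s) +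
      (1 + |r - t|) ^ (-ν) * k (s + (-r - t)))) (Set.Ioc 0 t) :=
    (((i3.const_mul _)).add (i2.const_mul _)).const_mul _
  have hDS : 1 + |r - t| ≤ 1 + r + t := by
    have : |r - t| ≤ r + t := abs_le.2 ⟨by linarith, by linarith⟩
    linarith
  refine (norm_integral_le_of_norm_le (f := φ) ig ?_).trans ?_
  · filter_upwards [hφ, ae_restrict_mem measurableSet_Ioc] with s hs hst
    obtain ⟨hs0, hst⟩ := hst
    refine hs.trans (mul_le_mul_of_nonneg_left ?_ hM)
    unfold PhiS
    have hx : s + (-r - t) < 0 := by linarith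
    rw [abs_of_neg hx, show -(s + (-r - t)) - s = r + t - 2 * s by ring,
        show 1 + -(s + (-r - t)) + s = 1 + r + t by ring, mul_add]
    have a1 : (1 + r + t) ^ (-ν) ≤ (1 + |r - t|) ^ (-ν) := rp_anti (by positivity) hDS hν0
    have b1 := mul_le_mul_of_nonneg_right a1 (mm_pos η (r + t - 2 * s)).le
    have b2 := mul_le_mul_of_nonneg_right a1 (hk0 (s + (-r - t)))
    linarith
  · rw [integral_const_mul, integral_add (i3.const_mul _) (i2.const_mul _),
      integral_const_mul, integral_const_mul]
    refine mul_le_mul_of_nonneg_left ?_ hM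
    have h4 : 0 < 1 - ν := by linarith
    have h5 : 0 ≤ 1 / (1 - ν) := by positivity
    have c1 : 0 ≤ mm η (r - t) * (1 + r + t) ^ (1 - ν) :=
      mul_nonneg (mm_pos _ _).le (by positivity)
    have c2 : 0 ≤ (1 + |r - t|) ^ (-ν) := by positivity
    have d2 : (1 + |r - t|) ^ (-ν) * (∫ s in Set.Ioc 0 t, mm η (r + t - 2 * s)) +
        (1 + |r - t|) ^ (-ν) * ∫ s in Set.Ioc 0 t, k (s + (-r - t)) ≤
        CL ν η k * (1 + |r - t|) ^ (-ν) := by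
      rw [← mul_add, mul_comm]
      refine mul_le_mul_of_nonneg_right ?_ c2
      unfold CL; linarith
    have := mul_nonneg (CL_nonneg (η := η) hν hk0) c1
    unfold BL
    linarith

end IntB



section Wsec

/-- The weight of the spaces `Z(ν)`. -/
def WZ (ν r t : ℝ) : ℝ := (1 + r + t) ^ (1 - ν) * (1 + |r - t|)⁻¹

def cw (ν : ℝ) : ℝ := 2 * 2 ^ |1 - ν|

lemma cw_ge (ν : ℝ) : 1 ≤ cw ν := by
  unfold cw
  have : (1:ℝ) ≤ 2 ^ |1 - ν| := Real.one_le_rpow (by norm_num) (abs_nonneg _)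
  linarith

lemma rpow_cmp {a b e : ℝ} (ha : 0 < a) (hb : 0 < b) (h1 : a ≤ 2 * b) (h2 : b ≤ 2 * a) :
    a ^ e ≤ 2 ^ |e| * b ^ e := by
  rcases le_total 0 e with he | he
  · rw [abs_of_nonneg he, ← Real.mul_rpow (by norm_num) hb.le]
    exact Real.rpow_le_rpow ha.le h1 he
  · rw [abs_of_nonpos he]
    have h3 : (2 * a) ^ e ≤ b ^ e := Real.rpow_le_rpow_of_nonpos hb h2 he
    rw [Real.mul_rpow (by norm_num) ha.le] at h3
    have h4 : (2:ℝ) ^ (-e) * 2 ^ e = 1 := by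
      rw [← Real.rpow_add (by norm_num)]; simp
    calc a ^ e = 2 ^ (-e) * (2 ^ e * a ^ e) := by rw [← mul_assoc, h4, one_mul]
      _ ≤ _ := mul_le_mul_of_nonneg_left h3 (by positivity)

lemma WZ_pos {ν r t : ℝ} (hr : 0 < r) (ht : 0 ≤ t) : 0 < WZ ν r t := by
  unfold WZ; positivity

lemma WZ_cmp {ν x s r t : ℝ} (hx : 0 < x) (hs : 0 ≤ s) (hr : 0 < r) (ht : 0 ≤ t)
    (h1 : 1 + x + s ≤ 2 * (1 + r + t)) (h2 : 1 + r + t ≤ 2 * (1 + x + s))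
    (h3 : 1 + |r - t| ≤ 2 * (1 + |x - s|)) : WZ ν x s ≤ cw ν * WZ ν r t := by
  unfold WZ cw
  have a1 := rpow_cmp (e := 1 - ν) (by linarith : 0 < 1 + x + s) (by linarith) h1 h2
  have a2 : (1 + |x - s|)⁻¹ ≤ 2 * (1 + |r - t|)⁻¹ := by
    rw [inv_le_comm₀ (by positivity) (by positivity), mul_inv, inv_inv]
    linarith
  calc (1 + x + s) ^ (1 - ν) * (1 + |x - s|)⁻¹ ≤
      (2 ^ |1 - ν| * (1 + r + t) ^ (1 - ν)) * (2 * (1 + |r - t|)⁻¹) :=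
        mul_le_mul a1 a2 (by positivity) (by positivity)
    _ = _ := by ring

lemma WZ_near {ν x r t : ℝ} (hx : 0 < x) (hxr : x ≤ r) (ht : 0 ≤ t) (h : r ≤ 1 ∨ 2 * r ≤ t) :
    WZ ν x t ≤ cw ν * WZ ν r t := by
  refine WZ_cmp hx ht (by linarith) ht (by linarith) ?_ ?_
  · rcases h with h | h <;> linarith
  · rcases h with h | h
    · have := abs_sub_le r x t
      rw [abs_of_nonneg (by linarith : 0 ≤ r - x)] at this
      have := abs_nonneg (x - t)
      linarith
    · rw [abs_of_nonpos (by linarith), abs_of_nonpos (by linarith)]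
      linarith

lemma WZ_zero {ν x s r : ℝ} (hr : 0 < r) {δ : ℝ} (hδ1 : δ ≤ 1/4) (hδr : δ ≤ r/4)
    (hx : |x - r| < δ) (hs : 0 < s) (hsδ : s < δ) : WZ ν x s ≤ cw ν * WZ ν r 0 := by
  obtain ⟨h1, h2⟩ := abs_lt.1 hx
  refine WZ_cmp (by linarith) hs.le hr le_rfl (by linarith) (by linarith) ?_
  rw [abs_of_nonneg (by linarith : 0 ≤ r - 0), abs_of_nonneg (by linarith : 0 ≤ x - s)]
  linarith

lemma bracket1_parts {u : ℝ → ℝ → ℝ} {r t N : ℝ} (hr : 0 < r) (h : bracket1 u r t ≤ N) :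
    r * |pdt u r t| ≤ N := by
  unfold bracket1 at h
  have : 0 ≤ r * |pdr u r t| := by positivity
  have := abs_nonneg (u r t)
  linarith

lemma bracket2_parts {u : ℝ → ℝ → ℝ} {r t N : ℝ} (hr : 0 < r) (h : bracket2 u r t ≤ N) :
    (1 + r) * |pdt u r t| ≤ N ∧ r * |pdr (pdt u) r t| ≤ N ∧ r * |pdt (pdt u) r t| ≤ N := by
  unfold bracket2 at h
  have h1 : 0 ≤ (1 + r) * |pdr u r t| := by positivity
  have h2 : 0 ≤ (1 + r) * |pdt u r t| := by positivity
  have h3 : 0 ≤ r * |pdr (pdr u) r t| := by positivity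
  have h4 : 0 ≤ r * |pdr (pdt u) r t| := by positivity
  have h5 : 0 ≤ r * |pdt (pdt u) r t| := by positivity
  have := abs_nonneg (u r t)
  exact ⟨by linarith, by linarith, by linarith⟩

lemma T0_1 {u : ℝ → ℝ → ℝ} {ν N : ℝ} (hu : Reg u) (hN : 0 ≤ N)
    (h : ∀ r t, 0 < r → 0 < t → bracket1 u r t ≤ N * WZ ν r t)
    (h0 : ∀ r, 0 < r → rpart1 u r 0 ≤ N * WZ ν r 0) :
    ∀ r t, 0 < r → 0 ≤ t → bracket1 u r t ≤ 5 * cw ν * N * WZ ν r t := by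
  intro r t hr ht
  have hcw := cw_ge ν
  have hW := WZ_pos (ν := ν) hr ht
  rcases ht.eq_or_lt with rfl | ht
  · have hδ : 0 < min (1/4) (r/4) := by positivity
    have e1 : r * |pdt u r 0| ≤ cw ν * N * WZ ν r 0 := by
      rw [mul_comm, ← le_div_iff₀ hr]
      refine abs_deriv_zero_le hδ (fun t h1 _ => hu.dt r t hr h1) fun t h1 h2 => ?_
      rw [le_div_iff₀ hr, mul_comm]
      refine (bracket1_parts hr (h r t hr h1)).trans ?_
      have := mul_le_mul_of_nonneg_left (WZ_zero (ν := ν) hr (min_le_left _ _) (min_le_right _ _)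
        (x := r) (by simpa using hδ) h1 h2) hN
      linarith
    have e2 := h0 r hr
    have e3 : N * WZ ν r 0 ≤ cw ν * (N * WZ ν r 0) := le_mul_of_one_le_left (by positivity) hcw
    have : 0 ≤ cw ν * (N * WZ ν r 0) := by positivity
    unfold rpart1 at e2
    unfold bracket1
    linarith
  · have := h r t hr ht
    have e3 : N * WZ ν r t ≤ cw ν * (N * WZ ν r t) := le_mul_of_one_le_left (by positivity) hcw
    have : 0 ≤ cw ν * (N * WZ ν r t) := by positivity
    linarith

lemma T0_2 {u : ℝ → ℝ → ℝ} {ν N : ℝ} (hu : Reg u) (hN : 0 ≤ N)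
    (h : ∀ r t, 0 < r → 0 < t → bracket2 u r t ≤ N * WZ ν r t)
    (h0 : ∀ r, 0 < r → rpart2 u r 0 ≤ N * WZ ν r 0) :
    ∀ r t, 0 < r → 0 ≤ t → bracket2 u r t ≤ 5 * cw ν * N * WZ ν r t := by
  intro r t hr ht
  have hcw := cw_ge ν
  have hW := WZ_pos (ν := ν) hr ht
  rcases ht.eq_or_lt with rfl | ht
  · have hδ : 0 < min (1/4) (r/4) := by positivity
    have hr1 : 0 < 1 + r := by linarith
    have hb : ∀ x t, |x - r| < min (1/4) (r/4) → 0 < t → t < min (1/4) (r/4) →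
        r / 2 < x ∧ bracket2 u x t ≤ cw ν * N * WZ ν r 0 := by
      intro x t hx h1 h2
      have hx2 : r / 2 < x := by
        have := (abs_lt.1 hx).1
        have := min_le_right (1/4) (r/4)
        linarith
      refine ⟨hx2, (h x t (by linarith) h1).trans ?_⟩
      have := mul_le_mul_of_nonneg_left (WZ_zero (ν := ν) hr (min_le_left _ _) (min_le_right _ _)
        hx h1 h2) hN
      linarith
    have e1 : (1 + r) * |pdt u r 0| ≤ cw ν * N * WZ ν r 0 := by
      rw [mul_comm, ← le_div_iff₀ hr1]
      refine abs_deriv_zero_le hδ (fun t h1 _ => hu.dt r t hr h1) fun t h1 h2 => ?_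
      rw [le_div_iff₀ hr1, mul_comm]
      exact (bracket2_parts hr (hb r t (by simpa using hδ) h1 h2).2).1
    have e4 : r * |pdt (pdt u) r 0| ≤ cw ν * N * WZ ν r 0 := by
      rw [mul_comm, ← le_div_iff₀ hr]
      refine abs_deriv_zero_le hδ (fun t h1 _ => hu.dtt r t hr h1) fun t h1 h2 => ?_
      rw [le_div_iff₀ hr, mul_comm]
      exact (bracket2_parts hr (hb r t (by simpa using hδ) h1 h2).2).2.2
    have hP : 0 ≤ cw ν * N * WZ ν r 0 := by positivity
    have aux : ∀ y x : ℝ, r / 2 < x → x * |y| ≤ cw ν * N * WZ ν r 0 →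
        |y| ≤ 2 * (cw ν * N * WZ ν r 0) / r := by
      intro y x hx hy
      rw [le_div_iff₀ hr]
      have : r / 2 * |y| ≤ x * |y| := mul_le_mul_of_nonneg_right hx.le (abs_nonneg _)
      linarith
    have e5 : r * |pdr (pdt u) r 0| ≤ 2 * (cw ν * N * WZ ν r 0) := by
      rw [mul_comm, ← le_div_iff₀ hr]
      refine abs_pdr_pdt_zero_le hu hδ (by have := min_le_right (1/4) (r/4); linarith)
        (K := 2 * (cw ν * N * WZ ν r 0) / r) ?_ ?_
      · intro x t hx h1 h2
        obtain ⟨h3, h4⟩ := hb x t hx h1 h2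
        exact aux _ x h3 (bracket2_parts (by linarith) h4).2.1
      · intro x t hx h1 h2
        obtain ⟨h3, h4⟩ := hb x t hx h1 h2
        exact aux _ x h3 (bracket2_parts (by linarith) h4).2.2
    have e2 := h0 r hr
    have e3 : N * WZ ν r 0 ≤ cw ν * (N * WZ ν r 0) := le_mul_of_one_le_left (by positivity) hcw
    unfold rpart2 at e2
    unfold bracket2
    linarith
  · have := h r t hr ht
    have e3 : N * WZ ν r t ≤ cw ν * (N * WZ ν r t) := le_mul_of_one_le_left (by positivity) hcw
    have : 0 ≤ cw ν * (N * WZ ν r t) := by positivity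
    linarith

lemma absrt_le {r t : ℝ} (hr : 0 < r) (ht : 0 ≤ t) : |r - t| ≤ r + t :=
  abs_le.2 ⟨by linarith, by linarith⟩

lemma mm_le_inv {η x : ℝ} (hη : 0 < η) : mm η x ≤ (1 + |x|)⁻¹ := by
  unfold mm
  rw [← Real.rpow_neg_one]
  have := abs_nonneg x
  exact Real.rpow_le_rpow_of_exponent_le (by linarith) (by linarith)

lemma BR_le {ν η r t : ℝ} (hη : 0 < η) (hr : 0 < r) (ht : 0 ≤ t) : BR ν η r t ≤ 2 * WZ ν r t := by
  unfold BR WZ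
  have h0 : 0 < 1 + r + t := by linarith
  have h1 : (1 + r + t) ^ (-ν) = (1 + r + t) ^ (1 - ν) * (1 + r + t)⁻¹ := by
    rw [← Real.rpow_neg_one (1 + r + t), ← Real.rpow_add h0]; ring_nf
  have h2 : (1 + r + t)⁻¹ ≤ (1 + |r - t|)⁻¹ :=
    inv_anti₀ (by positivity) (by linarith [absrt_le hr ht])
  have h3 := mul_le_mul_of_nonneg_left h2 (by positivity : 0 ≤ (1 + r + t) ^ (1 - ν))
  have h4 := mul_le_mul_of_nonneg_left (mm_le_inv (x := r - t) hη) (by positivity : 0 ≤ (1 + r + t) ^ (1 - ν))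
  rw [h1]
  linarith

lemma BL_le {ν η r t : ℝ} (hν : ν < 1) (hη : 0 < η) (hr : 0 < r) (ht : 0 ≤ t) :
    BL ν η r t ≤ 2 * WZ ν r t := by
  unfold BL WZ
  have h0 : 0 < 1 + r + t := by linarith
  have hd : 0 < 1 + |r - t| := by positivity
  have h1 : (1 + |r - t|) ^ (-ν) = (1 + |r - t|) ^ (1 - ν) * (1 + |r - t|)⁻¹ := by
    rw [← Real.rpow_neg_one (1 + |r - t|), ← Real.rpow_add hd]; ring_nf
  have h2 : (1 + |r - t|) ^ (1 - ν) ≤ (1 + r + t) ^ (1 - ν) :=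
    Real.rpow_le_rpow hd.le (by linarith [absrt_le hr ht]) (by linarith)
  have h3 := mul_le_mul_of_nonneg_right h2 (by positivity : 0 ≤ (1 + |r - t|)⁻¹)
  have h4 := mul_le_mul_of_nonneg_left (mm_le_inv (x := r - t) hη) (by positivity : 0 ≤ (1 + r + t) ^ (1 - ν))
  rw [h1]
  linarith

end Wsec



section Ubd
variable {h Q Qc : ℝ → ℝ → ℝ}

lemma QD.contQt (H : QD h Q Qc) (x : ℝ) : ContinuousOn (fun t => Q (x - t) t) (Set.Ici 0) := by
  intro t ht
  have ht : 0 ≤ t := ht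
  obtain ⟨L, hL0, hL⟩ := H.joint (t + 1)
  rw [ContinuousWithinAt, tendsto_iff_dist_tendsto_zero]
  have hlim : Tendsto (fun s : ℝ => L * (|x - s - (x - t)| + |s - t|)) (nhdsWithin t (Set.Ici 0)) (nhds 0) := by
    have : Continuous (fun s : ℝ => L * (|x - s - (x - t)| + |s - t|)) := by fun_prop
    have h2 := this.tendsto t
    simp only [sub_self, abs_zero, add_zero, mul_zero] at h2
    exact h2.mono_left nhdsWithin_le_nhds
  refine squeeze_zero' (Eventually.of_forall fun _ => dist_nonneg) ?_ hlim
  filter_upwards [self_mem_nhdsWithin, nhdsWithin_le_nhds (Iio_mem_nhds (by linarith : t < t + 1))] with s hs hs2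
  have hs : 0 ≤ s := hs
  have hs2 : s < t + 1 := hs2
  rw [Real.dist_eq]
  exact hL _ _ _ _ hs ht hs2.le (by linarith)

lemma QD.contU (H : QD h Q Qc) (r : ℝ) : ContinuousOn (fun t => UQ Q r t) (Set.Ici 0) := by
  intro t ht
  have ht : 0 ≤ t := ht
  obtain ⟨L, hL0, hL⟩ := H.joint (t + 1)
  rw [ContinuousWithinAt, tendsto_iff_dist_tendsto_zero]
  have hlim : Tendsto (fun s : ℝ => 1/2 * (L * (|t - s| + |s - t|) * |r - -r|)) (nhdsWithin t (Set.Ici 0)) (nhds 0) := by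
    have : Continuous (fun s : ℝ => 1/2 * (L * (|t - s| + |s - t|) * |r - -r|)) := by fun_prop
    have h2 := this.tendsto t
    simp only [sub_self, abs_zero, add_zero, mul_zero, zero_mul] at h2
    exact h2.mono_left nhdsWithin_le_nhds
  refine squeeze_zero' (Eventually.of_forall fun _ => dist_nonneg) ?_ hlim
  filter_upwards [self_mem_nhdsWithin, nhdsWithin_le_nhds (Iio_mem_nhds (by linarith : t < t + 1))] with s hs hs2
  have hs : 0 ≤ s := hs
  have hs2 : s < t + 1 := hs2
  rw [Real.dist_eq]
  unfold UQ
  have hi : ∀ τ, 0 ≤ τ → IntervalIntegrable (fun x => Q (x - τ) τ) volume (-r) r :=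
    fun τ hτ => (H.contshift hτ).intervalIntegrable _ _
  rw [← mul_sub, ← intervalIntegral.integral_sub (hi s hs) (hi t ht), abs_mul,
    abs_of_pos (by norm_num : (0:ℝ) < 1/2)]
  refine mul_le_mul_of_nonneg_left ?_ (by norm_num)
  refine intervalIntegral.norm_integral_le_of_norm_le_const (f := fun x => Q (x - s) s - Q (x - t) t)
    fun x _ => ?_
  have := hL (x - s) (x - t) s t hs ht hs2.le (by linarith)
  rw [show x - s - (x - t) = t - s by ring] at this
  exact this

lemma QD.U_incr (H : QD h Q Qc) (r : ℝ) {t T : ℝ} (ht : 0 ≤ t) (hT : t ≤ T) {g : ℝ → ℝ}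
    (hg : IntervalIntegrable g volume t T)
    (hb : ∀ s, t < s → s ≤ T → |(1/2) * (Q (-r - s) s - Q (r - s) s)| ≤ g s) :
    |UQ Q r T - UQ Q r t| ≤ ∫ s in t..T, g s := by
  have hcu : ContinuousOn (fun s => (1/2) * (Q (-r - s) s - Q (r - s) s)) (Set.Icc t T) :=
    (continuousOn_const.mul ((H.contQt (-r)).sub (H.contQt r))).mono
      (fun s hs => ht.trans hs.1)
  have hii : IntervalIntegrable (fun s => (1/2) * (Q (-r - s) s - Q (r - s) s)) volume t T := by
    apply ContinuousOn.intervalIntegrable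
    rwa [Set.uIcc_of_le hT]
  rw [← intervalIntegral.integral_eq_sub_of_hasDerivAt_of_le hT
    ((H.contU r).mono fun s hs => ht.trans hs.1)
    (fun s hs => H.U_t r (lt_of_le_of_lt ht hs.1)) hii]
  refine intervalIntegral.norm_integral_le_of_norm_le
    (f := fun s => (1/2) * (Q (-r - s) s - Q (r - s) s)) hT ?_ hg
  exact Eventually.of_forall fun s hs => hb s hs.1 hs.2

/-- Near region bound by integrating in `r`. -/
lemma QD.U_near (H : QD h Q Qc) {r t M : ℝ} (hr : 0 < r) (ht : 0 ≤ t)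
    (hb : ∀ x, 0 < x → x ≤ r → |Q (x - t) t| ≤ M ∧ |Q (-x - t) t| ≤ M) :
    |UQ Q r t| ≤ M * r := by
  unfold UQ
  have := intervalIntegral.norm_integral_le_of_norm_le_const_ae (f := fun x => Q (x - t) t)
    (a := -r) (b := r) (C := M) (by
      have h0 : ∀ᵐ x : ℝ, x ≠ 0 := by simp [ae_iff]
      filter_upwards [h0] with x hx hxr
      rw [Set.uIoc_of_le (by linarith)] at hxr
      rcases lt_or_gt_of_ne hx with h | h
      · have := (hb (-x) (by linarith) (by linarith [hxr.1])).2
        rwa [neg_neg] at this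
      · exact (hb x h hxr.2).1)
  rw [abs_mul, abs_of_pos (by norm_num : (0:ℝ) < 1/2)]
  rw [Real.norm_eq_abs, abs_of_pos (by linarith : 0 < r - -r)] at this
  linarith

lemma WZ_far {ν r t : ℝ} (hr : 1 ≤ r) (ht : 0 ≤ t) (htr : t < 2 * r) :
    (1 + r + t) ^ (1 - ν) ≤ 2 * r * WZ ν r t := by
  unfold WZ
  have hd : 1 + |r - t| ≤ 2 * r := by
    have : |r - t| ≤ r := abs_le.2 ⟨by linarith, by linarith⟩
    linarith
  have hd0 : 0 < 1 + |r - t| := by positivity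
  have hp : 0 < (1 + r + t) ^ (1 - ν) := by positivity
  rw [show 2 * r * ((1 + r + t) ^ (1 - ν) * (1 + |r - t|)⁻¹) =
    (1 + r + t) ^ (1 - ν) * ((2 * r) * (1 + |r - t|)⁻¹) by ring]
  refine le_mul_of_one_le_right hp.le ?_
  rw [← div_eq_mul_inv, le_div_iff₀ hd0]
  linarith

lemma QD.U_near' (H : QD h Q Qc) {ν r t N : ℝ} (hr : 0 < r) (ht : 0 ≤ t) (hN : 0 ≤ N)
    (hreg : r ≤ 1 ∨ 2 * r ≤ t)
    (hb : ∀ x, 0 < x → |Q (x - t) t| ≤ N * WZ ν x t ∧ |Q (-x - t) t| ≤ N * WZ ν x t) :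
    |UQ Q r t| ≤ (N * cw ν) * r * WZ ν r t := by
  have := H.U_near (M := N * (cw ν * WZ ν r t)) hr ht fun x hx hxr => by
    have h1 := mul_le_mul_of_nonneg_left (WZ_near (ν := ν) hx hxr ht hreg) hN
    exact ⟨(hb x hx).1.trans h1, (hb x hx).2.trans h1⟩
  linarith

lemma QD.U_R (H : QD h Q Qc) {ν η N : ℝ} (hν : 1 < ν) (hη : 0 < η) (hN : 0 ≤ N)
    (hb : ∀ x t, 0 < x → 0 ≤ t → |Q (x - t) t| ≤ N * BR ν η x t ∧ |Q (-x - t) t| ≤ N * BR ν η x t)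
    {r t : ℝ} (hr : 0 < r) (ht : 0 ≤ t) :
    |UQ Q r t| ≤ (N * (2 * cw ν + 2 * (Imm η + 1 / (ν - 1)))) * r * WZ ν r t := by
  have hW := WZ_pos (ν := ν) hr ht
  have hcw := cw_ge ν
  have hI := Imm_nonneg η
  have hν' : 0 < ν - 1 := by linarith
  have hb2 : ∀ t, 0 ≤ t → ∀ x, 0 < x → |Q (x - t) t| ≤ (2 * N) * WZ ν x t ∧
      |Q (-x - t) t| ≤ (2 * N) * WZ ν x t := by
    intro t ht x hx
    have h1 := mul_le_mul_of_nonneg_left (BR_le (ν := ν) hη hx ht) hN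
    exact ⟨(hb x t hx ht).1.trans (by linarith), (hb x t hx ht).2.trans (by linarith)⟩
  by_cases hreg : r ≤ 1 ∨ 2 * r ≤ t
  · have := H.U_near' hr ht (by linarith : 0 ≤ 2 * N) hreg (hb2 t ht)
    refine this.trans ?_
    have : 0 ≤ N * (2 * (Imm η + 1 / (ν - 1))) * r * WZ ν r t := by positivity
    linarith
  · push Not at hreg
    obtain ⟨hr1, htr⟩ := hreg
    have key : ∀ T, t ≤ T → |UQ Q r T - UQ Q r t| ≤ N * (Imm η + 1 / (ν - 1)) * (1 + r + t) ^ (1 - ν) := by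
      intro T hT
      obtain ⟨i1, e1⟩ := pow_int (ν := ν) (a := 1 + r) (t := t) hν (by linarith)
      have i2 : Integrable (fun s => mm η (r - s)) := (mm_int hη).comp_sub_left r
      have i3 : IntegrableOn (fun s => N * (mm η (r - s) * (1 + r + t) ^ (1 - ν) + (1 + r + s) ^ (-ν)))
        (Set.Ioi t) := ((i2.integrableOn.mul_const _).add i1).const_mul _
      refine (H.U_incr r ht hT (g := fun s => N * (mm η (r - s) * (1 + r + t) ^ (1 - ν) + (1 + r + s) ^ (-ν)))
        ?_ ?_).trans ?_
      · rw [intervalIntegrable_iff_integrableOn_Ioc_of_le hT]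
        exact i3.mono_set Set.Ioc_subset_Ioi_self
      · intro s hs hsT
        obtain ⟨h1, h2⟩ := hb r s hr (by linarith)
        have h3 : BR ν η r s ≤ mm η (r - s) * (1 + r + t) ^ (1 - ν) + (1 + r + s) ^ (-ν) := by
          unfold BR
          have := mul_le_mul_of_nonneg_left (rp_anti (ν := ν - 1) (by linarith : 0 < 1 + r + t)
            (by linarith : 1 + r + t ≤ 1 + r + s) (by linarith)) (mm_pos η (r - s)).le
          rw [neg_sub] at this
          linarith
        have h4 := mul_le_mul_of_nonneg_left h3 hN
        rw [abs_mul, abs_of_pos (by norm_num : (0:ℝ) < 1/2)]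
        have h5 := abs_sub (Q (-r - s) s) (Q (r - s) s)
        linarith
      · rw [intervalIntegral.integral_of_le hT]
        refine (setIntegral_mono_set i3 ?_ (Set.Ioc_subset_Ioi_self.eventuallyLE)).trans ?_
        · filter_upwards [ae_restrict_mem measurableSet_Ioi] with s hs
          have hs : t < s := hs
          have := mm_pos η (r - s)
          have h6 : 0 ≤ (1 + r + s) ^ (-ν) := Real.rpow_nonneg (by linarith) _
          simp only [Pi.zero_apply]
          positivity
        · rw [integral_const_mul, integral_add (i2.integrableOn.mul_const _) i1, integral_mul_const, e1]
          have h7 : ∫ s in Set.Ioi t, mm η (r - s) ≤ Imm η := by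
            refine (setIntegral_le_integral i2 (Eventually.of_forall fun s => (mm_pos _ _).le)).trans ?_
            rw [integral_sub_left_eq_self]; rfl
          have h8 := mul_le_mul_of_nonneg_right h7 (by positivity : 0 ≤ (1 + r + t) ^ (1 - ν))
          rw [mul_assoc]
          refine mul_le_mul_of_nonneg_left ?_ hN
          rw [add_mul, one_div_mul_eq_div]
          linarith
    have hlim : Tendsto (fun T => UQ Q r T) atTop (nhds 0) := by
      have h1 : Tendsto (fun T => (2 * N * cw ν) * r * (1 + r + T) ^ (1 - ν)) atTop (nhds 0) := by
        have h1 := (tendsto_rpow_neg_atTop (y := ν - 1) (by linarith)).comp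
          (tendsto_atTop_add_const_left atTop (1 + r) tendsto_id)
        have := h1.const_mul ((2 * N * cw ν) * r)
        rw [mul_zero] at this
        refine this.congr fun s => ?_
        simp [Function.comp]
      refine squeeze_zero_norm' ?_ h1
      filter_upwards [eventually_ge_atTop (2 * r)] with T hT
      refine (H.U_near' hr (by linarith) (by linarith : 0 ≤ 2 * N) (Or.inr hT) (hb2 T (by linarith))).trans ?_
      refine mul_le_mul_of_nonneg_left ?_ (by positivity)
      unfold WZ
      refine mul_le_of_le_one_right (Real.rpow_nonneg (by linarith) _) ?_
      exact inv_le_one_of_one_le₀ (by have := abs_nonneg (r - T); linarith)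
    have h2 : |0 - UQ Q r t| ≤ N * (Imm η + 1 / (ν - 1)) * (1 + r + t) ^ (1 - ν) :=
      le_of_tendsto ((hlim.sub_const _).abs) (by
        filter_upwards [eventually_ge_atTop t] with T hT using key T hT)
    rw [zero_sub, abs_neg] at h2
    refine h2.trans ?_
    have h3 := mul_le_mul_of_nonneg_left (WZ_far (ν := ν) hr1.le ht htr)
      (by positivity : 0 ≤ N * (Imm η + 1 / (ν - 1)))
    have : 0 ≤ N * (2 * cw ν) * r * WZ ν r t := by positivity
    linarith

lemma QD.U_L (H : QD h Q Qc) (hQ0 : ∀ c, Q c 0 = 0) {ν η N : ℝ} (hν0 : 0 ≤ ν) (hν : ν < 1)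
    (hη : 0 < η) (hN : 0 ≤ N)
    (hb : ∀ x t, 0 < x → 0 ≤ t → |Q (x - t) t| ≤ N * BL ν η x t ∧ |Q (-x - t) t| ≤ N * BL ν η x t)
    {r t : ℝ} (hr : 0 < r) (ht : 0 ≤ t) :
    |UQ Q r t| ≤ (N * (2 * cw ν + 2 * (Imm η + 2 / (1 - ν)))) * r * WZ ν r t := by
  have hW := WZ_pos (ν := ν) hr ht
  have hcw := cw_ge ν
  have hI := Imm_nonneg η
  have hν' : 0 < 1 - ν := by linarith
  have hb2 : ∀ x, 0 < x → |Q (x - t) t| ≤ (2 * N) * WZ ν x t ∧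
      |Q (-x - t) t| ≤ (2 * N) * WZ ν x t := by
    intro x hx
    have h1 := mul_le_mul_of_nonneg_left (BL_le hν hη hx ht) hN
    exact ⟨(hb x t hx ht).1.trans (by linarith), (hb x t hx ht).2.trans (by linarith)⟩
  by_cases hreg : r ≤ 1 ∨ 2 * r ≤ t
  · have := H.U_near' hr ht (by linarith : 0 ≤ 2 * N) hreg hb2
    refine this.trans ?_
    have : 0 ≤ N * (2 * (Imm η + 2 / (1 - ν))) * r * WZ ν r t := by positivity
    linarith
  · push Not at hreg
    obtain ⟨hr1, htr⟩ := hreg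
    have hU0 : UQ Q r 0 = 0 := by unfold UQ; simp [hQ0]
    have key : |UQ Q r t - UQ Q r 0| ≤ N * (Imm η + 2 / (1 - ν)) * (1 + r + t) ^ (1 - ν) := by
      have i2 : Integrable (fun s => mm η (r - s)) := (mm_int hη).comp_sub_left r
      have hfc : Continuous (fun x : ℝ => (1 + |x|) ^ (-ν)) :=
        Continuous.rpow_const (by fun_prop) fun x => Or.inl (by positivity)
      have hgc : Continuous (fun s : ℝ => (1 + |r - s|) ^ (-ν)) := hfc.comp (by fun_prop)
      have i3 : IntervalIntegrable (fun s => mm η (r - s) * (1 + r + t) ^ (1 - ν)) volume 0 t :=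
        (i2.mul_const _).intervalIntegrable
      have i4 := hgc.intervalIntegrable (μ := volume) 0 t
      refine (H.U_incr r le_rfl ht (g := fun s => N * (mm η (r - s) * (1 + r + t) ^ (1 - ν) + (1 + |r - s|) ^ (-ν)))
        ((i3.add i4).const_mul N) ?_).trans ?_
      · intro s hs hsT
        obtain ⟨h1, h2⟩ := hb r s hr (by linarith)
        have h3 : BL ν η r s ≤ mm η (r - s) * (1 + r + t) ^ (1 - ν) + (1 + |r - s|) ^ (-ν) := by
          unfold BL
          have := mul_le_mul_of_nonneg_left (Real.rpow_le_rpow (z := 1 - ν) (by linarith : 0 ≤ 1 + r + s)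
            (by linarith : 1 + r + s ≤ 1 + r + t) (by linarith)) (mm_pos η (r - s)).le
          linarith
        have h4 := mul_le_mul_of_nonneg_left h3 hN
        rw [abs_mul, abs_of_pos (by norm_num : (0:ℝ) < 1/2)]
        have h5 := abs_sub (Q (-r - s) s) (Q (r - s) s)
        linarith
      · rw [intervalIntegral.integral_const_mul, intervalIntegral.integral_add i3 i4,
          intervalIntegral.integral_mul_const]
        have h7 : ∫ s in (0:ℝ)..t, mm η (r - s) ≤ Imm η := by
          rw [intervalIntegral.integral_of_le ht]
          refine (setIntegral_le_integral i2 (Eventually.of_forall fun s => (mm_pos _ _).le)).trans ?_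
          rw [integral_sub_left_eq_self]; rfl
        have h8 := mul_le_mul_of_nonneg_right h7 (by positivity : 0 ≤ (1 + r + t) ^ (1 - ν))
        have h9 : ∫ s in (0:ℝ)..t, (1 + |r - s|) ^ (-ν) ≤ 2 / (1 - ν) * (1 + r + t) ^ (1 - ν) := by
          rw [intervalIntegral.integral_comp_sub_left (fun x => (1 + |x|) ^ (-ν)) r]
          have m1 : ∫ x in (r - t)..(r - 0), (1 + |x|) ^ (-ν) ≤ ∫ x in (-(r + t))..(r + t), (1 + |x|) ^ (-ν) :=
            intervalIntegral.integral_mono_interval (by linarith) (by linarith) (by linarith)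
              (Eventually.of_forall fun x => by simp only [Pi.zero_apply]; positivity)
              (hfc.intervalIntegrable _ _)
          refine m1.trans ?_
          rw [← intervalIntegral.integral_add_adjacent_intervals (b := 0)
            (hfc.intervalIntegrable _ _) (hfc.intervalIntegrable _ _)]
          have m2 : ∫ x in (-(r + t))..0, (1 + |x|) ^ (-ν) = ∫ x in (0:ℝ)..(r + t), (1 + |x|) ^ (-ν) := by
            have := intervalIntegral.integral_comp_neg (a := 0) (b := r + t) (fun x : ℝ => (1 + |x|) ^ (-ν))
            simp only [abs_neg, neg_zero] at this
            exact this.symm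
          have m3 : ∫ x in (0:ℝ)..(r + t), (1 + |x|) ^ (-ν) = ∫ x in (0:ℝ)..(r + t), (1 + x) ^ (-ν) := by
            refine intervalIntegral.integral_congr fun x hx => ?_
            rw [Set.uIcc_of_le (by linarith)] at hx
            simp only [abs_of_nonneg hx.1]
          have m4 := (pow_int_fin (ν := ν) (t := r + t) hν (by linarith)).2
          rw [m2, m3, intervalIntegral.integral_of_le (by linarith)]
          rw [← add_assoc] at m4
          rw [div_mul_eq_mul_div, mul_div_assoc]
          linarith
        rw [mul_assoc]
        refine mul_le_mul_of_nonneg_left ?_ hN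
        rw [add_mul]
        linarith
    rw [hU0, sub_zero] at key
    refine key.trans ?_
    have h3 := mul_le_mul_of_nonneg_left (WZ_far (ν := ν) hr1.le ht htr)
      (by positivity : 0 ≤ N * (Imm η + 2 / (1 - ν)))
    have : 0 ≤ N * (2 * cw ν) * r * WZ ν r t := by positivity
    linarith

end Ubd



section RL

structure SrcQ (F : ℝ → ℝ → ℝ) (B : ℝ → ℝ) (ν η : ℝ) (k : ℝ → ℝ) (M₁ M₂ : ℝ) : Prop where
  src : Src F B
  M1 : 0 ≤ M₁
  M2 : 0 ≤ M₂
  h1 : ∀ x s, 0 < x → 0 < s → |hh F x s| ≤ M₁ * PhiS ν η k x s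
  h2 : ∀ x s, 0 < x → 0 < s → |dhh F x s| ≤ M₂ * PhiS ν η k x s
  hW : ∀ x s, 0 < x → 0 < s → |hh F x s| ≤ M₁ * WZ ν x s

structure Ker (k : ℝ → ℝ) : Prop where
  nonneg : ∀ x, 0 ≤ k x
  int : Integrable k
  even : ∀ x, k (-x) = k x

variable {F : ℝ → ℝ → ℝ} {B : ℝ → ℝ} {ν η M₁ M₂ : ℝ} {k : ℝ → ℝ}

lemma PhiS_even (hk : Ker k) (x s : ℝ) : PhiS ν η k (-x) s = PhiS ν η k x s := by
  unfold PhiS; rw [abs_neg, hk.even]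

lemma SrcQ.h1' (S : SrcQ F B ν η k M₁ M₂) (hk : Ker k) {x s : ℝ} (hx : x ≠ 0) (hs : 0 < s) :
    |hh F x s| ≤ M₁ * PhiS ν η k x s := by
  rcases lt_or_gt_of_ne hx with h | h
  · have := S.h1 (-x) s (by linarith) hs
    rwa [S.src.odd x hs, abs_neg, PhiS_even hk] at this
  · exact S.h1 x s h hs

lemma SrcQ.h2' (S : SrcQ F B ν η k M₁ M₂) (hk : Ker k) {x s : ℝ} (hx : x ≠ 0) (hs : 0 < s) :
    |dhh F x s| ≤ M₂ * PhiS ν η k x s := by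
  rcases lt_or_gt_of_ne hx with h | h
  · have := S.h2 (-x) s (by linarith) hs
    rwa [S.src.dhh_even x hs, PhiS_even hk] at this
  · exact S.h2 x s h hs

lemma SrcQ.ae1 (S : SrcQ F B ν η k M₁ M₂) (hk : Ker k) (c : ℝ) {I : Set ℝ} (hI : MeasurableSet I)
    (hI0 : I ⊆ Set.Ioi 0) :
    ∀ᵐ s ∂(volume.restrict I), |hh F (s + c) s| ≤ M₁ * PhiS ν η k (s + c) s := by
  filter_upwards [ae_ne c I, ae_restrict_mem hI] with s h1 h2
  exact S.h1' hk h1 (hI0 h2)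

lemma SrcQ.ae2 (S : SrcQ F B ν η k M₁ M₂) (hk : Ker k) (c : ℝ) {I : Set ℝ} (hI : MeasurableSet I)
    (hI0 : I ⊆ Set.Ioi 0) :
    ∀ᵐ s ∂(volume.restrict I), |dhh F (s + c) s| ≤ M₂ * PhiS ν η k (s + c) s := by
  filter_upwards [ae_ne c I, ae_restrict_mem hI] with s h1 h2
  exact S.h2' hk h1 (hI0 h2)

theorem R_bound (hν : 1 < ν) (hη : 0 < η) (hk : Ker k) :
    ∃ C > 0, ∀ F B M₁ M₂, SrcQ F B ν η k M₁ M₂ → IntegrableOn B (Set.Ioi 0) →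
      Reg (Rop F) ∧ (∀ r t, 0 < r → 0 ≤ t → bracket1 (Rop F) r t ≤ C * M₁ * WZ ν r t) ∧
      (∀ r t, 0 < r → 0 ≤ t → bracket2 (Rop F) r t ≤ C * (M₁ + M₂) * WZ ν r t) := by
  set c₀ := CR ν η k with hc₀
  have hc0 : 0 ≤ c₀ := CR_nonneg hν hk.nonneg
  have hcw := cw_ge ν
  have hI := Imm_nonneg η
  have hν' : 0 < ν - 1 := by linarith
  set A := c₀ * (2 * cw ν + 2 * (Imm η + 1 / (ν - 1))) + 2 * c₀ + 1 with hA
  have hAp : 0 ≤ c₀ * (2 * cw ν + 2 * (Imm η + 1 / (ν - 1))) := by positivity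
  have hA0 : 0 < A := by positivity
  refine ⟨5 * cw ν * (14 * A + 12 * cw ν * A), by positivity, ?_⟩
  intro F B M₁ M₂ S hB
  have hM1 := S.M1
  have hM2 := S.M2
  have H := S.src.RQD hB
  have E := S.src.RUR hB
  have hreg := E.reg H
  have b1 : ∀ x t, 0 < x → 0 ≤ t → |RQ F (x - t) t| ≤ (M₁ * c₀) * BR ν η x t ∧
      |RQ F (-x - t) t| ≤ (M₁ * c₀) * BR ν η x t := by
    intro x t hx ht
    rw [mul_assoc]
    exact ⟨R_plus hν hk.nonneg hk.int hx ht hM1 (S.ae1 hk _ measurableSet_Ioi (Ioi_sub ht)),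
      R_minus hν hη hk.nonneg hk.int hx ht hM1 (S.ae1 hk _ measurableSet_Ioi (Ioi_sub ht))⟩
  have b2 : ∀ x t, 0 < x → 0 ≤ t → |RQc F (x - t) t| ≤ (M₂ * c₀) * BR ν η x t ∧
      |RQc F (-x - t) t| ≤ (M₂ * c₀) * BR ν η x t := by
    intro x t hx ht
    rw [mul_assoc]
    exact ⟨R_plus hν hk.nonneg hk.int hx ht hM2 (S.ae2 hk _ measurableSet_Ioi (Ioi_sub ht)),
      R_minus hν hη hk.nonneg hk.int hx ht hM2 (S.ae2 hk _ measurableSet_Ioi (Ioi_sub ht))⟩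
  have hcmp : ∀ M, 0 ≤ M → ∀ x t, 0 < x → 0 ≤ t → (M * c₀) * BR ν η x t ≤ (M * A) * WZ ν x t := by
    intro M hM x t hx ht
    have hW := WZ_pos (ν := ν) hx ht
    have h1 := mul_le_mul_of_nonneg_left (BR_le (ν := ν) hη hx ht) (by positivity : 0 ≤ M * c₀)
    have h2 : M * (2 * c₀) ≤ M * A := mul_le_mul_of_nonneg_left (by linarith) hM
    have h3 := mul_le_mul_of_nonneg_right h2 hW.le
    linarith
  have qb : ∀ t, 0 ≤ t → QB (hh F) (RQ F) (RQc F) t (fun r => WZ ν r t) (cw ν) (M₁ * A) (M₂ * A) := by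
    intro t ht
    refine ⟨hcw, by positivity, by positivity, fun r hr => (WZ_pos hr ht).le,
      fun x r hx hxr hr => WZ_near hx hxr ht (Or.inl hr), ?_, ?_, ?_, ?_, ?_, ?_⟩
    · intro r hr
      have hW := WZ_pos (ν := ν) hr ht
      refine (H.U_R hν hη (by positivity) b1 hr ht).trans ?_
      have h2 : M₁ * (c₀ * (2 * cw ν + 2 * (Imm η + 1 / (ν - 1)))) ≤ M₁ * A :=
        mul_le_mul_of_nonneg_left (by linarith) hM1
      have h3 := mul_le_mul_of_nonneg_right h2 (by positivity : 0 ≤ r * WZ ν r t)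
      linarith
    · exact fun r hr => (b1 r t hr ht).1.trans (hcmp M₁ hM1 r t hr ht)
    · exact fun r hr => (b1 r t hr ht).2.trans (hcmp M₁ hM1 r t hr ht)
    · exact fun r hr => (b2 r t hr ht).1.trans (hcmp M₂ hM2 r t hr ht)
    · exact fun r hr => (b2 r t hr ht).2.trans (hcmp M₂ hM2 r t hr ht)
    · intro r hr ht'
      refine (S.hW r t hr ht').trans ?_
      have hW := WZ_pos (ν := ν) hr ht
      refine mul_le_mul_of_nonneg_right ?_ hW.le
      exact le_mul_of_one_le_right hM1 (by linarith)
  have hAc : 0 ≤ cw ν * A := by positivity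
  refine ⟨hreg, ?_, ?_⟩
  · have := T0_1 (N := 4 * (M₁ * A)) (ν := ν) hreg (by positivity)
      (fun r t hr ht => (qb t ht.le).bracket1_bd E H ht hr)
      (fun r hr => ((qb 0 le_rfl).rpart1_bd E H le_rfl hr).trans (by
        have hW := WZ_pos (ν := ν) hr (le_refl 0)
        have : 0 ≤ M₁ * A * WZ ν r 0 := by positivity
        linarith))
    intro r t hr ht
    refine (this r t hr ht).trans ?_
    refine mul_le_mul_of_nonneg_right ?_ (WZ_pos hr ht).le
    have h5 : 0 ≤ 5 * cw ν * (10 * A + 12 * cw ν * A) * M₁ := by positivity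
    linarith
  · have := T0_2 (N := 14 * (M₁ * A) + 12 * cw ν * (M₂ * A)) (ν := ν) hreg (by positivity)
      (fun r t hr ht => (qb t ht.le).bracket2_bd E H ht hr)
      (fun r hr => ((qb 0 le_rfl).rpart2_bd E H le_rfl hr).trans (by
        have hW := WZ_pos (ν := ν) hr (le_refl 0)
        refine mul_le_mul_of_nonneg_right ?_ hW.le
        have h6 : 0 ≤ M₁ * A := by positivity
        have h7 : 0 ≤ cw ν * (M₂ * A) := by positivity
        linarith))
    intro r t hr ht
    refine (this r t hr ht).trans ?_
    refine mul_le_mul_of_nonneg_right ?_ (WZ_pos hr ht).le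
    rw [mul_assoc (5 * cw ν)]
    refine mul_le_mul_of_nonneg_left ?_ (by positivity)
    have h6 : 0 ≤ M₂ * A := by positivity
    have h7 : 0 ≤ cw ν * (M₁ * A) := by positivity
    linarith

theorem L_bound (hν0 : 0 ≤ ν) (hν : ν < 1) (hη : 0 < η) (hk : Ker k) :
    ∃ C > 0, ∀ F B M₁ M₂, SrcQ F B ν η k M₁ M₂ →
      Reg (Lop F) ∧ (∀ r t, 0 < r → 0 < t → bracket1 (Lop F) r t ≤ C * M₁ * WZ ν r t) ∧
      (∀ r t, 0 < r → 0 < t → bracket2 (Lop F) r t ≤ C * (M₁ + M₂) * WZ ν r t) := by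
  set c₀ := CL ν η k with hc₀
  have hc0 : 0 ≤ c₀ := CL_nonneg hν hk.nonneg
  have hcw := cw_ge ν
  have hI := Imm_nonneg η
  have hν' : 0 < 1 - ν := by linarith
  set A := c₀ * (2 * cw ν + 2 * (Imm η + 2 / (1 - ν))) + 2 * c₀ + 1 with hA
  have hAp : 0 ≤ c₀ * (2 * cw ν + 2 * (Imm η + 2 / (1 - ν))) := by positivity
  have hA0 : 0 < A := by positivity
  refine ⟨14 * A + 12 * cw ν * A, by positivity, ?_⟩
  intro F B M₁ M₂ S
  have hM1 := S.M1
  have hM2 := S.M2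
  have H := S.src.LQD
  have E := S.src.LUR
  have hreg := E.reg H
  have b1 : ∀ x t, 0 < x → 0 ≤ t → |LQ F (x - t) t| ≤ (M₁ * c₀) * BL ν η x t ∧
      |LQ F (-x - t) t| ≤ (M₁ * c₀) * BL ν η x t := by
    intro x t hx ht
    rw [mul_assoc]
    unfold LQ
    rw [abs_neg, abs_neg]
    exact ⟨L_plus hν0 hν hη hk.nonneg hk.int hx ht hM1 (S.ae1 hk _ measurableSet_Ioc Ioc_sub),
      L_minus hν0 hν hη hk.nonneg hk.int hx ht hM1 (S.ae1 hk _ measurableSet_Ioc Ioc_sub)⟩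
  have b2 : ∀ x t, 0 < x → 0 ≤ t → |LQc F (x - t) t| ≤ (M₂ * c₀) * BL ν η x t ∧
      |LQc F (-x - t) t| ≤ (M₂ * c₀) * BL ν η x t := by
    intro x t hx ht
    rw [mul_assoc]
    unfold LQc
    rw [abs_neg, abs_neg]
    exact ⟨L_plus hν0 hν hη hk.nonneg hk.int hx ht hM2 (S.ae2 hk _ measurableSet_Ioc Ioc_sub),
      L_minus hν0 hν hη hk.nonneg hk.int hx ht hM2 (S.ae2 hk _ measurableSet_Ioc Ioc_sub)⟩
  have hcmp : ∀ M, 0 ≤ M → ∀ x t, 0 < x → 0 ≤ t → (M * c₀) * BL ν η x t ≤ (M * A) * WZ ν x t := by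
    intro M hM x t hx ht
    have hW := WZ_pos (ν := ν) hx ht
    have h1 := mul_le_mul_of_nonneg_left (BL_le hν hη hx ht) (by positivity : 0 ≤ M * c₀)
    have h2 : M * (2 * c₀) ≤ M * A := mul_le_mul_of_nonneg_left (by linarith) hM
    have h3 := mul_le_mul_of_nonneg_right h2 hW.le
    linarith
  have qb : ∀ t, 0 ≤ t → QB (hh F) (LQ F) (LQc F) t (fun r => WZ ν r t) (cw ν) (M₁ * A) (M₂ * A) := by
    intro t ht
    refine ⟨hcw, by positivity, by positivity, fun r hr => (WZ_pos hr ht).le,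
      fun x r hx hxr hr => WZ_near hx hxr ht (Or.inl hr), ?_, ?_, ?_, ?_, ?_, ?_⟩
    · intro r hr
      have hW := WZ_pos (ν := ν) hr ht
      refine (H.U_L (fun c => by simp [LQ]) hν0 hν hη (by positivity) b1 hr ht).trans ?_
      have h2 : M₁ * (c₀ * (2 * cw ν + 2 * (Imm η + 2 / (1 - ν)))) ≤ M₁ * A :=
        mul_le_mul_of_nonneg_left (by linarith) hM1
      have h3 := mul_le_mul_of_nonneg_right h2 (by positivity : 0 ≤ r * WZ ν r t)
      linarith
    · exact fun r hr => (b1 r t hr ht).1.trans (hcmp M₁ hM1 r t hr ht)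
    · exact fun r hr => (b1 r t hr ht).2.trans (hcmp M₁ hM1 r t hr ht)
    · exact fun r hr => (b2 r t hr ht).1.trans (hcmp M₂ hM2 r t hr ht)
    · exact fun r hr => (b2 r t hr ht).2.trans (hcmp M₂ hM2 r t hr ht)
    · intro r hr ht'
      refine (S.hW r t hr ht').trans ?_
      have hW := WZ_pos (ν := ν) hr ht
      refine mul_le_mul_of_nonneg_right ?_ hW.le
      exact le_mul_of_one_le_right hM1 (by linarith)
  refine ⟨hreg, ?_, ?_⟩
  · intro r t hr ht
    refine ((qb t ht.le).bracket1_bd E H ht hr).trans ?_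
    refine mul_le_mul_of_nonneg_right ?_ (WZ_pos hr ht.le).le
    have h6 : 0 ≤ (10 * A + 12 * cw ν * A) * M₁ := by positivity
    linarith
  · intro r t hr ht
    refine ((qb t ht.le).bracket2_bd E H ht hr).trans ?_
    refine mul_le_mul_of_nonneg_right ?_ (WZ_pos hr ht.le).le
    have h6 : 0 ≤ M₂ * A := by positivity
    have h7 : 0 ≤ cw ν * (M₁ * A) := by positivity
    linarith

end RL


section NL

def sp (p x : ℝ) : ℝ := |x| ^ (p - 2) * x

lemma sp_nonneg {p x : ℝ} (hp : 1 < p) (hx : 0 ≤ x) : sp p x = x ^ (p - 1) := by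
  unfold sp
  rcases hx.eq_or_lt with rfl | hx
  · rw [Real.zero_rpow (by linarith)]; simp
  · rw [abs_of_pos hx]
    nth_rewrite 2 [← Real.rpow_one x]
    rw [← Real.rpow_add hx]; congr 1; ring

lemma sp_neg (p x : ℝ) : sp p (-x) = - sp p x := by unfold sp; rw [abs_neg]; ring

lemma abs_sp {p x : ℝ} (hp : 1 < p) : |sp p x| = |x| ^ (p - 1) := by
  rcases le_total 0 x with hx | hx
  · rw [sp_nonneg hp hx, abs_of_nonneg hx, abs_of_nonneg (by positivity)]
  · have := sp_neg p (-x)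
    rw [neg_neg] at this
    rw [this, sp_nonneg hp (by linarith), abs_neg, abs_of_nonpos hx,
      abs_of_nonneg (Real.rpow_nonneg (by linarith) _)]

lemma sp_cmp {p X x y : ℝ} (hp : 1 < p) {Φ : ℝ → ℝ}
    (h1 : ∀ x y, 0 ≤ y → y ≤ x → x ≤ X → x ^ (p - 1) - y ^ (p - 1) ≤ Φ (x - y))
    (h2 : ∀ x y, 0 ≤ x → 0 ≤ y → x ≤ X → y ≤ X → x ^ (p - 1) + y ^ (p - 1) ≤ Φ (x + y))
    (hx : |x| ≤ X) (hy : |y| ≤ X) : |sp p x - sp p y| ≤ Φ |x - y| := by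
  have key1 : ∀ x y, 0 ≤ y → y ≤ x → x ≤ X → |sp p x - sp p y| ≤ Φ |x - y| := by
    intro x y h0 hxy hX
    rw [sp_nonneg hp h0, sp_nonneg hp (h0.trans hxy), abs_of_nonneg (sub_nonneg.2 hxy),
      abs_of_nonneg (sub_nonneg.2 (Real.rpow_le_rpow h0 hxy (by linarith)))]
    exact h1 x y h0 hxy hX
  have key2 : ∀ x y, 0 ≤ x → 0 ≤ y → x ≤ X → y ≤ X → |sp p x - sp p (-y)| ≤ Φ |x - -y| := by
    intro x y h0 h0' hX hY
    rw [sp_neg, sp_nonneg hp h0, sp_nonneg hp h0', sub_neg_eq_add, sub_neg_eq_add,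
      abs_of_nonneg (by positivity), abs_of_nonneg (by positivity)]
    exact h2 x y h0 h0' hX hY
  have key1' : ∀ x y, 0 ≤ y → 0 ≤ x → x ≤ X → y ≤ X → |sp p x - sp p y| ≤ Φ |x - y| := by
    intro x y h0 h0' hX hY
    rcases le_total y x with h | h
    · exact key1 x y h0 h hX
    · rw [abs_sub_comm, abs_sub_comm x]; exact key1 y x h0' h hY
  rw [abs_le] at hx hy
  rcases le_total 0 x with h | h <;> rcases le_total 0 y with h' | h'
  · exact key1' x y h' h hx.2 hy.2
  · have := key2 x (-y) h (by linarith) hx.2 (by linarith)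
    rwa [neg_neg] at this
  · have := key2 y (-x) h' (by linarith) hy.2 (by linarith)
    rw [neg_neg] at this
    rwa [abs_sub_comm, abs_sub_comm x]
  · have := key1' (-x) (-y) (by linarith) (by linarith) (by linarith) (by linarith)
    rw [sp_neg, sp_neg] at this
    rw [abs_sub_comm, abs_sub_comm x]
    convert this using 2
    · ring
    · congr 1; ring

lemma sp_holder {p x y : ℝ} (hp : 1 < p) (hp2 : p < 2) :
    |sp p x - sp p y| ≤ 2 * |x - y| ^ (p - 1) := by
  refine sp_cmp (X := max |x| |y|) (Φ := fun z => 2 * z ^ (p - 1)) hp ?_ ?_ (le_max_left _ _)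
    (le_max_right _ _)
  · intro x y h0 hxy _
    have h3 := Real.rpow_add_le_add_rpow (sub_nonneg.2 hxy) h0 (p := p - 1) (by linarith) (by linarith)
    rw [sub_add_cancel] at h3
    have := Real.rpow_nonneg (sub_nonneg.2 hxy) (p - 1)
    linarith
  · intro x y h0 h0' _ _
    have h3 : x ^ (p - 1) ≤ (x + y) ^ (p - 1) := Real.rpow_le_rpow h0 (by linarith) (by linarith)
    have h4 : y ^ (p - 1) ≤ (x + y) ^ (p - 1) := Real.rpow_le_rpow h0' (by linarith) (by linarith)
    linarith

lemma pow_mvt {p X x y : ℝ} (hp : 1 < p) (hx : |x| ≤ X) (hy : |y| ≤ X) :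
    |(|x| ^ p - |y| ^ p)| ≤ p * X ^ (p - 1) * |x - y| := by
  have := Convex.norm_image_sub_le_of_norm_hasDerivWithin_le (𝕜 := ℝ) (f := fun x : ℝ => |x| ^ p)
    (f' := fun x => p * |x| ^ (p - 2) * x) (s := Set.Icc (-X) X) (C := p * X ^ (p - 1)) (x := y) (y := x)
    (fun z _ => (hasDerivAt_abs_rpow z hp).hasDerivWithinAt) (by
      intro z hz
      have e : p * |z| ^ (p - 2) * z = p * sp p z := by unfold sp; ring
      simp only [Real.norm_eq_abs]
      rw [e, abs_mul, abs_sp hp, abs_of_pos (by linarith)]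
      have : |z| ^ (p - 1) ≤ X ^ (p - 1) :=
        Real.rpow_le_rpow (abs_nonneg _) (abs_le.2 ⟨hz.1, hz.2⟩) (by linarith)
      exact mul_le_mul_of_nonneg_left this (by linarith)) (convex_Icc _ _)
    (abs_le.1 hy) (abs_le.1 hx)
  simpa [Real.norm_eq_abs] using this

lemma sp_lip {p X x y : ℝ} (hp : 2 < p) (hx : |x| ≤ X) (hy : |y| ≤ X) :
    |sp p x - sp p y| ≤ (p - 1) * X ^ (p - 2) * |x - y| := by
  refine sp_cmp (X := X) (Φ := fun z => (p - 1) * X ^ (p - 2) * z) (by linarith) ?_ ?_ hx hy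
  · intro x y h0 hxy hX
    have := pow_mvt (p := p - 1) (x := x) (y := y) (X := X) (by linarith)
      (by rw [abs_of_nonneg (h0.trans hxy)]; exact hX) (by rw [abs_of_nonneg h0]; linarith)
    rw [abs_of_nonneg h0, abs_of_nonneg (h0.trans hxy), abs_of_nonneg (sub_nonneg.2 hxy),
      show p - 1 - 1 = p - 2 by ring] at this
    exact (le_abs_self _).trans this
  · intro x y h0 h0' hX hY
    have aux : ∀ z, 0 ≤ z → z ≤ X → z ^ (p - 1) ≤ X ^ (p - 2) * z := by
      intro z hz hzX
      rcases hz.eq_or_lt with rfl | hz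
      · rw [Real.zero_rpow (by linarith)]; simp
      · rw [show p - 1 = (p - 2) + 1 by ring, Real.rpow_add hz, Real.rpow_one]
        exact mul_le_mul_of_nonneg_right (Real.rpow_le_rpow hz.le hzX (by linarith)) hz.le
    have hX0 : 0 ≤ X := h0.trans hX
    have h1 := aux x h0 hX
    have h2 := aux y h0' hY
    have h3 : 0 ≤ X ^ (p - 2) * (x + y) := by positivity
    nlinarith

variable {u v : ℝ → ℝ → ℝ} {r t : ℝ}

lemma pdt_sub (hu : Reg u) (hv : Reg v) (hr : 0 < r) (ht : 0 < t) :
    pdt (u - v) r t = pdt u r t - pdt v r t := by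
  rw [sub_eq_add_neg, pdt_add hu hv.neg hr ht, pdt_neg]; simp [sub_eq_add_neg]

lemma pdrt_sub (hu : Reg u) (hv : Reg v) (hr : 0 < r) (ht : 0 < t) :
    pdr (pdt (u - v)) r t = pdr (pdt u) r t - pdr (pdt v) r t := by
  rw [sub_eq_add_neg, pdrt_add hu hv.neg hr ht, pdt_neg, pdr_neg]; simp [sub_eq_add_neg]

lemma NL_hasDeriv {p : ℝ} (hp : 1 < p) (hu : Reg u) (hr : 0 < r) (ht : 0 < t) :
    HasDerivAt (fun r => NLt p u r t) (p * sp p (pdt u r t) * pdr (pdt u) r t) r := by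
  have h := (hasDerivAt_abs_rpow (pdt u r t) hp).comp r (hu.dtr r t hr ht).hasDerivAt
  have e : p * sp p (pdt u r t) * pdr (pdt u) r t
    = p * |pdt u r t| ^ (p - 2) * pdt u r t * deriv (fun r' => pdt u r' t) r := by
    unfold sp pdr; ring
  rw [e]; exact h

lemma NL_dhh {p : ℝ} (hp : 1 < p) (hu : Reg u) (hv : Reg v) (hr : 0 < r) (ht : 0 < t) :
    dhh (NLt p u - NLt p v) r t = (NLt p u r t - NLt p v r t) +
      r * (p * sp p (pdt u r t) * pdr (pdt u) r t - p * sp p (pdt v r t) * pdr (pdt v) r t) := by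
  have h := (hasDerivAt_id r).mul ((NL_hasDeriv hp hu hr ht).sub (NL_hasDeriv hp hv hr ht))
  have h2 : HasDerivAt (fun x => hh (NLt p u - NLt p v) x t) _ r := h
  unfold dhh
  rw [h2.deriv]
  simp

lemma NL_est {p X δ Y : ℝ} (hp : 1 < p) (hu : Reg u) (hv : Reg v) (hr : 0 < r) (ht : 0 < t)
    (hX1 : |pdt u r t| ≤ X) (hX2 : |pdt v r t| ≤ X)
    (hY : |sp p (pdt u r t) - sp p (pdt v r t)| ≤ Y) (hδ : |pdt (u - v) r t| ≤ δ) :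
    |(NLt p u - NLt p v) r t| ≤ p * X ^ (p - 1) * δ ∧
    |dhh (NLt p u - NLt p v) r t| ≤ p * X ^ (p - 1) * δ
      + p * X ^ (p - 1) * (r * |pdr (pdt (u - v)) r t|) + p * Y * (r * |pdr (pdt v) r t|) := by
  have hX0 : 0 ≤ X := (abs_nonneg _).trans hX1
  have h1 : |(NLt p u - NLt p v) r t| ≤ p * X ^ (p - 1) * δ := by
    refine (pow_mvt hp hX1 hX2).trans ?_
    rw [← pdt_sub hu hv hr ht]
    exact mul_le_mul_of_nonneg_left hδ (by positivity)
  refine ⟨h1, ?_⟩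
  rw [NL_dhh hp hu hv hr ht, pdrt_sub hu hv hr ht]
  set x := pdt u r t
  set y := pdt v r t
  set x' := pdr (pdt u) r t
  set y' := pdr (pdt v) r t
  have e : r * (p * sp p x * x' - p * sp p y * y') =
    p * sp p x * (r * (x' - y')) + p * (sp p x - sp p y) * (r * y') := by ring
  rw [e]
  have h2 : |p * sp p x * (r * (x' - y'))| ≤ p * X ^ (p - 1) * (r * |x' - y'|) := by
    rw [abs_mul, abs_mul, abs_mul, abs_sp hp, abs_of_pos hr, abs_of_pos (by linarith : 0 < p)]
    have : |x| ^ (p - 1) ≤ X ^ (p - 1) := Real.rpow_le_rpow (abs_nonneg _) hX1 (by linarith)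
    gcongr
  have h3 : |p * (sp p x - sp p y) * (r * y')| ≤ p * Y * (r * |y'|) := by
    rw [abs_mul, abs_mul, abs_mul, abs_of_pos hr, abs_of_pos (by linarith : 0 < p)]
    gcongr
  have h4 : |NLt p u r t - NLt p v r t| ≤ p * X ^ (p - 1) * δ := h1
  have h5 := abs_add_le (NLt p u r t - NLt p v r t)
    (p * sp p x * (r * (x' - y')) + p * (sp p x - sp p y) * (r * y'))
  have h6 := abs_add_le (p * sp p x * (r * (x' - y'))) (p * (sp p x - sp p y) * (r * y'))
  linarith

lemma NL_src {p : ℝ} (hp : 1 < p) (hu : Reg u) (hv : Reg v) {B : ℝ → ℝ} {M ν : ℝ} (hM : 0 ≤ M) (hν : 0 ≤ ν)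
    (hB : B = fun s => M * (1 + s) ^ (-ν))
    (bF : ∀ x s, 0 < x → 0 < s → |(NLt p u - NLt p v) x s| ≤ B s)
    (bh : ∀ x s, 0 < x → 0 < s → |hh (NLt p u - NLt p v) x s| ≤ B s)
    (bd : ∀ x s, 0 < x → 0 < s → |dhh (NLt p u - NLt p v) x s| ≤ B s) :
    Src (NLt p u - NLt p v) B ∧ (1 < ν → IntegrableOn B (Set.Ioi 0)) := by
  refine ⟨⟨?_, ?_, ?_, bF, bh, bd, ?_, ?_⟩, ?_⟩
  · intro x s hs
    simp only [Pi.sub_apply, NLt, hu.pdt_even x s hs, hv.pdt_even x s hs]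
  · have h1 := (hu.ct.abs).rpow_const (p := p) (fun _ _ => Or.inr (by linarith))
    have h2 := (hv.ct.abs).rpow_const (p := p) (fun _ _ => Or.inr (by linarith))
    exact h1.sub h2
  · intro x s hx hs
    exact ((NL_hasDeriv hp hu hx hs).sub (NL_hasDeriv hp hv hx hs)).differentiableAt
  · intro s t hs hst
    rw [hB]
    exact mul_le_mul_of_nonneg_left (rp_anti (by linarith) (by linarith) hν) hM
  · rw [hB]
    refine continuousOn_const.mul (ContinuousOn.rpow_const (by fun_prop) ?_)
    intro s hs
    left
    have : (0:ℝ) ≤ s := hs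
    linarith
  · intro h
    rw [hB]
    exact ((pow_int (a := 1) (t := 0) h (by norm_num)).1).const_mul M

lemma reg_zero : Reg (0 : ℝ → ℝ → ℝ) := by
  have e1 : pdr (0 : ℝ → ℝ → ℝ) = 0 := by funext r t; simp [pdr]
  have e2 : pdt (0 : ℝ → ℝ → ℝ) = 0 := by funext r t; simp [pdt]
  refine ⟨?_, ?_, ?_, ?_, ?_, ?_, ?_⟩ <;> intros <;> simp [e1, e2]
  exact continuousOn_const

lemma bracket2_zero (r t : ℝ) : bracket2 (0 : ℝ → ℝ → ℝ) r t = 0 := by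
  have e1 : pdr (0 : ℝ → ℝ → ℝ) = 0 := by funext r t; simp [pdr]
  have e2 : pdt (0 : ℝ → ℝ → ℝ) = 0 := by funext r t; simp [pdt]
  simp [bracket2, e1, e2]

lemma NLt_zero {p : ℝ} (hp : 1 < p) : NLt p (0 : ℝ → ℝ → ℝ) = 0 := by
  have e2 : pdt (0 : ℝ → ℝ → ℝ) = 0 := by funext r t; simp [pdt]
  funext r t
  simp [NLt, e2, Real.zero_rpow (by linarith : p ≠ 0)]

end NL


section Wt

def jk (κ x : ℝ) : ℝ := if |x| < 1 then |x| ^ (-κ) else 0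

lemma jk_ker {κ : ℝ} (hκ1 : κ < 1) : Ker (jk κ) where
  nonneg x := by unfold jk; split_ifs <;> positivity
  even x := by simp [jk]
  int := by
    have h0 : IntervalIntegrable (fun x : ℝ => x ^ (-κ)) volume 0 1 :=
      intervalIntegral.intervalIntegrable_rpow' (by linarith)
    have h1 : IntegrableOn (jk κ) (Set.Ioi 0) := by
      have h2 : IntegrableOn (jk κ) (Set.Ioo 0 1) := by
        have := (intervalIntegrable_iff_integrableOn_Ioo_of_le zero_le_one).1 h0
        refine this.congr_fun (fun x hx => ?_) measurableSet_Ioo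
        simp [jk, abs_of_pos hx.1, hx.2]
      have h3 : IntegrableOn (jk κ) (Set.Ici 1) := by
        refine (integrableOn_zero (s := Set.Ici (1:ℝ))).congr_fun (fun x hx => ?_) measurableSet_Ici
        have : (1:ℝ) ≤ x := hx
        have h4 : ¬ |x| < 1 := by rw [abs_of_pos (by linarith)]; linarith
        simp only [jk, if_neg h4]
      have := h2.union h3
      rwa [Set.Ioo_union_Ici_eq_Ioi (by norm_num)] at this
    have h5 : IntegrableOn (jk κ) (Set.Iio 0) := by
      have := h1.comp_neg
      simp only [Set.neg_Ioi, neg_zero] at this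
      have e : (fun x => jk κ (-x)) = jk κ := by funext x; simp [jk]
      rwa [e] at this
    rw [← integrableOn_univ, ← Set.Iio_union_Ici (a := (0:ℝ))]
    exact h5.union ((integrableOn_Ici_iff_integrableOn_Ioi (by simp)).2 h1)

lemma mm_ker {η : ℝ} (hη : 0 < η) : Ker (mm η) where
  nonneg x := (mm_pos η x).le
  even x := by simp [mm]
  int := mm_int hη

variable {κ κ₂ a S D Λ : ℝ}

lemma lam_le (hκ : 0 < κ) (hκ1 : κ ≤ 1) (hS : 1 ≤ S) (hD : 1 ≤ D) (hL : 1 ≤ Λ) (h : S ≤ 2 * Λ * D) :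
    Λ ^ (-κ) ≤ 2 * (D ^ κ * S ^ (-κ)) := by
  have hS0 : 0 < S := by linarith
  have hD0 : 0 < D := by linarith
  have hL0 : 0 < Λ := by linarith
  have h1 : S ^ κ ≤ 2 * Λ ^ κ * D ^ κ := by
    calc S ^ κ ≤ (2 * Λ * D) ^ κ := Real.rpow_le_rpow hS0.le h hκ.le
      _ = 2 ^ κ * Λ ^ κ * D ^ κ := by
        rw [Real.mul_rpow (by positivity) hD0.le, Real.mul_rpow (by norm_num) hL0.le]
      _ ≤ _ := by
        have : (2:ℝ) ^ κ ≤ 2 := by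
          calc (2:ℝ) ^ κ ≤ 2 ^ (1:ℝ) := Real.rpow_le_rpow_of_exponent_le (by norm_num) hκ1
            _ = 2 := Real.rpow_one 2
        gcongr
  rw [Real.rpow_neg hL0.le, Real.rpow_neg hS0.le, ← mul_assoc, ← div_eq_mul_inv, inv_eq_one_div,
    div_le_div_iff₀ (by positivity) (by positivity)]
  linarith

lemma K1 (hκ : 0 < κ) (hκ1 : κ ≤ 1) (ha : 1 ≤ a) (hS : 1 ≤ S) (hD : 1 ≤ D) (hL : 1 ≤ Λ)
    (h : S ≤ 2 * Λ * D) :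
    (D ^ (-κ₂) / Λ) ^ κ * (S ^ (1 - a) * D⁻¹) ≤ 2 * (S ^ (-(κ * a)) * D ^ (-1 - κ * (κ₂ - 1))) := by
  have hS0 : 0 < S := by linarith
  have hD0 : 0 < D := by linarith
  have hL0 : 0 < Λ := by linarith
  have e1 : (D ^ (-κ₂) / Λ) ^ κ = D ^ (-κ₂ * κ) * Λ ^ (-κ) := by
    rw [Real.div_rpow (by positivity) hL0.le, ← Real.rpow_mul hD0.le, Real.rpow_neg hL0.le, div_eq_mul_inv]
  have e2 : D ^ (-1 - κ * (κ₂ - 1)) = D ^ (-κ₂ * κ) * D ^ κ * D⁻¹ := by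
    rw [← Real.rpow_neg_one D, ← Real.rpow_add hD0, ← Real.rpow_add hD0]; congr 1; ring
  have e3 : S ^ (-κ) * S ^ (1 - a) ≤ S ^ (-(κ * a)) := by
    rw [← Real.rpow_add hS0]
    apply Real.rpow_le_rpow_of_exponent_le hS
    nlinarith
  rw [e1, e2]
  calc _ ≤ D ^ (-κ₂ * κ) * (2 * (D ^ κ * S ^ (-κ))) * (S ^ (1 - a) * D⁻¹) := by
        gcongr; exact lam_le hκ hκ1 hS hD hL h
    _ = 2 * (S ^ (-κ) * S ^ (1 - a)) * (D ^ (-κ₂ * κ) * D ^ κ * D⁻¹) := by ring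
    _ ≤ 2 * S ^ (-(κ * a)) * (D ^ (-κ₂ * κ) * D ^ κ * D⁻¹) := by gcongr
    _ = _ := by ring

lemma K3 (hκ : 0 < κ) (hκ1 : κ ≤ 1) (hS : 1 ≤ S) (hD : 1 ≤ D) (hL : 1 ≤ Λ)
    (h : S ≤ 2 * Λ * D) :
    ((S ^ (1 - a) * D⁻¹) / Λ) ^ κ * D ^ (-κ₂) ≤ 2 * (S ^ (-(κ * a)) * D ^ (-κ₂)) := by
  have hS0 : 0 < S := by linarith
  have hD0 : 0 < D := by linarith
  have hL0 : 0 < Λ := by linarith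
  have e1 : ((S ^ (1 - a) * D⁻¹) / Λ) ^ κ = S ^ ((1 - a) * κ) * (D ^ κ)⁻¹ * Λ ^ (-κ) := by
    rw [Real.div_rpow (by positivity) hL0.le, Real.mul_rpow (by positivity) (by positivity),
      ← Real.rpow_mul hS0.le, Real.rpow_neg hL0.le, div_eq_mul_inv, Real.inv_rpow hD0.le]
  have e3 : S ^ ((1 - a) * κ) * S ^ (-κ) = S ^ (-(κ * a)) := by
    rw [← Real.rpow_add hS0]; congr 1; ring
  rw [e1]
  calc _ ≤ S ^ ((1 - a) * κ) * (D ^ κ)⁻¹ * (2 * (D ^ κ * S ^ (-κ))) * D ^ (-κ₂) := by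
        gcongr; exact lam_le hκ hκ1 hS hD hL h
    _ = 2 * ((S ^ ((1 - a) * κ) * S ^ (-κ)) * ((D ^ κ)⁻¹ * D ^ κ) * D ^ (-κ₂)) := by ring
    _ = _ := by rw [e3, inv_mul_cancel₀ (by positivity), mul_one]

lemma K2 {r : ℝ} (hr : 0 < r) (hκ : 0 < κ) (hκ1 : κ ≤ 1) (hκ₂ : 1 ≤ κ₂) (hS : 1 ≤ S) (hD : 1 ≤ D)
    (h : S ≤ 2 * (1 + r) * D) (h3 : S ≤ D + 2 * r) :
    ((S ^ (1 - a) * D⁻¹) / r) ^ κ * D ^ (-κ₂) ≤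
      4 * (S ^ (-(κ * a)) * (D ^ (-1 - κ * (κ₂ - 1)) + jk κ r)) := by
  have hS0 : 0 < S := by linarith
  have hD0 : 0 < D := by linarith
  have e1 : D ^ (-κ₂) ≤ D ^ (-1 - κ * (κ₂ - 1)) :=
    Real.rpow_le_rpow_of_exponent_le hD (by nlinarith)
  have two : (2:ℝ) ^ κ ≤ 2 := by
    calc (2:ℝ) ^ κ ≤ 2 ^ (1:ℝ) := Real.rpow_le_rpow_of_exponent_le (by norm_num) hκ1
      _ = 2 := Real.rpow_one 2
  have three : (3:ℝ) ^ κ ≤ 3 := by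
    calc (3:ℝ) ^ κ ≤ 3 ^ (1:ℝ) := Real.rpow_le_rpow_of_exponent_le (by norm_num) hκ1
      _ = 3 := Real.rpow_one 3
  rcases le_or_gt 1 r with h1 | h1
  · have hj : jk κ r = 0 := by
      rw [jk, if_neg]; rw [abs_of_pos hr]; linarith
    rw [hj, add_zero]
    calc ((S ^ (1 - a) * D⁻¹) / r) ^ κ * D ^ (-κ₂)
        ≤ (2 * ((S ^ (1 - a) * D⁻¹) / (1 + r))) ^ κ * D ^ (-κ₂) := by
          gcongr
          rw [← mul_div_assoc, div_le_div_iff₀ hr (by linarith)]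
          have : 0 < S ^ (1 - a) * D⁻¹ := by positivity
          nlinarith
      _ = 2 ^ κ * (((S ^ (1 - a) * D⁻¹) / (1 + r)) ^ κ * D ^ (-κ₂)) := by
          rw [Real.mul_rpow (by norm_num) (by positivity)]; ring
      _ ≤ 2 * (2 * (S ^ (-(κ * a)) * D ^ (-κ₂))) := by
          refine mul_le_mul two (K3 hκ hκ1 hS hD (by linarith) h) (by positivity) (by norm_num)
      _ ≤ _ := by
          have : S ^ (-(κ * a)) * D ^ (-κ₂) ≤ S ^ (-(κ * a)) * D ^ (-1 - κ * (κ₂ - 1)) := by gcongr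
          linarith
  · have hj : jk κ r = r ^ (-κ) := by
      rw [jk, if_pos] <;> rw [abs_of_pos hr]; exact h1
    rw [hj]
    have e2 : ((S ^ (1 - a) * D⁻¹) / r) ^ κ = S ^ (-(κ * a)) * ((S / D) ^ κ * r ^ (-κ)) := by
      rw [Real.div_rpow (by positivity) hr.le, Real.mul_rpow (by positivity) (by positivity),
        ← Real.rpow_mul hS0.le, Real.rpow_neg hr.le, Real.inv_rpow hD0.le, Real.div_rpow hS0.le hD0.le,
        show (1 - a) * κ = -(κ * a) + κ by ring, Real.rpow_add hS0]
      field_simp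
    have e3 : (S / D) ^ κ ≤ 3 := by
      refine (Real.rpow_le_rpow (by positivity) ?_ hκ.le).trans three
      rw [div_le_iff₀ hD0]; linarith
    have e4 : D ^ (-κ₂) ≤ 1 := Real.rpow_le_one_of_one_le_of_nonpos hD (by linarith)
    have e5 : 0 < D ^ (-1 - κ * (κ₂ - 1)) := by positivity
    rw [e2]
    calc _ ≤ S ^ (-(κ * a)) * (3 * r ^ (-κ)) * 1 := by gcongr
      _ ≤ S ^ (-(κ * a)) * (4 * (D ^ (-1 - κ * (κ₂ - 1)) + r ^ (-κ))) := by
        rw [mul_one]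
        have : 0 ≤ r ^ (-κ) := by positivity
        refine mul_le_mul_of_nonneg_left ?_ (by positivity)
        linarith
      _ = _ := by ring

lemma geo {r s : ℝ} (hr : 0 < r) (hs : 0 < s) : 1 ≤ 1 + r + s ∧ 1 ≤ 1 + |r - s| ∧ 1 ≤ 1 + r ∧
    1 + r + s ≤ (1 + |r - s|) + 2 * r ∧ 1 + r + s ≤ 2 * (1 + r) * (1 + |r - s|) ∧
    1 + |r - s| ≤ 1 + r + s := by
  have h0 := abs_nonneg (r - s)
  have h1 := neg_abs_le (r - s)
  have h2 := absrt_le hr hs.le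
  refine ⟨by linarith, by linarith, by linarith, by linarith, by nlinarith, by linarith⟩

lemma phi_eq {ν η : ℝ} {k : ℝ → ℝ} {r s : ℝ} (hr : 0 < r) :
    PhiS ν η k r s = (1 + r + s) ^ (-ν) * ((1 + |r - s|) ^ (-1 - η) + k r) := by
  unfold PhiS mm; rw [abs_of_pos hr]

end Wt


section GSrc
variable {u v : ℝ → ℝ → ℝ}

lemma G_pt {p κ₂ a A N₁ N₂ r s : ℝ} (hp : 1 < p) (hp2 : p < 2) (hκ₂ : 1 ≤ κ₂) (ha : 1 ≤ a)
    (hA : 0 ≤ A) (hN₁ : 0 ≤ N₁) (hN₂ : 0 ≤ N₂) (hu : Reg u) (hv : Reg v) (hr : 0 < r) (hs : 0 < s)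
    (bu : bracket2 u r s ≤ A * (1 + |r - s|) ^ (-κ₂))
    (bv : bracket2 v r s ≤ A * (1 + |r - s|) ^ (-κ₂))
    (b1 : bracket1 (u - v) r s ≤ N₁ * WZ a r s)
    (b2 : bracket2 (u - v) r s ≤ N₂ * WZ a r s) {E : ℝ}
    (hE : E = (1 + r + s) ^ (-((p - 1) * a)) * (1 + |r - s|) ^ (-1 - (p - 1) * (κ₂ - 1))) :
    |(NLt p u - NLt p v) r s| ≤ 2 * p * (A ^ (p - 1) * N₂) * E ∧
    |hh (NLt p u - NLt p v) r s| ≤ 2 * p * (A ^ (p - 1) * N₁) * E ∧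
    |dhh (NLt p u - NLt p v) r s| ≤ 4 * p * (A ^ (p - 1) * N₂) * E
      + 8 * p * (A * N₁ ^ (p - 1)) * PhiS ((p - 1) * a) ((p - 1) * (κ₂ - 1)) (jk (p - 1)) r s ∧
    |dhh (NLt p u - NLt p v) r s| ≤ 4 * p * (A ^ (p - 1) * N₂) * E
      + 4 * p * (A * N₂ ^ (p - 1)) * (1 + r + s) ^ (-((p - 1) * a)) := by
  obtain ⟨gS, gD, gL, g1, g2, g3⟩ := geo hr hs
  rw [phi_eq hr]
  unfold WZ at b1 b2
  have k1 := K1 (κ := p - 1) (κ₂ := κ₂) (a := a) (by linarith) (by linarith) ha gS gD gL g2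
  have k2 := K2 (κ := p - 1) (κ₂ := κ₂) (a := a) hr (by linarith) (by linarith) hκ₂ gS gD g2 g1
  have k3 := K3 (κ := p - 1) (κ₂ := κ₂) (a := a) (by linarith) (by linarith) gS gD gL g2
  rw [← hE] at k1
  set S := 1 + r + s
  set D := 1 + |r - s|
  set ω := S ^ (1 - a) * D⁻¹ with hω
  have hS0 : 0 < S := by linarith
  have hD0 : 0 < D := by linarith
  have hω0 : 0 < ω := by positivity
  have hp0 : 0 < p := by linarith
  have q1 := (bracket2_parts hr bu).1
  obtain ⟨q2, q3, -⟩ := bracket2_parts hr bv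
  have q4 := bracket1_parts hr b1
  obtain ⟨q5, q6, -⟩ := bracket2_parts hr b2
  set δ := |pdt (u - v) r s| with hδ
  have hδ0 : 0 ≤ δ := abs_nonneg _
  have conv : ∀ x : ℝ, (1 + r) * x ≤ A * D ^ (-κ₂) → x ≤ A * (D ^ (-κ₂) / (1 + r)) := by
    intro x hx
    rw [← mul_div_assoc, le_div_iff₀ (by linarith)]; linarith
  have est := NL_est (δ := δ) (Y := 2 * δ ^ (p - 1)) hp hu hv hr hs (conv _ q1) (conv _ q2)
    (by rw [hδ, pdt_sub hu hv hr hs]; exact sp_holder hp hp2) le_rfl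
  have eX : (A * (D ^ (-κ₂) / (1 + r))) ^ (p - 1) = A ^ (p - 1) * (D ^ (-κ₂) / (1 + r)) ^ (p - 1) :=
    Real.mul_rpow hA (by positivity)
  rw [eX] at est
  set Z := (D ^ (-κ₂) / (1 + r)) ^ (p - 1) with hZ
  have hZ0 : 0 ≤ Z := by positivity
  have hA' : 0 ≤ A ^ (p - 1) := by positivity
  have main : ∀ N y, 0 ≤ N → y ≤ N * ω → p * (A ^ (p - 1) * Z) * y ≤ 2 * p * (A ^ (p - 1) * N) * E := by
    intro N y hN hy
    calc p * (A ^ (p - 1) * Z) * y ≤ p * (A ^ (p - 1) * Z) * (N * ω) := by gcongr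
      _ = p * (A ^ (p - 1) * N) * (Z * ω) := by ring
      _ ≤ p * (A ^ (p - 1) * N) * (2 * E) := by gcongr
      _ = _ := by ring
  have hδ2 : δ ≤ N₂ * ω := by nlinarith
  have two := main N₂ δ hN₂ hδ2
  have two' := main N₂ _ hN₂ q6
  have third1 : δ ^ (p - 1) * (r * |pdr (pdt v) r s|) ≤ A * N₁ ^ (p - 1) * (4 * (S ^ (-((p - 1) * a)) *
      (D ^ (-1 - (p - 1) * (κ₂ - 1)) + jk (p - 1) r))) := by
    calc δ ^ (p - 1) * (r * |pdr (pdt v) r s|) ≤ (N₁ * (ω / r)) ^ (p - 1) * (A * D ^ (-κ₂)) := by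
          have : δ ≤ N₁ * (ω / r) := by rw [← mul_div_assoc, le_div_iff₀ hr]; linarith
          gcongr
      _ = A * N₁ ^ (p - 1) * ((ω / r) ^ (p - 1) * D ^ (-κ₂)) := by
          rw [Real.mul_rpow hN₁ (by positivity)]; ring
      _ ≤ _ := by gcongr
  have third2 : δ ^ (p - 1) * (r * |pdr (pdt v) r s|) ≤ A * N₂ ^ (p - 1) * (2 * S ^ (-((p - 1) * a))) := by
    calc δ ^ (p - 1) * (r * |pdr (pdt v) r s|) ≤ (N₂ * (ω / (1 + r))) ^ (p - 1) * (A * D ^ (-κ₂)) := by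
          have : δ ≤ N₂ * (ω / (1 + r)) := by rw [← mul_div_assoc, le_div_iff₀ (by linarith)]; linarith
          gcongr
      _ = A * N₂ ^ (p - 1) * ((ω / (1 + r)) ^ (p - 1) * D ^ (-κ₂)) := by
          rw [Real.mul_rpow hN₂ (by positivity)]; ring
      _ ≤ A * N₂ ^ (p - 1) * (2 * (S ^ (-((p - 1) * a)) * D ^ (-κ₂))) := by gcongr
      _ ≤ A * N₂ ^ (p - 1) * (2 * (S ^ (-((p - 1) * a)) * 1)) := by
          have : D ^ (-κ₂) ≤ 1 := Real.rpow_le_one_of_one_le_of_nonpos gD (by linarith)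
          gcongr
      _ = _ := by ring
  refine ⟨est.1.trans two, ?_, est.2.trans ?_, est.2.trans ?_⟩
  · unfold hh
    rw [abs_mul, abs_of_pos hr]
    calc _ ≤ r * (p * (A ^ (p - 1) * Z) * δ) := by gcongr; exact est.1
      _ = p * (A ^ (p - 1) * Z) * (r * δ) := by ring
      _ ≤ _ := main N₁ _ hN₁ q4
  · have e : p * (2 * δ ^ (p - 1)) * (r * |pdr (pdt v) r s|)
        = 2 * p * (δ ^ (p - 1) * (r * |pdr (pdt v) r s|)) := by ring
    rw [e]
    have := mul_le_mul_of_nonneg_left third1 (by linarith : 0 ≤ 2 * p)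
    linarith
  · have e : p * (2 * δ ^ (p - 1)) * (r * |pdr (pdt v) r s|)
        = 2 * p * (δ ^ (p - 1) * (r * |pdr (pdt v) r s|)) := by ring
    rw [e]
    have := mul_le_mul_of_nonneg_left third2 (by linarith : 0 ≤ 2 * p)
    linarith

lemma G_src {p κ₂ a A N₁ N₂ : ℝ} (hp : 1 < p) (hp2 : p < 2) (hκ₂ : 1 ≤ κ₂) (ha : 1 ≤ a)
    (hA : 0 ≤ A) (hN₁ : 0 ≤ N₁) (hN₂ : 0 ≤ N₂) (hu : Reg u) (hv : Reg v)
    (bu : ∀ r s, 0 < r → 0 < s → bracket2 u r s ≤ A * (1 + |r - s|) ^ (-κ₂))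
    (bv : ∀ r s, 0 < r → 0 < s → bracket2 v r s ≤ A * (1 + |r - s|) ^ (-κ₂))
    (b1 : ∀ r s, 0 < r → 0 < s → bracket1 (u - v) r s ≤ N₁ * WZ a r s)
    (b2 : ∀ r s, 0 < r → 0 < s → bracket2 (u - v) r s ≤ N₂ * WZ a r s) :
    ∃ B, SrcQ (NLt p u - NLt p v) B ((p - 1) * a) ((p - 1) * (κ₂ - 1)) (jk (p - 1))
      (8 * p * (A ^ (p - 1) * N₁)) (8 * p * (A ^ (p - 1) * N₂ + A * N₁ ^ (p - 1))) ∧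
      (1 < (p - 1) * a → IntegrableOn B (Set.Ioi 0)) := by
  have hp0 : 0 < p := by linarith
  have hν0 : 0 ≤ (p - 1) * a := mul_nonneg (by linarith) (by linarith)
  have hη0 : 0 ≤ (p - 1) * (κ₂ - 1) := mul_nonneg (by linarith) (by linarith)
  have pt := fun r s (hr : 0 < r) (hs : 0 < s) => G_pt hp hp2 hκ₂ ha hA hN₁ hN₂ hu hv hr hs (bu r s hr hs)
    (bv r s hr hs) (b1 r s hr hs) (b2 r s hr hs) rfl
  set ν := (p - 1) * a with hν
  set η := (p - 1) * (κ₂ - 1) with hη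
  set P1 := A ^ (p - 1) * N₁ with hP1
  set P2 := A ^ (p - 1) * N₂ with hP2
  set P3 := A * N₁ ^ (p - 1) with hP3
  set P4 := A * N₂ ^ (p - 1) with hP4
  have h1 : 0 ≤ P1 := by positivity
  have h2 : 0 ≤ P2 := by positivity
  have h3 : 0 ≤ P3 := by positivity
  have h4 : 0 ≤ P4 := by positivity
  have n1 := mul_nonneg hp0.le h1
  have n2 := mul_nonneg hp0.le h2
  have n3 := mul_nonneg hp0.le h3
  have n4 := mul_nonneg hp0.le h4
  have EW : ∀ r s, 0 < r → 0 < s →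
      0 ≤ (1 + r + s) ^ (-ν) * (1 + |r - s|) ^ (-1 - η) ∧
      (1 + r + s) ^ (-ν) * (1 + |r - s|) ^ (-1 - η) ≤ (1 + s) ^ (-ν) ∧
      (1 + r + s) ^ (-ν) ≤ (1 + s) ^ (-ν) ∧
      (1 + r + s) ^ (-ν) * (1 + |r - s|) ^ (-1 - η) ≤ PhiS ν η (jk (p - 1)) r s ∧
      (1 + r + s) ^ (-ν) * (1 + |r - s|) ^ (-1 - η) ≤ WZ ν r s := by
    intro r s hr hs
    obtain ⟨gS, gD, gL, g1, g2, g3⟩ := geo hr hs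
    have e1 : (1 + r + s) ^ (-ν) ≤ (1 + s) ^ (-ν) := rp_anti (by linarith) (by linarith) hν0
    have e2 : (1 + |r - s|) ^ (-1 - η) ≤ 1 := Real.rpow_le_one_of_one_le_of_nonpos gD (by linarith)
    have e3 : 0 ≤ (1 + r + s) ^ (-ν) := by positivity
    refine ⟨by positivity, by nlinarith, e1, ?_, ?_⟩
    · rw [phi_eq hr]
      have : 0 ≤ jk (p - 1) r := (jk_ker (by linarith)).nonneg r
      gcongr; linarith
    · unfold WZ
      have e4 : (1 + |r - s|) ^ (-1 - η) ≤ (1 + |r - s|)⁻¹ := by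
        rw [← Real.rpow_neg_one]
        exact Real.rpow_le_rpow_of_exponent_le gD (by linarith)
      have e5 : (1 + r + s) ^ (-ν) ≤ (1 + r + s) ^ (1 - ν) :=
        Real.rpow_le_rpow_of_exponent_le gS (by linarith)
      gcongr
  have src := NL_src (p := p) hp hu hv (B := fun s => (8 * p * (P1 + P2 + P4)) * (1 + s) ^ (-ν))
    (M := 8 * p * (P1 + P2 + P4)) (ν := ν) (by positivity) hν0 rfl (by
      intro r s hr hs
      obtain ⟨w0, w1, w2, w3, w4⟩ := EW r s hr hs
      refine (pt r s hr hs).1.trans ?_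
      have : 2 * p * P2 ≤ 8 * p * (P1 + P2 + P4) := by nlinarith
      exact mul_le_mul this w1 w0 (by positivity)) (by
      intro r s hr hs
      obtain ⟨w0, w1, w2, w3, w4⟩ := EW r s hr hs
      refine (pt r s hr hs).2.1.trans ?_
      have : 2 * p * P1 ≤ 8 * p * (P1 + P2 + P4) := by nlinarith
      exact mul_le_mul this w1 w0 (by positivity)) (by
      intro r s hr hs
      obtain ⟨w0, w1, w2, w3, w4⟩ := EW r s hr hs
      refine (pt r s hr hs).2.2.2.trans ?_
      have i1 := mul_le_mul_of_nonneg_left w1 (by positivity : 0 ≤ 4 * p * P2)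
      have i2 := mul_le_mul_of_nonneg_left w2 (by positivity : 0 ≤ 4 * p * P4)
      have : 4 * p * P2 + 4 * p * P4 ≤ 8 * p * (P1 + P2 + P4) := by nlinarith
      have i3 := mul_le_mul_of_nonneg_right this (by positivity : 0 ≤ (1 + s) ^ (-ν))
      linarith)
  refine ⟨_, ⟨src.1, by positivity, by positivity, ?_, ?_, ?_⟩, src.2⟩
  · intro r s hr hs
    obtain ⟨w0, w1, w2, w3, w4⟩ := EW r s hr hs
    refine (pt r s hr hs).2.1.trans ?_
    exact mul_le_mul (by nlinarith) w3 w0 (by positivity)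
  · intro r s hr hs
    obtain ⟨w0, w1, w2, w3, w4⟩ := EW r s hr hs
    refine (pt r s hr hs).2.2.1.trans ?_
    have i1 := mul_le_mul_of_nonneg_left w3 (by positivity : 0 ≤ 4 * p * P2)
    have i2 := mul_nonneg n2 (w0.trans w3)
    linarith
  · intro r s hr hs
    obtain ⟨w0, w1, w2, w3, w4⟩ := EW r s hr hs
    refine (pt r s hr hs).2.1.trans ?_
    exact mul_le_mul (by nlinarith) w4 w0 (by positivity)

end GSrc


section HSrc
variable {u v : ℝ → ℝ → ℝ}

lemma K4 {q S D Λ : ℝ} (hq : 2 < q) (hS : 1 ≤ S) (hD : 1 ≤ D) (hL : 1 ≤ Λ)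
    (h : S ≤ D + 2 * Λ) :
    (S / (D * Λ)) ^ (q - 1) * D⁻¹ ≤ 3 ^ (q - 1) * (D ^ (1 - q) + Λ ^ (1 - q)) ∧
    (S / (D * Λ)) ^ (q - 1) * D⁻¹ ≤ 3 ^ (q - 1) * D⁻¹ := by
  have hS0 : 0 < S := by linarith
  have hD0 : 0 < D := by linarith
  have hL0 : 0 < Λ := by linarith
  have iD : D⁻¹ ≤ 1 := inv_le_one_of_one_le₀ hD
  have p1 : 0 ≤ D ^ (1 - q) := by positivity
  have p2 : 0 ≤ Λ ^ (1 - q) := by positivity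
  have cube : S / (D * Λ) ≤ 3 * D⁻¹ ∨ S / (D * Λ) ≤ 3 * Λ⁻¹ := by
    rcases le_total D Λ with c | c
    · left
      rw [div_le_iff₀ (by positivity)]
      have : 3 * D⁻¹ * (D * Λ) = 3 * Λ := by field_simp
      rw [this]; linarith
    · right
      rw [div_le_iff₀ (by positivity)]
      have : 3 * Λ⁻¹ * (D * Λ) = 3 * D := by field_simp
      rw [this]; linarith
  have gen : ∀ x : ℝ, 1 ≤ x → S / (D * Λ) ≤ 3 * x⁻¹ →
      (S / (D * Λ)) ^ (q - 1) ≤ 3 ^ (q - 1) * x ^ (1 - q) := by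
    intro x hx h'
    have hx0 : 0 < x := by linarith
    calc (S / (D * Λ)) ^ (q - 1) ≤ (3 * x⁻¹) ^ (q - 1) :=
          Real.rpow_le_rpow (by positivity) h' (by linarith)
      _ = _ := by
        rw [Real.mul_rpow (by norm_num) (by positivity), Real.inv_rpow hx0.le, ← Real.rpow_neg hx0.le]
        congr 2; ring
  have one : ∀ x : ℝ, 1 ≤ x → x ^ (1 - q) ≤ 1 := fun x hx =>
    Real.rpow_le_one_of_one_le_of_nonpos hx (by linarith)
  have t0 : (0:ℝ) ≤ 3 ^ (q - 1) := by positivity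
  have d0 : 0 ≤ D⁻¹ := by positivity
  have b0 : (S / (D * Λ)) ^ (q - 1) ≤ 3 ^ (q - 1) * (D ^ (1 - q) + Λ ^ (1 - q)) ∧
    (S / (D * Λ)) ^ (q - 1) ≤ 3 ^ (q - 1) := by
    rcases cube with c | c
    · have := gen D hD c
      have := one D hD
      constructor <;> nlinarith
    · have := gen Λ hL c
      have := one Λ hL
      constructor <;> nlinarith
  have z0 : 0 ≤ (S / (D * Λ)) ^ (q - 1) := by positivity
  constructor
  · nlinarith [b0.1]
  · exact mul_le_mul_of_nonneg_right b0.2 d0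

lemma K4' {q κ a ν S D Λ : ℝ} (hS : 1 ≤ S) (hD : 1 ≤ D) (hL : 1 ≤ Λ)
    (hν : ν = κ * (a - 1) + (q * κ - 1)) :
    (S ^ (1 - κ) * D⁻¹ / Λ) ^ (q - 1) * (S ^ (1 - κ * a) * D⁻¹) =
      S ^ (-ν) * ((S / (D * Λ)) ^ (q - 1) * D⁻¹) := by
  have hS0 : 0 < S := by linarith
  have hD0 : 0 < D := by linarith
  have hL0 : 0 < Λ := by linarith
  have e : S ^ (1 - κ) * D⁻¹ / Λ = S ^ (-κ) * (S / (D * Λ)) := by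
    rw [show 1 - κ = -κ + 1 by ring, Real.rpow_add hS0, Real.rpow_one]; field_simp
  rw [e, Real.mul_rpow (by positivity) (by positivity), ← Real.rpow_mul hS0.le]
  have e2 : S ^ (-ν) = S ^ (-κ * (q - 1)) * S ^ (1 - κ * a) := by
    rw [← Real.rpow_add hS0, hν]; congr 1; ring
  rw [e2]; ring

lemma H_pt {q κ a A N₁ N₂ r s ν : ℝ} (hq : 2 < q)
    (hA : 0 ≤ A) (hN₁ : 0 ≤ N₁) (hN₂ : 0 ≤ N₂) (hu : Reg u) (hv : Reg v) (hr : 0 < r) (hs : 0 < s)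
    (bu : bracket2 u r s ≤ A * WZ κ r s) (bv : bracket2 v r s ≤ A * WZ κ r s)
    (b1 : bracket1 (u - v) r s ≤ N₁ * WZ (κ * a) r s)
    (b2 : bracket2 (u - v) r s ≤ N₂ * WZ (κ * a) r s)
    (hν : ν = κ * (a - 1) + (q * κ - 1)) {E : ℝ}
    (hE : E = (1 + r + s) ^ (-ν) * (((1 + r + s) / ((1 + |r - s|) * (1 + r))) ^ (q - 1) * (1 + |r - s|)⁻¹)) :
    |(NLt q u - NLt q v) r s| ≤ q * (A ^ (q - 1) * N₂) * E ∧
    |hh (NLt q u - NLt q v) r s| ≤ q * (A ^ (q - 1) * N₁) * E ∧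
    |dhh (NLt q u - NLt q v) r s| ≤ q * (q + 1) * (A ^ (q - 1) * N₂) * E := by
  obtain ⟨gS, gD, gL, g1, g2, g3⟩ := geo hr hs
  unfold WZ at b1 b2 bu bv
  have k := K4' (κ := κ) (a := a) (q := q) gS gD gL hν
  rw [← hE] at k
  set S := 1 + r + s
  set D := 1 + |r - s|
  set ω := S ^ (1 - κ * a) * D⁻¹ with hω
  set ω' := S ^ (1 - κ) * D⁻¹ with hω'
  have hS0 : 0 < S := by linarith
  have hD0 : 0 < D := by linarith
  have hω0 : 0 < ω := by positivity
  have hω0' : 0 < ω' := by positivity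
  have hq0 : 0 < q := by linarith
  have q1 := (bracket2_parts hr bu).1
  obtain ⟨q2, q3, -⟩ := bracket2_parts hr bv
  have q4 := bracket1_parts hr b1
  obtain ⟨q5, q6, -⟩ := bracket2_parts hr b2
  set δ := |pdt (u - v) r s| with hδ
  have hδ0 : 0 ≤ δ := abs_nonneg _
  have conv : ∀ x : ℝ, (1 + r) * x ≤ A * ω' → x ≤ A * (ω' / (1 + r)) := by
    intro x hx
    rw [← mul_div_assoc, le_div_iff₀ (by linarith)]; linarith
  have est := NL_est (p := q) (δ := δ) (Y := (q - 1) * (A * (ω' / (1 + r))) ^ (q - 2) * δ) (by linarith) hu hv hr hs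
    (conv _ q1) (conv _ q2)
    (by rw [hδ, pdt_sub hu hv hr hs]; exact sp_lip hq (conv _ q1) (conv _ q2)) le_rfl
  set X := A * (ω' / (1 + r)) with hX
  have hX0 : 0 ≤ X := by positivity
  have eX : X ^ (q - 1) = A ^ (q - 1) * (ω' / (1 + r)) ^ (q - 1) :=
    Real.mul_rpow hA (by positivity)
  have hX1 : X ^ (q - 2) * (A * ω') = X ^ (q - 1) * (1 + r) := by
    have e0 : A * ω' = X * (1 + r) := by rw [hX]; field_simp
    rw [e0, ← mul_assoc]
    congr 1
    have := Real.rpow_add_one' hX0 (y := q - 2) (by linarith)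
    rw [← this]; congr 1; ring
  have main : ∀ N y, 0 ≤ N → y ≤ N * ω → X ^ (q - 1) * y ≤ (A ^ (q - 1) * N) * E := by
    intro N y hN hy
    calc X ^ (q - 1) * y ≤ X ^ (q - 1) * (N * ω) := by gcongr
      _ = (A ^ (q - 1) * N) * ((ω' / (1 + r)) ^ (q - 1) * ω) := by rw [eX]; ring
      _ = _ := by rw [k]
  have hδ2 : δ ≤ N₂ * ω := by nlinarith
  have m1 := main N₂ δ hN₂ hδ2
  have m2 := main N₂ _ hN₂ q6
  have m3 := main N₂ _ hN₂ q5
  have m4 := main N₁ _ hN₁ q4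
  refine ⟨est.1.trans ?_, ?_, est.2.trans ?_⟩
  · have := mul_le_mul_of_nonneg_left m1 hq0.le
    linarith
  · unfold hh
    rw [abs_mul, abs_of_pos hr]
    calc _ ≤ r * (q * X ^ (q - 1) * δ) := by gcongr; exact est.1
      _ = q * (X ^ (q - 1) * (r * δ)) := by ring
      _ ≤ q * ((A ^ (q - 1) * N₁) * E) := by gcongr
      _ = _ := by ring
  · have t3 : q * ((q - 1) * X ^ (q - 2) * δ) * (r * |pdr (pdt v) r s|) ≤
        q * (q - 1) * ((A ^ (q - 1) * N₂) * E) := by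
      have hq1 : 0 ≤ q - 1 := by linarith
      calc _ ≤ q * ((q - 1) * X ^ (q - 2) * δ) * (A * ω') := by gcongr
        _ = q * (q - 1) * ((X ^ (q - 2) * (A * ω')) * δ) := by ring
        _ = q * (q - 1) * (X ^ (q - 1) * ((1 + r) * δ)) := by rw [hX1]; ring
        _ ≤ _ := by gcongr
    have i1 := mul_le_mul_of_nonneg_left m1 hq0.le
    have i2 := mul_le_mul_of_nonneg_left m2 hq0.le
    linarith

lemma H_src {q κ a A N₁ N₂ ν : ℝ} (hq : 2 < q)
    (hA : 0 ≤ A) (hN₁ : 0 ≤ N₁) (hN₂ : 0 ≤ N₂) (hu : Reg u) (hv : Reg v)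
    (hν : ν = κ * (a - 1) + (q * κ - 1)) (hν1 : 1 < ν)
    (bu : ∀ r s, 0 < r → 0 < s → bracket2 u r s ≤ A * WZ κ r s)
    (bv : ∀ r s, 0 < r → 0 < s → bracket2 v r s ≤ A * WZ κ r s)
    (b1 : ∀ r s, 0 < r → 0 < s → bracket1 (u - v) r s ≤ N₁ * WZ (κ * a) r s)
    (b2 : ∀ r s, 0 < r → 0 < s → bracket2 (u - v) r s ≤ N₂ * WZ (κ * a) r s) :
    ∃ B, SrcQ (NLt q u - NLt q v) B ν (q - 2) (mm (q - 2))
      (q * (q + 1) * 3 ^ (q - 1) * (A ^ (q - 1) * N₁)) (q * (q + 1) * 3 ^ (q - 1) * (A ^ (q - 1) * N₂)) ∧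
      IntegrableOn B (Set.Ioi 0) := by
  have hq0 : 0 < q := by linarith
  have pt := fun r s (hr : 0 < r) (hs : 0 < s) => H_pt hq hA hN₁ hN₂ hu hv hr hs (bu r s hr hs)
    (bv r s hr hs) (b1 r s hr hs) (b2 r s hr hs) hν rfl
  set P1 := A ^ (q - 1) * N₁ with hP1
  set P2 := A ^ (q - 1) * N₂ with hP2
  set T : ℝ := 3 ^ (q - 1) with hT
  have hT0 : 0 < T := by positivity
  have h1 : 0 ≤ P1 := by positivity
  have h2 : 0 ≤ P2 := by positivity
  have n1 := mul_nonneg hq0.le h1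
  have n2 := mul_nonneg hq0.le h2
  have EW : ∀ r s, 0 < r → 0 < s → ∀ E, E =
      (1 + r + s) ^ (-ν) * (((1 + r + s) / ((1 + |r - s|) * (1 + r))) ^ (q - 1) * (1 + |r - s|)⁻¹) →
      0 ≤ E ∧ E ≤ T * (1 + s) ^ (-ν) ∧ E ≤ T * PhiS ν (q - 2) (mm (q - 2)) r s ∧ E ≤ T * WZ ν r s := by
    intro r s hr hs E hE
    obtain ⟨gS, gD, gL, g1, g2, g3⟩ := geo hr hs
    have k := K4 hq gS gD gL (by linarith : 1 + r + s ≤ 1 + |r - s| + 2 * (1 + r))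
    rw [← hT] at k
    have e1 : (1 + r + s) ^ (-ν) ≤ (1 + s) ^ (-ν) := rp_anti (by linarith) (by linarith) (by linarith)
    have e3 : 0 ≤ (1 + r + s) ^ (-ν) := by positivity
    have e5 : (1 + r + s) ^ (-ν) ≤ (1 + r + s) ^ (1 - ν) :=
        Real.rpow_le_rpow_of_exponent_le gS (by linarith)
    have iD : (1 + |r - s|)⁻¹ ≤ 1 := inv_le_one_of_one_le₀ gD
    have iD0 : 0 ≤ (1 + |r - s|)⁻¹ := by positivity
    have EW1 : E ≤ (1 + r + s) ^ (-ν) * (T * (1 + |r - s|)⁻¹) := by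
      rw [hE]; exact mul_le_mul_of_nonneg_left k.2 e3
    refine ⟨by rw [hE]; positivity, EW1.trans ?_, ?_, EW1.trans ?_⟩
    · calc _ ≤ (1 + s) ^ (-ν) * (T * 1) := by gcongr
        _ = _ := by ring
    · rw [hE, phi_eq hr]
      have e6 : mm (q - 2) r = (1 + r) ^ (1 - q) := by
        unfold mm; rw [abs_of_pos hr]; congr 1; ring
      rw [e6, show -1 - (q - 2) = 1 - q by ring]
      calc _ ≤ _ := mul_le_mul_of_nonneg_left k.1 e3
        _ = _ := by ring
    · unfold WZ
      calc _ ≤ (1 + r + s) ^ (1 - ν) * (T * (1 + |r - s|)⁻¹) := by gcongr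
        _ = _ := by ring
  have step : ∀ c P E W : ℝ, 0 ≤ c → c ≤ q * (q + 1) → 0 ≤ P → 0 ≤ E → E ≤ T * W →
      c * P * E ≤ q * (q + 1) * T * P * W := by
    intro c P E W hc hc' hP hE hEW
    calc c * P * E ≤ q * (q + 1) * P * (T * W) := by gcongr
      _ = _ := by ring
  have c1 : q ≤ q * (q + 1) := by nlinarith
  have W0 : ∀ s : ℝ, 0 < s → 0 ≤ (1 + s) ^ (-ν) := fun s hs => by positivity
  have src := NL_src (p := q) (by linarith) hu hv (B := fun s => (q * (q + 1) * T * (P1 + P2)) * (1 + s) ^ (-ν))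
    (M := q * (q + 1) * T * (P1 + P2)) (ν := ν) (by positivity) (by linarith) rfl (by
      intro r s hr hs
      obtain ⟨w0, w1, w2, w3⟩ := EW r s hr hs _ rfl
      refine (pt r s hr hs).1.trans ((step _ _ _ _ hq0.le c1 h2 w0 w1).trans ?_)
      have := W0 s hs
      gcongr
      linarith) (by
      intro r s hr hs
      obtain ⟨w0, w1, w2, w3⟩ := EW r s hr hs _ rfl
      refine (pt r s hr hs).2.1.trans ((step _ _ _ _ hq0.le c1 h1 w0 w1).trans ?_)
      have := W0 s hs
      gcongr
      linarith) (by
      intro r s hr hs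
      obtain ⟨w0, w1, w2, w3⟩ := EW r s hr hs _ rfl
      refine (pt r s hr hs).2.2.trans ((step _ _ _ _ (by positivity) le_rfl h2 w0 w1).trans ?_)
      have := W0 s hs
      gcongr
      linarith)
  refine ⟨_, ⟨src.1, by positivity, by positivity, ?_, ?_, ?_⟩, src.2 hν1⟩
  · intro r s hr hs
    obtain ⟨w0, w1, w2, w3⟩ := EW r s hr hs _ rfl
    exact (pt r s hr hs).2.1.trans (step _ _ _ _ hq0.le c1 h1 w0 w2)
  · intro r s hr hs
    obtain ⟨w0, w1, w2, w3⟩ := EW r s hr hs _ rfl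
    exact (pt r s hr hs).2.2.trans (step _ _ _ _ (by positivity) le_rfl h2 w0 w2)
  · intro r s hr hs
    obtain ⟨w0, w1, w2, w3⟩ := EW r s hr hs _ rfl
    exact (pt r s hr hs).2.1.trans (step _ _ _ _ hq0.le c1 h1 w0 w3)

end HSrc


section memXsec

lemma memX.reg {u : ℝ → ℝ → ℝ} (h : memX 2 u) : Reg u := by
  obtain ⟨h1, h2, h3⟩ := h
  have sl : ∀ r t, 0 < r → 0 ≤ t → ContDiffAt ℝ 2 (fun r' => u r' t) r := by
    intro r t hr ht
    have hc : ContDiff ℝ 2 (fun r' : ℝ => r' * u r' t) := by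
      rw [← contDiffOn_univ]
      have := h2.comp (s := Set.univ) (f := fun r' : ℝ => ((r', t) : ℝ × ℝ)) (by fun_prop)
        (by intro x _; exact ⟨trivial, ht⟩)
      exact_mod_cast this
    have hd : ContDiffAt ℝ 2 (fun r' : ℝ => (r' * u r' t) / r') r :=
      hc.contDiffAt.div contDiffAt_id hr.ne'
    refine hd.congr_of_eventuallyEq ?_
    filter_upwards [lt_mem_nhds hr] with x hx
    field_simp
  have U2 : ∀ r t, 0 < r → 0 < t → ContDiffAt ℝ 2 (fun z : ℝ × ℝ => u z.1 z.2) (r, t) := by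
    intro r t hr ht
    have hc : ContDiffAt ℝ 2 (fun z : ℝ × ℝ => z.1 * u z.1 z.2) (r, t) := by
      have := h2.contDiffAt (x := (r, t)) (prod_mem_nhds univ_mem (Ici_mem_nhds ht))
      exact_mod_cast this
    have hd : ContDiffAt ℝ 2 (fun z : ℝ × ℝ => (z.1 * u z.1 z.2) / z.1) (r, t) :=
      hc.div contDiffAt_fst hr.ne'
    refine hd.congr_of_eventuallyEq ?_
    have : ∀ᶠ z : ℝ × ℝ in nhds (r, t), 0 < z.1 :=
      (continuous_fst.tendsto (r, t)).eventually (lt_mem_nhds hr)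
    filter_upwards [this] with z hz
    field_simp
  have pd : ∀ r t, 0 < r → 0 < t → HasDerivAt (fun t' => u r t')
      (fderiv ℝ (fun z : ℝ × ℝ => u z.1 z.2) (r, t) (0, 1)) t := by
    intro r t hr ht
    have hd := ((U2 r t hr ht).differentiableAt (by norm_num)).hasFDerivAt
    exact hd.comp_hasDerivAt t ((hasDerivAt_const t r).prodMk (hasDerivAt_id t))
  have V1 : ∀ r t, 0 < r → 0 < t → ContDiffAt ℝ 1 (fun z : ℝ × ℝ => pdt u z.1 z.2) (r, t) := by
    intro r t hr ht
    have hc : ContDiffAt ℝ 1 (fun z : ℝ × ℝ => fderiv ℝ (fun z : ℝ × ℝ => u z.1 z.2) z (0, 1)) (r, t) :=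
      ((U2 r t hr ht).fderiv_right (m := 1) (by norm_num)).clm_apply contDiffAt_const
    refine hc.congr_of_eventuallyEq ?_
    have e1 : ∀ᶠ z : ℝ × ℝ in nhds (r, t), 0 < z.1 :=
      (continuous_fst.tendsto (r, t)).eventually (lt_mem_nhds hr)
    have e2 : ∀ᶠ z : ℝ × ℝ in nhds (r, t), 0 < z.2 :=
      (continuous_snd.tendsto (r, t)).eventually (lt_mem_nhds ht)
    filter_upwards [e1, e2] with z hz hz'
    exact (pd z.1 z.2 hz hz').deriv
  refine ⟨fun r t ht => h3 r t ht.le, ?_, ?_, ?_, ?_, ?_, ?_⟩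
  · intro r t hr ht
    exact (sl r t hr ht).differentiableAt (by norm_num)
  · intro r t hr ht
    have hc := (sl r t hr ht).fderiv_right (m := 1) (by norm_num)
    have hc2 : ContDiffAt ℝ 1 (fun r' => fderiv ℝ (fun r' => u r' t) r' 1) r :=
      hc.clm_apply contDiffAt_const
    exact hc2.differentiableAt (by norm_num)
  · intro r t hr ht
    exact (pd r t hr ht).differentiableAt
  · intro r t hr ht
    have := ((V1 r t hr ht).differentiableAt (by norm_num)).hasFDerivAt
    exact (this.comp_hasDerivAt r ((hasDerivAt_id r).prodMk (hasDerivAt_const r t))).differentiableAt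
  · intro r t hr ht
    have := ((V1 r t hr ht).differentiableAt (by norm_num)).hasFDerivAt
    exact (this.comp_hasDerivAt t ((hasDerivAt_const t r).prodMk (hasDerivAt_id t))).differentiableAt
  · intro z hz
    exact ((V1 z.1 z.2 hz.1 hz.2).continuousAt).continuousWithinAt

lemma bS1 (u : ℝ → ℝ → ℝ) (r t : ℝ) : bracketS 1 u r t = bracket1 u r t := by simp [bracketS]
lemma bS2 (u : ℝ → ℝ → ℝ) (r t : ℝ) : bracketS 2 u r t = bracket2 u r t := by simp [bracketS]

lemma bS_nonneg (n : ℕ) (u : ℝ → ℝ → ℝ) {r t : ℝ} (hr : 0 < r) : 0 ≤ bracketS n u r t := by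
  unfold bracketS; split_ifs
  · exact bracket1_nonneg hr
  · exact bracket2_nonneg hr

lemma WZ_inv {ν r t : ℝ} (hr : 0 < r) (ht : 0 ≤ t) :
    (1 + r + t) ^ (ν - 1) * (1 + |r - t|) = (WZ ν r t)⁻¹ := by
  unfold WZ
  rw [mul_inv, inv_inv, ← Real.rpow_neg (by linarith)]; congr 2; ring

lemma ZSet_iff {n : ℕ} {ν N : ℝ} {u : ℝ → ℝ → ℝ} : N ∈ upperBounds (ZSet n ν u) ↔
    ∀ r t, 0 < r → 0 ≤ t → bracketS n u r t ≤ N * WZ ν r t := by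
  constructor
  · intro h r t hr ht
    have := h ⟨r, t, hr, ht, rfl⟩
    rw [mul_assoc, WZ_inv hr ht, ← div_eq_mul_inv, div_le_iff₀ (WZ_pos hr ht)] at this
    exact this
  · rintro h _ ⟨r, t, hr, ht, rfl⟩
    rw [mul_assoc, WZ_inv hr ht, ← div_eq_mul_inv, div_le_iff₀ (WZ_pos hr ht)]
    exact h r t hr ht

lemma ZSet_nonempty {n : ℕ} {ν : ℝ} {u : ℝ → ℝ → ℝ} : (ZSet n ν u).Nonempty :=
  ⟨_, 1, 0, one_pos, le_rfl, rfl⟩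

lemma Znorm_nonneg {n : ℕ} {ν : ℝ} {u : ℝ → ℝ → ℝ} : 0 ≤ Znorm n ν u := by
  apply Real.sSup_nonneg
  rintro _ ⟨r, t, hr, ht, rfl⟩
  have := bS_nonneg n u (t := t) hr
  positivity

lemma Znorm_le {n : ℕ} {ν N : ℝ} {u : ℝ → ℝ → ℝ}
    (h : ∀ r t, 0 < r → 0 ≤ t → bracketS n u r t ≤ N * WZ ν r t) :
    BddAbove (ZSet n ν u) ∧ Znorm n ν u ≤ N :=
  ⟨⟨N, ZSet_iff.2 h⟩, csSup_le ZSet_nonempty (ZSet_iff.2 h)⟩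

lemma Znorm_bd {n : ℕ} {ν : ℝ} {u : ℝ → ℝ → ℝ} (h : BddAbove (ZSet n ν u)) {r t : ℝ} (hr : 0 < r) (ht : 0 ≤ t) :
    bracketS n u r t ≤ Znorm n ν u * WZ ν r t :=
  ZSet_iff.1 (fun _ hx => le_csSup h hx) r t hr ht

lemma ZSet_sub1 {ν : ℝ} {u v w : ℝ → ℝ → ℝ} (hu : Reg u) (hv : Reg v) (hw : Reg w)
    (h1 : BddAbove (ZSet 1 ν (u - w))) (h2 : BddAbove (ZSet 1 ν (v - w))) :
    BddAbove (ZSet 1 ν (u - v)) := by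
  set N := Znorm 1 ν (u - w) + Znorm 1 ν (v - w) with hN
  have hN0 : 0 ≤ N := add_nonneg Znorm_nonneg Znorm_nonneg
  have e : u - v = (u - w) + -(v - w) := by abel
  have := T0_1 (u := u - v) (ν := ν) (N := N) (hu.sub hv) hN0 (by
    intro r t hr ht
    rw [e]
    refine (bracket1_add (hu.sub hw) (hv.sub hw).neg hr ht).trans ?_
    have i1 := Znorm_bd h1 hr ht.le
    have i2 := Znorm_bd h2 hr ht.le
    rw [bS1] at i1 i2
    rw [bracket1_neg, hN, add_mul]
    exact add_le_add i1 i2) (by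
    intro r hr
    rw [e]
    refine (rpart1_add (hu.sub hw) (hv.sub hw).neg hr le_rfl).trans ?_
    have i1 := Znorm_bd h1 hr le_rfl
    have i2 := Znorm_bd h2 hr le_rfl
    rw [bS1] at i1 i2
    rw [rpart1_neg, hN, add_mul]
    exact add_le_add ((rpart1_le hr).trans i1) ((rpart1_le hr).trans i2))
  refine (Znorm_le (N := 5 * cw ν * N) ?_).1
  intro r t hr ht
  rw [bS1]; exact this r t hr ht

lemma ZSet_sub2 {ν : ℝ} {u v w : ℝ → ℝ → ℝ} (hu : Reg u) (hv : Reg v) (hw : Reg w)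
    (h1 : BddAbove (ZSet 2 ν (u - w))) (h2 : BddAbove (ZSet 2 ν (v - w))) :
    BddAbove (ZSet 2 ν (u - v)) := by
  set N := Znorm 2 ν (u - w) + Znorm 2 ν (v - w) with hN
  have hN0 : 0 ≤ N := add_nonneg Znorm_nonneg Znorm_nonneg
  have e : u - v = (u - w) + -(v - w) := by abel
  have := T0_2 (u := u - v) (ν := ν) (N := N) (hu.sub hv) hN0 (by
    intro r t hr ht
    rw [e]
    refine (bracket2_add (hu.sub hw) (hv.sub hw).neg hr ht).trans ?_
    have i1 := Znorm_bd h1 hr ht.le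
    have i2 := Znorm_bd h2 hr ht.le
    rw [bS2] at i1 i2
    rw [bracket2_neg, hN, add_mul]
    exact add_le_add i1 i2) (by
    intro r hr
    rw [e]
    refine (rpart2_add (hu.sub hw) (hv.sub hw).neg hr le_rfl).trans ?_
    have i1 := Znorm_bd h1 hr le_rfl
    have i2 := Znorm_bd h2 hr le_rfl
    rw [bS2] at i1 i2
    rw [rpart2_neg, hN, add_mul]
    exact add_le_add ((rpart2_le hr).trans i1) ((rpart2_le hr).trans i2))
  refine (Znorm_le (N := 5 * cw ν * N) ?_).1
  intro r t hr ht
  rw [bS2]; exact this r t hr ht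

end memXsec


section Comb

def Dk (κ₂ A : ℝ) (u : ℝ → ℝ → ℝ) : Prop :=
  ∀ r t, 0 < r → 0 < t → bracket2 u r t ≤ A * (1 + |r - t|) ^ (-κ₂)
def Z1 (ν N : ℝ) (u : ℝ → ℝ → ℝ) : Prop := ∀ r t, 0 < r → 0 < t → bracket1 u r t ≤ N * WZ ν r t
def Z2 (ν N : ℝ) (u : ℝ → ℝ → ℝ) : Prop := ∀ r t, 0 < r → 0 < t → bracket2 u r t ≤ N * WZ ν r t

lemma Z1.mono {ν N N' : ℝ} {u} (h : Z1 ν N u) (hN : N ≤ N') : Z1 ν N' u := fun r t hr ht =>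
  (h r t hr ht).trans (mul_le_mul_of_nonneg_right hN (WZ_pos hr ht.le).le)
lemma Z2.mono {ν N N' : ℝ} {u} (h : Z2 ν N u) (hN : N ≤ N') : Z2 ν N' u := fun r t hr ht =>
  (h r t hr ht).trans (mul_le_mul_of_nonneg_right hN (WZ_pos hr ht.le).le)
lemma Dk.mono {ν N N' : ℝ} {u} (h : Dk ν N u) (hN : N ≤ N') : Dk ν N' u := fun r t hr ht =>
  (h r t hr ht).trans (mul_le_mul_of_nonneg_right hN (by positivity))

lemma Z1.add {ν N N' : ℝ} {u v} (h : Z1 ν N u) (h' : Z1 ν N' v) (hu : Reg u) (hv : Reg v) :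
    Z1 ν (N + N') (u + v) := fun r t hr ht => by
  rw [add_mul]; exact (bracket1_add hu hv hr ht).trans (add_le_add (h r t hr ht) (h' r t hr ht))
lemma Z2.add {ν N N' : ℝ} {u v} (h : Z2 ν N u) (h' : Z2 ν N' v) (hu : Reg u) (hv : Reg v) :
    Z2 ν (N + N') (u + v) := fun r t hr ht => by
  rw [add_mul]; exact (bracket2_add hu hv hr ht).trans (add_le_add (h r t hr ht) (h' r t hr ht))
lemma Dk.add {ν N N' : ℝ} {u v} (h : Dk ν N u) (h' : Dk ν N' v) (hu : Reg u) (hv : Reg v) :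
    Dk ν (N + N') (u + v) := fun r t hr ht => by
  rw [add_mul]; exact (bracket2_add hu hv hr ht).trans (add_le_add (h r t hr ht) (h' r t hr ht))

lemma Z2.toZ1 {ν N : ℝ} {u} (h : Z2 ν N u) : Z1 ν N u := fun r t hr ht =>
  (bracket1_le_bracket2 hr).trans (h r t hr ht)

lemma WZ_anti {ν ν' r t : ℝ} (hr : 0 < r) (ht : 0 ≤ t) (h : ν' ≤ ν) : WZ ν r t ≤ WZ ν' r t := by
  unfold WZ
  have : (1 + r + t) ^ (1 - ν) ≤ (1 + r + t) ^ (1 - ν') :=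
    Real.rpow_le_rpow_of_exponent_le (by linarith) (by linarith)
  gcongr

lemma Z2.weaken {ν ν' N : ℝ} {u} (h : Z2 ν N u) (hN : 0 ≤ N) (h' : ν' ≤ ν) : Z2 ν' N u :=
  fun r t hr ht => (h r t hr ht).trans (mul_le_mul_of_nonneg_left (WZ_anti hr ht.le h') hN)

lemma Dk.toZ2 {κ₂ ν N : ℝ} {u} (h : Dk κ₂ N u) (hN : 0 ≤ N) (h1 : ν ≤ 1) (h2 : ν ≤ κ₂) : Z2 ν N u := by
  intro r t hr ht
  obtain ⟨gS, gD, gL, g1, g2, g3⟩ := geo hr ht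
  refine (h r t hr ht).trans (mul_le_mul_of_nonneg_left ?_ hN)
  unfold WZ
  have hD0 : 0 < 1 + |r - t| := by linarith
  calc (1 + |r - t|) ^ (-κ₂) ≤ (1 + |r - t|) ^ (-ν) :=
        Real.rpow_le_rpow_of_exponent_le gD (by linarith)
    _ = (1 + |r - t|) ^ (1 - ν) * (1 + |r - t|)⁻¹ := by
        rw [← Real.rpow_neg_one (1 + |r - t|), ← Real.rpow_add hD0]; congr 1; ring
    _ ≤ _ := by
        have : (1 + |r - t|) ^ (1 - ν) ≤ (1 + r + t) ^ (1 - ν) :=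
          Real.rpow_le_rpow hD0.le g3 (by linarith)
        gcongr

lemma Z2.toDk {κ₂ ν N : ℝ} {u} (h : Z2 ν N u) (hN : 0 ≤ N) (h1 : 1 ≤ ν) (h2 : κ₂ ≤ ν) : Dk κ₂ N u := by
  intro r t hr ht
  obtain ⟨gS, gD, gL, g1, g2, g3⟩ := geo hr ht
  refine (h r t hr ht).trans (mul_le_mul_of_nonneg_left ?_ hN)
  unfold WZ
  have hD0 : 0 < 1 + |r - t| := by linarith
  calc _ ≤ (1 + |r - t|) ^ (1 - ν) * (1 + |r - t|)⁻¹ := by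
        have : (1 + r + t) ^ (1 - ν) ≤ (1 + |r - t|) ^ (1 - ν) := by
          have := rp_anti hD0 g3 (by linarith : 0 ≤ ν - 1)
          rwa [neg_sub] at this
        gcongr
    _ = (1 + |r - t|) ^ (-ν) := by
        rw [← Real.rpow_neg_one (1 + |r - t|), ← Real.rpow_add hD0]; congr 1; ring
    _ ≤ _ := Real.rpow_le_rpow_of_exponent_le gD (by linarith)

theorem LG {p κ₂ a : ℝ} (hp : 1 < p) (hp2 : p < 2) (hκ₂ : 1 < κ₂) (ha : 1 ≤ a) (hν : (p - 1) * a < 1) :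
    ∃ C > 0, ∀ u v A N₁ N₂, 0 ≤ A → 0 ≤ N₁ → N₁ ≤ N₂ → Reg u → Reg v → Dk κ₂ A u → Dk κ₂ A v →
      Z1 a N₁ (u - v) → Z2 a N₂ (u - v) →
      Reg (Lop (NLt p u - NLt p v)) ∧ Z1 ((p - 1) * a) (C * (A ^ (p - 1) * N₁)) (Lop (NLt p u - NLt p v)) ∧
      Z2 ((p - 1) * a) (C * (A ^ (p - 1) * N₂ + A * N₁ ^ (p - 1))) (Lop (NLt p u - NLt p v)) := by
  obtain ⟨C, hC, H⟩ := L_bound (ν := (p - 1) * a) (η := (p - 1) * (κ₂ - 1)) (k := jk (p - 1))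
    (mul_nonneg (by linarith) (by linarith)) hν (mul_pos (by linarith) (by linarith)) (jk_ker (by linarith))
  have hp0 : 0 < p := by linarith
  refine ⟨C * (16 * p), by positivity, ?_⟩
  intro u v A N₁ N₂ hA hN₁ hN hu hv bu bv b1 b2
  have hN₂ : 0 ≤ N₂ := hN₁.trans hN
  obtain ⟨B, hB, -⟩ := G_src hp hp2 hκ₂.le ha hA hN₁ hN₂ hu hv bu bv b1 b2
  obtain ⟨h1, h2, h3⟩ := H _ _ _ _ hB
  have a0 : 0 ≤ A ^ (p - 1) := by positivity
  have i1 : A ^ (p - 1) * N₁ ≤ A ^ (p - 1) * N₂ := by gcongr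
  have i2 : 0 ≤ A ^ (p - 1) * N₁ := by positivity
  have i3 : 0 ≤ A * N₁ ^ (p - 1) := by positivity
  have cp : 0 < C * p := by positivity
  refine ⟨h1, Z1.mono h2 ?_, Z2.mono h3 ?_⟩
  · nlinarith
  · nlinarith

theorem RG {p κ₂ a : ℝ} (hp : 1 < p) (hp2 : p < 2) (hκ₂ : 1 < κ₂) (ha : 1 ≤ a) (hν : 1 < (p - 1) * a) :
    ∃ C > 0, ∀ u v A N₁ N₂, 0 ≤ A → 0 ≤ N₁ → N₁ ≤ N₂ → Reg u → Reg v → Dk κ₂ A u → Dk κ₂ A v →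
      Z1 a N₁ (u - v) → Z2 a N₂ (u - v) →
      (∀ r t, 0 < r → 0 ≤ t → bracket1 (Rop (NLt p u - NLt p v)) r t ≤
        C * (A ^ (p - 1) * N₁) * WZ ((p - 1) * a) r t) ∧
      (∀ r t, 0 < r → 0 ≤ t → bracket2 (Rop (NLt p u - NLt p v)) r t ≤
        C * (A ^ (p - 1) * N₂ + A * N₁ ^ (p - 1)) * WZ ((p - 1) * a) r t) := by
  obtain ⟨C, hC, H⟩ := R_bound (ν := (p - 1) * a) (η := (p - 1) * (κ₂ - 1)) (k := jk (p - 1))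
    hν (mul_pos (by linarith) (by linarith)) (jk_ker (by linarith))
  have hp0 : 0 < p := by linarith
  refine ⟨C * (16 * p), by positivity, ?_⟩
  intro u v A N₁ N₂ hA hN₁ hN hu hv bu bv b1 b2
  have hN₂ : 0 ≤ N₂ := hN₁.trans hN
  obtain ⟨B, hB, hB'⟩ := G_src hp hp2 hκ₂.le ha hA hN₁ hN₂ hu hv bu bv b1 b2
  obtain ⟨h1, h2, h3⟩ := H _ _ _ _ hB (hB' hν)
  have a0 : 0 ≤ A ^ (p - 1) := by positivity
  have i1 : A ^ (p - 1) * N₁ ≤ A ^ (p - 1) * N₂ := by gcongr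
  have i2 : 0 ≤ A ^ (p - 1) * N₁ := by positivity
  have i3 : 0 ≤ A * N₁ ^ (p - 1) := by positivity
  have cp : 0 < C * p := by positivity
  refine ⟨fun r t hr ht => (h2 r t hr ht).trans (mul_le_mul_of_nonneg_right ?_ (WZ_pos hr ht).le),
    fun r t hr ht => (h3 r t hr ht).trans (mul_le_mul_of_nonneg_right ?_ (WZ_pos hr ht).le)⟩
  · nlinarith
  · nlinarith

theorem RH {q κ a ν : ℝ} (hq : 2 < q) (hν : ν = κ * (a - 1) + (q * κ - 1)) (hν1 : 1 < ν) :
    ∃ C > 0, ∀ u v A N₁ N₂, 0 ≤ A → 0 ≤ N₁ → N₁ ≤ N₂ → Reg u → Reg v → Z2 κ A u → Z2 κ A v →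
      Z1 (κ * a) N₁ (u - v) → Z2 (κ * a) N₂ (u - v) →
      Reg (Rop (NLt q u - NLt q v)) ∧
      (∀ r t, 0 < r → 0 ≤ t → bracket1 (Rop (NLt q u - NLt q v)) r t ≤ C * (A ^ (q - 1) * N₁) * WZ ν r t) ∧
      (∀ r t, 0 < r → 0 ≤ t → bracket2 (Rop (NLt q u - NLt q v)) r t ≤ C * (A ^ (q - 1) * N₂) * WZ ν r t) := by
  obtain ⟨C, hC, H⟩ := R_bound (ν := ν) (η := q - 2) (k := mm (q - 2))
    hν1 (by linarith) (mm_ker (by linarith))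
  have hq0 : 0 < q := by linarith
  set c : ℝ := q * (q + 1) * 3 ^ (q - 1) with hc
  have hc0 : 0 < c := by positivity
  refine ⟨C * (2 * c), by positivity, ?_⟩
  intro u v A N₁ N₂ hA hN₁ hN hu hv bu bv b1 b2
  have hN₂ : 0 ≤ N₂ := hN₁.trans hN
  obtain ⟨B, hB, hB'⟩ := H_src hq hA hN₁ hN₂ hu hv hν hν1 bu bv b1 b2
  rw [← hc] at hB
  obtain ⟨h1, h2, h3⟩ := H _ _ _ _ hB hB'
  have a0 : 0 ≤ A ^ (q - 1) := by positivity
  have i1 : A ^ (q - 1) * N₁ ≤ A ^ (q - 1) * N₂ := by gcongr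
  have i2 : 0 ≤ A ^ (q - 1) * N₁ := by positivity
  have cp : 0 < C * c := by positivity
  refine ⟨h1, fun r t hr ht => (h2 r t hr ht).trans (mul_le_mul_of_nonneg_right ?_ (WZ_pos hr ht).le),
    fun r t hr ht => (h3 r t hr ht).trans (mul_le_mul_of_nonneg_right ?_ (WZ_pos hr ht).le)⟩
  · nlinarith
  · nlinarith

end Comb



section Iter

lemma eps_anti {ε x y : ℝ} (h0 : 0 < ε) (h1 : ε ≤ 1) (h : x ≤ y) : ε ^ y ≤ ε ^ x :=
  Real.rpow_le_rpow_of_exponent_ge h0 h1 h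

lemma eps_le {ε y : ℝ} (h0 : 0 < ε) (h1 : ε ≤ 1) (h : 1 ≤ y) : ε ^ y ≤ ε := by
  simpa using eps_anti h0 h1 h

lemma eps_le_one {ε y : ℝ} (h0 : 0 < ε) (h1 : ε ≤ 1) (h : 0 ≤ y) : ε ^ y ≤ 1 :=
  Real.rpow_le_one h0.le h1 h

structure Par (p q : ℝ) : Prop where
  hp1 : 1 < p
  hp2 : p < 2
  hq : 2 < q
  hk2 : 1 < q * (p - 1) - 1
  hkq : 1 < (p - 1) * q

lemma par_of {p q : ℝ} (hp1 : 1 < p) (hp2 : p < 2) (hcond : (p - 1) ^ 2 * (q - 1) > 1) : Par p q := by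
  have h0 : 0 < p - 1 := by linarith
  have h1 : p - 1 < 1 := by linarith
  have hq : 2 < q := by
    by_contra hh
    push Not at hh
    nlinarith [mul_pos h0 h0]
  have e : 0 < (p - 1) * (q * (p - 1) - 2) := by nlinarith [sq_nonneg (1 - (p - 1))]
  have e2 : 0 < q * (p - 1) - 2 := (mul_pos_iff_of_pos_left h0).1 e
  exact ⟨hp1, hp2, hq, by linarith, by linarith⟩

lemma aseq_ge {κ κ₂ : ℝ} (hκ : 0 ≤ κ) (h2 : 1 ≤ κ₂) (n : ℕ) : 1 ≤ aseq κ κ₂ n := by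
  induction n with
  | zero => simp [aseq]
  | succ n ih => simp only [aseq]; nlinarith [mul_nonneg hκ (sub_nonneg.2 ih)]

lemma aseq_succ_ge {κ κ₂ : ℝ} (hκ : 0 ≤ κ) (h2 : 1 ≤ κ₂) (n : ℕ) : κ₂ ≤ aseq κ κ₂ (n + 1) := by
  simp only [aseq]; nlinarith [mul_nonneg hκ (sub_nonneg.2 (aseq_ge hκ h2 n))]

lemma aseq_le_succ {κ κ₂ : ℝ} (hκ : 0 ≤ κ) (h2 : 1 ≤ κ₂) (n : ℕ) : aseq κ κ₂ n ≤ aseq κ κ₂ (n + 1) := by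
  induction n with
  | zero => simpa [aseq] using h2
  | succ n ih =>
    have := mul_le_mul_of_nonneg_left ih hκ
    show κ * (aseq κ κ₂ n - 1) + κ₂ ≤ κ * (aseq κ κ₂ (n + 1) - 1) + κ₂
    linarith

lemma aseq_mono {κ κ₂ : ℝ} (hκ : 0 ≤ κ) (h2 : 1 ≤ κ₂) : Monotone (aseq κ κ₂) :=
  monotone_nat_of_le_succ (aseq_le_succ hκ h2)

structure IterInv (p q a b C ε : ℝ) (v w' v' : ℝ → ℝ → ℝ) : Prop where
  rv : Reg v
  rw' : Reg w'
  rv' : Reg v'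
  dv : Dk (q * (p - 1) - 1) (C * ε) v
  dv' : Dk (q * (p - 1) - 1) (C * ε) v'
  zw : Z2 (p - 1) (C * ε) w'
  z1 : Z1 a (C * ε ^ b) (v' - v)
  z2 : Z2 a (C * ε ^ ((p - 1) * b)) (v' - v)

lemma Z2_zero_sub {ν N : ℝ} {u : ℝ → ℝ → ℝ} (h : Z2 ν N u) : Z2 ν N (u - 0) := by rwa [sub_zero]

lemma Dk_zero {κ A : ℝ} (hA : 0 ≤ A) : Dk κ A 0 := fun r t _ _ => by
  rw [bracket2_zero]; positivity

lemma Z2_zero {κ A : ℝ} (hA : 0 ≤ A) : Z2 κ A 0 := fun r t hr ht => by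
  rw [bracket2_zero]; exact mul_nonneg hA (WZ_pos hr ht.le).le

lemma base {p q : ℝ} (P : Par p q) : ∃ C > 0, ∀ ε, 0 < ε → ε ≤ 1 → ∀ fg1 fg2 : (ℝ → ℝ) × (ℝ → ℝ),
    memY (p - 1) ε fg1 → memY (q * (p - 1) - 1) ε fg2 →
    IterInv p q (aseq (p - 1) (q * (p - 1) - 1) 1) q C ε (iterAux p q fg1 fg2 0).1.2
      (iterAux p q fg1 fg2 0).2.1 (iterAux p q fg1 fg2 0).2.2 := by
  obtain ⟨hp1, hp2, hq, hk2, hkq⟩ := P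
  have hk0 : 0 < p - 1 := by linarith
  set c1 : ℝ := 42 + 36 * 2 ^ (p - 1) with hc1
  set c2 : ℝ := 42 + 36 * 2 ^ (q * (p - 1) - 1) with hc2
  have c1p : 0 < c1 := by positivity
  have c2p : 0 < c2 := by positivity
  obtain ⟨C1, hC1, H1⟩ := LG (a := 1) hp1 hp2 hk2 le_rfl (by linarith)
  obtain ⟨C2, hC2, H2⟩ := RH (κ := p - 1) (a := 1) (ν := q * (p - 1) - 1) hq (by ring) hk2
  set c3 : ℝ := C1 * (2 * (c2 ^ (p - 1) * c2)) with hc3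
  have c3p : 0 < c3 := by positivity
  set c4 := c1 + c3 with hc4
  have c4p : 0 < c4 := by positivity
  set c5 := C2 * (c4 ^ (q - 1) * c4) with hc5
  have c5p : 0 < c5 := by positivity
  refine ⟨c2 + c4 + c5, by positivity, ?_⟩
  intro ε he he1 fg1 fg2 hY1 hY2
  simp only [iterAux]
  have rw0 := hY1.Kreg hk0.le
  have rv0 := hY2.Kreg (by linarith)
  have dv0 : Dk (q * (p - 1) - 1) (c2 * ε) (Kop fg2) := fun r t hr ht => hY2.Kbd (by linarith) hr ht
  have dw0 : Dk (p - 1) (c1 * ε) (Kop fg1) := fun r t hr ht => hY1.Kbd hk0.le hr ht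
  have zw0 : Z2 (p - 1) (c1 * ε) (Kop fg1) := dw0.toZ2 (by positivity) (by linarith) le_rfl
  have zv0 : Z2 1 (c2 * ε) (Kop fg2) := dv0.toZ2 (by positivity) le_rfl hk2.le
  obtain ⟨rL, -, zL⟩ := H1 (Kop fg2) 0 (c2 * ε) (c2 * ε) (c2 * ε) (by positivity) (by positivity) le_rfl
    rv0 reg_zero dv0 (Dk_zero (by positivity)) (Z2_zero_sub zv0).toZ1 (Z2_zero_sub zv0)
  rw [NLt_zero hp1, sub_zero, mul_one] at zL
  rw [NLt_zero hp1, sub_zero] at rL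
  have ek : (c2 * ε) ^ (p - 1) ≤ c2 ^ (p - 1) :=
    Real.rpow_le_rpow (by positivity) (by nlinarith) hk0.le
  have zL' : Z2 (p - 1) (c3 * ε) (Lop (NLt p (Kop fg2))) := by
    refine zL.mono ?_
    rw [hc3]
    have := mul_le_mul_of_nonneg_right ek (by positivity : 0 ≤ c2 * ε)
    calc _ = C1 * (2 * ((c2 * ε) ^ (p - 1) * (c2 * ε))) := by ring
      _ ≤ C1 * (2 * (c2 ^ (p - 1) * (c2 * ε))) := by gcongr
      _ = _ := by ring
  set w1 := Kop fg1 + Lop (NLt p (Kop fg2)) with hw1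
  have rw1 : Reg w1 := rw0.add rL
  have zw1 : Z2 (p - 1) (c4 * ε) w1 := (zw0.add zL' rw0 rL).mono (by rw [hc4]; linarith)
  have zw1' : Z2 ((p - 1) * 1) (c4 * ε) (w1 - 0) := by rw [mul_one]; exact Z2_zero_sub zw1
  obtain ⟨rR, -, zR⟩ := H2 w1 0 (c4 * ε) (c4 * ε) (c4 * ε) (by positivity) (by positivity) le_rfl
    rw1 reg_zero zw1 (Z2_zero (by positivity)) zw1'.toZ1 zw1'
  rw [NLt_zero (by linarith), sub_zero] at zR rR
  have eq1 : C2 * ((c4 * ε) ^ (q - 1) * (c4 * ε)) = c5 * ε ^ q := by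
    rw [Real.mul_rpow c4p.le he.le, hc5]
    have : ε ^ q = ε ^ (q - 1) * ε := by
      nth_rewrite 3 [← Real.rpow_one ε]; rw [← Real.rpow_add he]; congr 1; ring
    rw [this]; ring
  rw [eq1] at zR
  have zR2 : Z2 (q * (p - 1) - 1) (c5 * ε ^ q) (Rop (NLt q w1)) := fun r t hr ht => zR r t hr ht.le
  have e1 : ε ^ q ≤ ε := eps_le he he1 (by linarith)
  have e2 : ε ^ q ≤ ε ^ ((p - 1) * q) := eps_anti he he1 (by nlinarith)
  have ea : aseq (p - 1) (q * (p - 1) - 1) 1 = q * (p - 1) - 1 := by simp [aseq]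
  have ed : Kop fg2 + Rop (NLt q w1) - Kop fg2 = Rop (NLt q w1) := by abel
  have dR : Dk (q * (p - 1) - 1) (c5 * ε ^ q) (Rop (NLt q w1)) :=
    zR2.toDk (by positivity) hk2.le le_rfl
  have p1 := mul_pos c2p he
  have p2 := mul_pos c4p he
  have p3 := mul_pos c5p he
  have eqp : 0 < ε ^ q := by positivity
  have eqp' : 0 < ε ^ ((p - 1) * q) := by positivity
  have m1 := mul_le_mul_of_nonneg_left e1 c5p.le
  have m2 := mul_le_mul_of_nonneg_left e2 c5p.le
  rw [ea]
  refine ⟨rv0, rw1, rv0.add rR, dv0.mono (by linarith), (dv0.add dR rv0 rR).mono (by linarith),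
    zw1.mono (by linarith), ?_, ?_⟩
  · rw [ed]; exact zR2.toZ1.mono (by nlinarith)
  · rw [ed]; exact zR2.mono (by nlinarith)

lemma step {p q : ℝ} (P : Par p q) {n : ℕ} {b C : ℝ} (hC : 0 < C) (hb : q ≤ b)
    (ha : (p - 1) * aseq (p - 1) (q * (p - 1) - 1) (n + 1) < 1) :
    ∃ C' > 0, ∀ ε, 0 < ε → ε ≤ 1 → ∀ v w' v' : ℝ → ℝ → ℝ,
    IterInv p q (aseq (p - 1) (q * (p - 1) - 1) (n + 1)) b C ε v w' v' →
    IterInv p q (aseq (p - 1) (q * (p - 1) - 1) (n + 2)) (b + (p + q - 2)) C' ε v'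
      (w' + Lop (NLt p v' - NLt p v))
      (v' + Rop (NLt q (w' + Lop (NLt p v' - NLt p v)) - NLt q w')) := by
  obtain ⟨hp1, hp2, hq, hk2, hkq⟩ := P
  have hk0 : 0 < p - 1 := by linarith
  have hk1 : p - 1 < 1 := by linarith
  set a := aseq (p - 1) (q * (p - 1) - 1) (n + 1) with had
  set a' := aseq (p - 1) (q * (p - 1) - 1) (n + 2) with had'
  have ha1 : 1 ≤ a := aseq_ge hk0.le hk2.le _
  have ha2 : q * (p - 1) - 1 ≤ a' := aseq_succ_ge hk0.le hk2.le _
  have hb0 : 0 < b := by linarith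
  have hkb : 1 < (p - 1) * b := by nlinarith
  obtain ⟨C1, hC1, H1⟩ := LG (a := a) hp1 hp2 hk2 ha1 ha
  obtain ⟨C2, hC2, H2⟩ := RH (κ := p - 1) (a := a) (ν := a') hq rfl (by linarith)
  set c1 : ℝ := C1 * (2 * (C ^ (p - 1) * C)) with hc1
  have c1p : 0 < c1 := by positivity
  set c2 := C + c1 with hc2
  have c2p : 0 < c2 := by positivity
  set c3 := C2 * (c2 ^ (q - 1) * c1) with hc3
  have c3p : 0 < c3 := by positivity
  refine ⟨C + c2 + c3, by positivity, ?_⟩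
  rintro ε he he1 v w' v' ⟨rv, rw', rv', dv, dv', zw, z1, z2⟩
  have ebk : ε ^ b ≤ ε ^ ((p - 1) * b) := eps_anti he he1 (by nlinarith)
  obtain ⟨rL, y1, y2⟩ := H1 v' v (C * ε) (C * ε ^ b) (C * ε ^ ((p - 1) * b)) (by positivity)
    (by positivity) (by gcongr) rv' rv dv' dv z1 z2
  set L := Lop (NLt p v' - NLt p v) with hL
  have y1' : Z1 ((p - 1) * a) (c1 * ε ^ (p - 1 + b)) L := by
    refine y1.mono ?_
    rw [Real.mul_rpow hC.le he.le, hc1, Real.rpow_add he]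
    have : 0 < C1 * (C ^ (p - 1) * C) * (ε ^ (p - 1) * ε ^ b) := by positivity
    linarith
  have y2' : Z2 ((p - 1) * a) (c1 * ε ^ (p - 1 + (p - 1) * b)) L := by
    refine y2.mono ?_
    rw [Real.mul_rpow hC.le he.le, Real.mul_rpow hC.le (by positivity), ← Real.rpow_mul he.le, hc1,
      Real.rpow_add he, mul_comm b]
    have e1 : ε ≤ ε ^ (p - 1) := by simpa using eps_anti he he1 hk1.le
    have : C1 * (C * C ^ (p - 1)) * (ε * ε ^ ((p - 1) * b)) ≤
      C1 * (C * C ^ (p - 1)) * (ε ^ (p - 1) * ε ^ ((p - 1) * b)) := by gcongr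
    linarith
  have ezz : ε ^ (p - 1 + (p - 1) * b) ≤ ε := eps_le he he1 (by linarith)
  have zL : Z2 (p - 1) (c1 * ε) L :=
    (y2'.weaken (by positivity) (by nlinarith)).mono (by gcongr)
  set w := w' + L with hw
  have rw1 : Reg w := rw'.add rL
  have zw1 : Z2 (p - 1) (c2 * ε) w := (zw.add zL rw' rL).mono (by rw [hc2]; linarith)
  have ed : w - w' = L := by rw [hw]; abel
  have p1 := mul_pos hC he
  have p2 := mul_pos c1p he
  have p4 := mul_pos c3p he
  obtain ⟨rR, x1, x2⟩ := H2 w w' (c2 * ε) (c1 * ε ^ (p - 1 + b)) (c1 * ε ^ (p - 1 + (p - 1) * b))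
    (by positivity) (by positivity) (by
      refine mul_le_mul_of_nonneg_left (eps_anti he he1 ?_) c1p.le
      nlinarith) rw1 rw' zw1 (zw.mono (by rw [hc2]; linarith)) (by rwa [ed]) (by rwa [ed])
  set R := Rop (NLt q w - NLt q w') with hR
  have x1' : Z1 a' (c3 * ε ^ (b + (p + q - 2))) R := by
    intro r t hr ht
    refine (x1 r t hr ht.le).trans (le_of_eq ?_)
    congr 1
    have : b + (p + q - 2) = (q - 1) + (p - 1 + b) := by ring
    rw [Real.mul_rpow c2p.le he.le, hc3, this, Real.rpow_add he (q - 1)]; ring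
  have x2' : Z2 a' (c3 * ε ^ ((p - 1) * (b + (p + q - 2)))) R := by
    intro r t hr ht
    refine (x2 r t hr ht.le).trans (mul_le_mul_of_nonneg_right ?_ (WZ_pos hr ht.le).le)
    have e0 : ε ^ ((q - 1) + (p - 1 + (p - 1) * b)) ≤ ε ^ ((p - 1) * (b + (p + q - 2))) := by
      apply eps_anti he he1
      nlinarith
    calc _ = c3 * ε ^ ((q - 1) + (p - 1 + (p - 1) * b)) := by
          rw [Real.mul_rpow c2p.le he.le, hc3, Real.rpow_add he (q - 1)]; ring
      _ ≤ _ := by gcongr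
  have dR : Dk (q * (p - 1) - 1) (c3 * ε) R := by
    refine (x2'.toDk (by positivity) (by linarith) ha2).mono ?_
    have : ε ^ ((p - 1) * (b + (p + q - 2))) ≤ ε := eps_le he he1 (by nlinarith)
    gcongr
  have p3 := mul_pos c2p he
  have ed2 : v' + R - v' = R := by abel
  refine ⟨rv', rw1, rv'.add rR, dv'.mono (by linarith), (dv'.add dR rv' rR).mono (by linarith),
    zw1.mono (by linarith), ?_, ?_⟩
  · rw [ed2]; refine x1'.mono ?_; gcongr; linarith
  · rw [ed2]; refine x2'.mono ?_; gcongr; linarith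

theorem iter_inv {p q : ℝ} (P : Par p q) (n : ℕ)
    (ha : (p - 1) * aseq (p - 1) (q * (p - 1) - 1) n < 1) :
    ∃ C > 0, ∀ ε, 0 < ε → ε ≤ 1 → ∀ fg1 fg2 : (ℝ → ℝ) × (ℝ → ℝ),
    memY (p - 1) ε fg1 → memY (q * (p - 1) - 1) ε fg2 →
    IterInv p q (aseq (p - 1) (q * (p - 1) - 1) (n + 1)) (q + (n : ℝ) * (p + q - 2)) C ε
      (viter p q fg1 fg2 n) (witer p q fg1 fg2 (n + 1)) (viter p q fg1 fg2 (n + 1)) := by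
  have hk0 : 0 ≤ p - 1 := by linarith [P.hp1]
  induction n with
  | zero =>
    obtain ⟨C, hC, H⟩ := base P
    refine ⟨C, hC, fun ε he he1 fg1 fg2 h1 h2 => ?_⟩
    have := H ε he he1 fg1 fg2 h1 h2
    simpa [viter, witer, iterAux] using this
  | succ n ih =>
    have hm := aseq_le_succ hk0 P.hk2.le n
    obtain ⟨C, hC, H⟩ := ih (lt_of_le_of_lt (mul_le_mul_of_nonneg_left hm hk0) ha)
    have hb : q ≤ q + (n : ℝ) * (p + q - 2) := by
      have := P.hp1; have := P.hq
      have : 0 ≤ (n : ℝ) * (p + q - 2) := mul_nonneg (Nat.cast_nonneg n) (by linarith)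
      linarith
    obtain ⟨C', hC', H'⟩ := step P hC hb ha
    refine ⟨C', hC', fun ε he he1 fg1 fg2 h1 h2 => ?_⟩
    have := H' ε he he1 _ _ _ (H ε he he1 fg1 fg2 h1 h2)
    have e : q + ((n + 1 : ℕ) : ℝ) * (p + q - 2) = q + (n : ℝ) * (p + q - 2) + (p + q - 2) := by
      push_cast; ring
    rw [e]
    exact this

end Iter



section Final

lemma RGd {p q c : ℝ} (P : Par p q) (ℓ : ℕ) (hc : 0 < c)
    (hl : 1 < (p - 1) * aseq (p - 1) (q * (p - 1) - 1) (ℓ + 1)) :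
    ∃ C > 0, ∀ ε u v N₁ N₂, 0 < ε → ε ≤ 1 → 0 ≤ N₁ → N₁ ≤ N₂ → Reg u → Reg v →
      Dk (q * (p - 1) - 1) (c * ε) u → Dk (q * (p - 1) - 1) (c * ε) v →
      Z1 (aseq (p - 1) (q * (p - 1) - 1) (ℓ + 1)) N₁ (u - v) →
      Z2 (aseq (p - 1) (q * (p - 1) - 1) (ℓ + 1)) N₂ (u - v) →
      BddAbove (ZSet 2 ((p - 1) * aseq (p - 1) (q * (p - 1) - 1) (ℓ + 1)) (Rop (NLt p u - NLt p v))) ∧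
      BddAbove (ZSet 1 ((p - 1) * aseq (p - 1) (q * (p - 1) - 1) (ℓ + 1)) (Rop (NLt p u - NLt p v))) ∧
      dOne p q ℓ (Rop (NLt p u - NLt p v)) ≤ C * ε ^ ((p - 1) ^ 2) * (N₂ + N₁ ^ (p - 1)) := by
  obtain ⟨hp1, hp2, hq, hk2, hkq⟩ := P
  have hk0 : 0 < p - 1 := by linarith
  have hk1 : p - 1 < 1 := by linarith
  have ha1 := aseq_ge hk0.le hk2.le (ℓ + 1)
  unfold dOne
  set a := aseq (p - 1) (q * (p - 1) - 1) (ℓ + 1) with had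
  obtain ⟨C, hC, H⟩ := RG hp1 hp2 hk2 ha1 hl
  refine ⟨C * c ^ (p - 1) + C * c + (C * c ^ (p - 1)) ^ (p - 1), by positivity, ?_⟩
  intro ε u v N₁ N₂ he he1 hN₁ hN ru rv du dv z1 z2
  have hN₂ := hN₁.trans hN
  obtain ⟨h1, h2⟩ := H u v (c * ε) N₁ N₂ (by positivity) hN₁ hN ru rv du dv z1 z2
  obtain ⟨B1, n1⟩ := Znorm_le (n := 1) (ν := (p - 1) * a) (u := Rop (NLt p u - NLt p v))
    (N := C * ((c * ε) ^ (p - 1) * N₁)) (fun r t hr ht => by rw [bS1]; exact h1 r t hr ht)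
  obtain ⟨B2, n2⟩ := Znorm_le (n := 2) (ν := (p - 1) * a) (u := Rop (NLt p u - NLt p v))
    (N := C * ((c * ε) ^ (p - 1) * N₂ + (c * ε) * N₁ ^ (p - 1)))
    (fun r t hr ht => by rw [bS2]; exact h2 r t hr ht)
  refine ⟨B2, B1, ?_⟩
  have e1 : ε ^ (p - 1) ≤ ε ^ ((p - 1) ^ 2) := eps_anti he he1 (by nlinarith)
  have e2 : ε ≤ ε ^ ((p - 1) ^ 2) := by
    have := eps_anti he he1 (show (p - 1) ^ 2 ≤ 1 by nlinarith)
    simpa using this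
  have n1' := Real.rpow_le_rpow Znorm_nonneg n1 hk0.le
  have x1 : (C * ((c * ε) ^ (p - 1) * N₁)) ^ (p - 1) =
      (C * c ^ (p - 1)) ^ (p - 1) * (ε ^ ((p - 1) ^ 2) * N₁ ^ (p - 1)) := by
    rw [Real.mul_rpow hc.le he.le, show C * (c ^ (p - 1) * ε ^ (p - 1) * N₁) =
      C * c ^ (p - 1) * (ε ^ (p - 1) * N₁) by ring, Real.mul_rpow (by positivity) (by positivity),
      Real.mul_rpow (by positivity) hN₁, ← Real.rpow_mul he.le, sq]
  rw [x1] at n1'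
  rw [Real.mul_rpow hc.le he.le] at n2
  set K := (C * c ^ (p - 1)) ^ (p - 1)
  have hK : 0 < K := by positivity
  set M := N₁ ^ (p - 1)
  have hM : 0 ≤ M := by positivity
  set E := ε ^ ((p - 1) ^ 2)
  have hE : 0 < E := by positivity
  have hd : 0 < c ^ (p - 1) := by positivity
  set d := c ^ (p - 1)
  have y1 : C * d * (ε ^ (p - 1) * N₂) ≤ C * d * (E * N₂) := by gcongr
  have y2 : C * c * (ε * M) ≤ C * c * (E * M) := by gcongr
  have q1 : 0 ≤ C * d * (E * M) := by positivity
  have q2 : 0 ≤ C * c * (E * N₂) := by positivity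
  have q3 : 0 ≤ K * (E * N₂) := by positivity
  linarith

lemma RHd {p q c : ℝ} (P : Par p q) (ℓ : ℕ) (hc : 0 < c) :
    ∃ C > 0, ∀ ε u v N₁ N₂, 0 < ε → ε ≤ 1 → 0 ≤ N₁ → N₁ ≤ N₂ → Reg u → Reg v →
      Z2 (p - 1) (c * ε) u → Z2 (p - 1) (c * ε) v →
      Z1 ((p - 1) * aseq (p - 1) (q * (p - 1) - 1) (ℓ + 1)) N₁ (u - v) →
      Z2 ((p - 1) * aseq (p - 1) (q * (p - 1) - 1) (ℓ + 1)) N₂ (u - v) →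
      BddAbove (ZSet 2 (aseq (p - 1) (q * (p - 1) - 1) (ℓ + 1)) (Rop (NLt q u - NLt q v))) ∧
      BddAbove (ZSet 1 (aseq (p - 1) (q * (p - 1) - 1) (ℓ + 1)) (Rop (NLt q u - NLt q v))) ∧
      dTwo p q ℓ (Rop (NLt q u - NLt q v)) ≤ C * ε ^ ((p - 1) * (q - 1)) * (N₂ + N₁ ^ (p - 1)) := by
  obtain ⟨hp1, hp2, hq, hk2, hkq⟩ := P
  have hk0 : 0 < p - 1 := by linarith
  have hk1 : p - 1 < 1 := by linarith
  have ha1 := aseq_ge hk0.le hk2.le (ℓ + 1)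
  have hmon := aseq_le_succ hk0.le hk2.le (ℓ + 1)
  have hge := aseq_succ_ge hk0.le hk2.le (ℓ + 1)
  unfold dTwo
  obtain ⟨C, hC, H⟩ := RH (κ := p - 1) (a := aseq (p - 1) (q * (p - 1) - 1) (ℓ + 1))
    (ν := aseq (p - 1) (q * (p - 1) - 1) (ℓ + 1 + 1)) hq rfl (by linarith)
  set a := aseq (p - 1) (q * (p - 1) - 1) (ℓ + 1) with had
  refine ⟨C * c ^ (q - 1) + (C * c ^ (q - 1)) ^ (p - 1), by positivity, ?_⟩
  intro ε u v N₁ N₂ he he1 hN₁ hN ru rv du dv z1 z2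
  have hN₂ := hN₁.trans hN
  obtain ⟨-, h1, h2⟩ := H u v (c * ε) N₁ N₂ (by positivity) hN₁ hN ru rv du dv z1 z2
  obtain ⟨B1, n1⟩ := Znorm_le (n := 1) (ν := a) (u := Rop (NLt q u - NLt q v))
    (N := C * ((c * ε) ^ (q - 1) * N₁)) (fun r t hr ht => by
      rw [bS1]
      exact (h1 r t hr ht).trans (mul_le_mul_of_nonneg_left (WZ_anti hr ht hmon) (by positivity)))
  obtain ⟨B2, n2⟩ := Znorm_le (n := 2) (ν := a) (u := Rop (NLt q u - NLt q v))
    (N := C * ((c * ε) ^ (q - 1) * N₂))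
    (fun r t hr ht => by
      rw [bS2]
      exact (h2 r t hr ht).trans (mul_le_mul_of_nonneg_left (WZ_anti hr ht hmon) (by positivity)))
  refine ⟨B2, B1, ?_⟩
  have e1 : ε ^ (q - 1) ≤ ε ^ ((p - 1) * (q - 1)) := eps_anti he he1 (by nlinarith)
  have n1' := Real.rpow_le_rpow Znorm_nonneg n1 hk0.le
  have x1 : (C * ((c * ε) ^ (q - 1) * N₁)) ^ (p - 1) =
      (C * c ^ (q - 1)) ^ (p - 1) * (ε ^ ((p - 1) * (q - 1)) * N₁ ^ (p - 1)) := by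
    rw [Real.mul_rpow hc.le he.le, show C * (c ^ (q - 1) * ε ^ (q - 1) * N₁) =
      C * c ^ (q - 1) * (ε ^ (q - 1) * N₁) by ring, Real.mul_rpow (by positivity) (by positivity),
      Real.mul_rpow (by positivity) hN₁, ← Real.rpow_mul he.le, mul_comm (q - 1)]
  rw [x1] at n1'
  rw [Real.mul_rpow hc.le he.le] at n2
  set K := (C * c ^ (q - 1)) ^ (p - 1)
  have hK : 0 < K := by positivity
  set M := N₁ ^ (p - 1)
  have hM : 0 ≤ M := by positivity
  set E := ε ^ ((p - 1) * (q - 1))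
  have hE : 0 < E := by positivity
  have hd : 0 < c ^ (q - 1) := by positivity
  set d := c ^ (q - 1)
  have y1 : C * d * (ε ^ (q - 1) * N₂) ≤ C * d * (E * N₂) := by gcongr
  have q1 : 0 ≤ C * d * (E * M) := by positivity
  have q3 : 0 ≤ K * (E * N₂) := by positivity
  linarith

lemma Znorm12 {ν : ℝ} {u : ℝ → ℝ → ℝ} (h : BddAbove (ZSet 2 ν u)) : Znorm 1 ν u ≤ Znorm 2 ν u :=
  (Znorm_le (n := 1) (fun r t hr ht => by
    have := Znorm_bd h hr ht
    rw [bS2] at this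
    rw [bS1]
    exact (bracket1_le_bracket2 hr).trans this)).2

lemma Znorm_Z1 {ν : ℝ} {u : ℝ → ℝ → ℝ} (h : BddAbove (ZSet 1 ν u)) : Z1 ν (Znorm 1 ν u) u :=
  fun r t hr ht => by rw [← bS1]; exact Znorm_bd h hr ht.le

lemma Znorm_Z2 {ν : ℝ} {u : ℝ → ℝ → ℝ} (h : BddAbove (ZSet 2 ν u)) : Z2 ν (Znorm 2 ν u) u :=
  fun r t hr ht => by rw [← bS2]; exact Znorm_bd h hr ht.le

structure DInfo (p q ε b c : ℝ) (ℓ : ℕ) (w v u₁ u₂ : ℝ → ℝ → ℝ) : Prop where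
  r1 : Reg u₁
  r2 : Reg u₂
  B12 : BddAbove (ZSet 2 ((p - 1) * aseq (p - 1) (q * (p - 1) - 1) (ℓ + 1)) (u₁ - w))
  B11 : BddAbove (ZSet 1 ((p - 1) * aseq (p - 1) (q * (p - 1) - 1) (ℓ + 1)) (u₁ - w))
  B22 : BddAbove (ZSet 2 (aseq (p - 1) (q * (p - 1) - 1) (ℓ + 1)) (u₂ - v))
  B21 : BddAbove (ZSet 1 (aseq (p - 1) (q * (p - 1) - 1) (ℓ + 1)) (u₂ - v))
  y12 : Z2 ((p - 1) * aseq (p - 1) (q * (p - 1) - 1) (ℓ + 1)) (ε ^ ((p - 1) * b)) (u₁ - w)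
  y11 : Z1 ((p - 1) * aseq (p - 1) (q * (p - 1) - 1) (ℓ + 1)) (ε ^ b) (u₁ - w)
  y22 : Z2 (aseq (p - 1) (q * (p - 1) - 1) (ℓ + 1)) (ε ^ ((p - 1) * b)) (u₂ - v)
  y21 : Z1 (aseq (p - 1) (q * (p - 1) - 1) (ℓ + 1)) (ε ^ b) (u₂ - v)
  z1 : Z2 (p - 1) (c * ε) u₁
  d2 : Dk (q * (p - 1) - 1) (c * ε) u₂

lemma dinfo {p q ε C : ℝ} (P : Par p q) {ℓ : ℕ} {fg1 fg2 : (ℝ → ℝ) × (ℝ → ℝ)} {u₁ u₂ : ℝ → ℝ → ℝ}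
    (he : 0 < ε) (he1 : ε ≤ 1)
    (I : IterInv p q (aseq (p - 1) (q * (p - 1) - 1) (ℓ + 1)) (q + (ℓ : ℝ) * (p + q - 2)) C ε
      (viter p q fg1 fg2 ℓ) (witer p q fg1 fg2 (ℓ + 1)) (viter p q fg1 fg2 (ℓ + 1)))
    (hD : memD p q ε ℓ fg1 fg2 u₁ u₂) :
    DInfo p q ε (q + (ℓ : ℝ) * (p + q - 2)) (C + 1) ℓ (witer p q fg1 fg2 (ℓ + 1))
      (viter p q fg1 fg2 (ℓ + 1)) u₁ u₂ := by
  obtain ⟨hp1, hp2, hq, hk2, hkq⟩ := P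
  have hk0 : 0 < p - 1 := by linarith
  obtain ⟨m1, m2, B12, B11, B22, B21, hd⟩ := hD
  have ha1 := aseq_ge hk0.le hk2.le (ℓ + 1)
  have hge := aseq_succ_ge hk0.le hk2.le ℓ
  unfold dOne dTwo at hd
  have hb : q ≤ q + (ℓ : ℝ) * (p + q - 2) := by
    have : 0 ≤ (ℓ : ℝ) * (p + q - 2) := mul_nonneg (Nat.cast_nonneg ℓ) (by linarith)
    linarith
  set b := q + (ℓ : ℝ) * (p + q - 2) with hbd
  set a := aseq (p - 1) (q * (p - 1) - 1) (ℓ + 1) with had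
  set w := witer p q fg1 fg2 (ℓ + 1)
  set v := viter p q fg1 fg2 (ℓ + 1)
  have k1 : 0 ≤ Znorm 2 ((p - 1) * a) (u₁ - w) := Znorm_nonneg
  have k2 : 0 ≤ Znorm 1 ((p - 1) * a) (u₁ - w) := Znorm_nonneg
  have k3 : 0 ≤ Znorm 2 a (u₂ - v) := Znorm_nonneg
  have k4 : 0 ≤ Znorm 1 a (u₂ - v) := Znorm_nonneg
  have k2' : 0 ≤ Znorm 1 ((p - 1) * a) (u₁ - w) ^ (p - 1) := by positivity
  have k4' : 0 ≤ Znorm 1 a (u₂ - v) ^ (p - 1) := by positivity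
  have root : ∀ x : ℝ, 0 ≤ x → x ^ (p - 1) ≤ ε ^ ((p - 1) * b) → x ≤ ε ^ b := by
    intro x hx h
    rw [mul_comm, Real.rpow_mul he.le] at h
    exact (Real.rpow_le_rpow_iff hx (by positivity) hk0).1 h
  have r1 := m1.reg
  have r2 := m2.reg
  have y12 := (Znorm_Z2 B12).mono (by linarith : _ ≤ ε ^ ((p - 1) * b))
  have y22 := (Znorm_Z2 B22).mono (by linarith : _ ≤ ε ^ ((p - 1) * b))
  have ee : ε ^ ((p - 1) * b) ≤ ε := eps_le he he1 (by nlinarith)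
  refine ⟨r1, r2, B12, B11, B22, B21, y12, (Znorm_Z1 B11).mono (root _ k2 (by linarith)), y22,
    (Znorm_Z1 B21).mono (root _ k4 (by linarith)), ?_, ?_⟩
  · have e : u₁ = w + (u₁ - w) := by abel
    rw [e]
    refine (I.zw.add (y12.weaken (by positivity) (by nlinarith)) I.rw' (r1.sub I.rw')).mono ?_
    linarith
  · have e : u₂ = v + (u₂ - v) := by abel
    rw [e]
    refine (I.dv'.add (y22.toDk (by positivity) ha1 hge) I.rv' (r2.sub I.rv')).mono ?_
    linarith

end Final



/-- **Corollary 4.8.** Under the assumptions of Theorem 2.4, with `0 < ε ≤ 1` and the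
maps `T⁽¹⁾(u₂) = w_{ℓ+1} + R(G(u₂, v_ℓ))`, `T⁽²⁾(u₁) = v_{ℓ+1} + R(H(u₁, w_{ℓ+1}))`:
for `(u₁,u₂), (u₁^*,u₂^*) ∈ D_ε` one has
`d₁(T⁽¹⁾(u₂), w_{ℓ+1}) ≤ C ε^{(p-1)b_ℓ+(p-1)²}`,
`d₂(T⁽²⁾(u₁), v_{ℓ+1}) ≤ C ε^{(p-1)b_ℓ+(p-1)(q-1)}`,
`d₁(T⁽¹⁾(u₂), T⁽¹⁾(u₂^*)) ≤ C ε^{(p-1)²} d₂(u₂,u₂^*)` and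
`d₂(T⁽²⁾(u₁), T⁽²⁾(u₁^*)) ≤ C ε^{(p-1)(q-1)} d₁(u₁,u₁^*)`. -/
theorem stmt18 (p q : ℝ) (hp1 : 1 < p) (hp2 : p < 2) (hpq : p ≤ q)
    (hcond : (p - 1) ^ 2 * (q - 1) > 1) (ℓ : ℕ)
    (hl1 : 1 / (p - 1) < aseq (p - 1) (q * (p - 1) - 1) (ℓ + 1))
    (hl2 : aseq (p - 1) (q * (p - 1) - 1) ℓ ≤ 1 / (p - 1))
    (hl3 : (p - 1) * aseq (p - 1) (q * (p - 1) - 1) ℓ < 1) :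
    ∃ C > 0, ∀ ε : ℝ, 0 < ε → ε ≤ 1 →
      ∀ fg1 fg2 : (ℝ → ℝ) × (ℝ → ℝ),
        memY (p - 1) ε fg1 → memY (q * (p - 1) - 1) ε fg2 →
      ∀ u₁ u₂ u₁' u₂' : ℝ → ℝ → ℝ,
        memD p q ε ℓ fg1 fg2 u₁ u₂ → memD p q ε ℓ fg1 fg2 u₁' u₂' →
        (BddAbove (ZSet 2 ((p - 1) * aseq (p - 1) (q * (p - 1) - 1) (ℓ + 1))
            (Rop (NLt p u₂ - NLt p (viter p q fg1 fg2 ℓ)))) ∧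
          BddAbove (ZSet 1 ((p - 1) * aseq (p - 1) (q * (p - 1) - 1) (ℓ + 1))
            (Rop (NLt p u₂ - NLt p (viter p q fg1 fg2 ℓ)))) ∧
          dOne p q ℓ (Rop (NLt p u₂ - NLt p (viter p q fg1 fg2 ℓ))) ≤
            C * ε ^ ((p - 1) * (q + (ℓ : ℝ) * (p + q - 2)) + (p - 1) ^ 2)) ∧
        (BddAbove (ZSet 2 (aseq (p - 1) (q * (p - 1) - 1) (ℓ + 1))
            (Rop (NLt q u₁ - NLt q (witer p q fg1 fg2 (ℓ + 1))))) ∧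
          BddAbove (ZSet 1 (aseq (p - 1) (q * (p - 1) - 1) (ℓ + 1))
            (Rop (NLt q u₁ - NLt q (witer p q fg1 fg2 (ℓ + 1))))) ∧
          dTwo p q ℓ (Rop (NLt q u₁ - NLt q (witer p q fg1 fg2 (ℓ + 1)))) ≤
            C * ε ^ ((p - 1) * (q + (ℓ : ℝ) * (p + q - 2)) + (p - 1) * (q - 1))) ∧
        (BddAbove (ZSet 2 ((p - 1) * aseq (p - 1) (q * (p - 1) - 1) (ℓ + 1))
            (Rop (NLt p u₂ - NLt p u₂'))) ∧
          BddAbove (ZSet 1 ((p - 1) * aseq (p - 1) (q * (p - 1) - 1) (ℓ + 1))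
            (Rop (NLt p u₂ - NLt p u₂'))) ∧
          dOne p q ℓ (Rop (NLt p u₂ - NLt p u₂')) ≤
            C * ε ^ ((p - 1) ^ 2) * dTwo p q ℓ (u₂ - u₂')) ∧
        (BddAbove (ZSet 2 (aseq (p - 1) (q * (p - 1) - 1) (ℓ + 1))
            (Rop (NLt q u₁ - NLt q u₁'))) ∧
          BddAbove (ZSet 1 (aseq (p - 1) (q * (p - 1) - 1) (ℓ + 1))
            (Rop (NLt q u₁ - NLt q u₁'))) ∧
          dTwo p q ℓ (Rop (NLt q u₁ - NLt q u₁')) ≤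
            C * ε ^ ((p - 1) * (q - 1)) * dOne p q ℓ (u₁ - u₁')) := by
  have P : Par p q := par_of hp1 hp2 hcond
  have hk0 : 0 < p - 1 := by linarith
  have hl : 1 < (p - 1) * aseq (p - 1) (q * (p - 1) - 1) (ℓ + 1) := by
    rw [div_lt_iff₀ hk0] at hl1
    linarith
  obtain ⟨C₀, hC₀, H₀⟩ := iter_inv P ℓ hl3
  have hc : 0 < C₀ + 1 := by linarith
  obtain ⟨C₁, hC₁, H₁⟩ := RGd P ℓ hc hl
  obtain ⟨C₂, hC₂, H₂⟩ := RHd P ℓ hc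
  set K : ℝ := (C₀ + 1) + (C₀ + 1) ^ (p - 1) with hK
  have hKp : 0 < K := by positivity
  have hK1 : 1 ≤ K := by
    have : 0 < (C₀ + 1) ^ (p - 1) := by positivity
    linarith
  refine ⟨(C₁ + C₂) * (K + 1), by positivity, ?_⟩
  intro ε he he1 fg1 fg2 hY1 hY2 u₁ u₂ u₁' u₂' hD hD'
  have I := H₀ ε he he1 fg1 fg2 hY1 hY2
  have D := dinfo P he he1 I hD
  have D' := dinfo P he he1 I hD'
  clear hD hD' hY1 hY2 H₀
  have hb0 : 0 ≤ q + (ℓ : ℝ) * (p + q - 2) := by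
    have := P.hq
    have : 0 ≤ (ℓ : ℝ) * (p + q - 2) := mul_nonneg (Nat.cast_nonneg ℓ) (by linarith)
    linarith
  set b := q + (ℓ : ℝ) * (p + q - 2) with hbd
  have ebk : ε ^ b ≤ ε ^ ((p - 1) * b) := eps_anti he he1 (by nlinarith)
  have ebm : (ε ^ b) ^ (p - 1) = ε ^ ((p - 1) * b) := by rw [← Real.rpow_mul he.le, mul_comm]
  have dvl := I.dv.mono (by nlinarith : C₀ * ε ≤ (C₀ + 1) * ε)
  have zwl := I.zw.mono (by nlinarith : C₀ * ε ≤ (C₀ + 1) * ε)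
  have hEb : 0 < ε ^ ((p - 1) * b) := by positivity
  refine ⟨?_, ?_, ?_, ?_⟩
  · have e : u₂ - viter p q fg1 fg2 ℓ = (u₂ - viter p q fg1 fg2 (ℓ + 1)) +
        (viter p q fg1 fg2 (ℓ + 1) - viter p q fg1 fg2 ℓ) := by abel
    have s1 := (D.y21.add I.z1 (D.r2.sub I.rv') (I.rv'.sub I.rv)).mono
      (by linarith : _ ≤ (C₀ + 1) * ε ^ b)
    have s2 := (D.y22.add I.z2 (D.r2.sub I.rv') (I.rv'.sub I.rv)).mono
      (by linarith : _ ≤ (C₀ + 1) * ε ^ ((p - 1) * b))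
    rw [← e] at s1 s2
    obtain ⟨B2, B1, hd⟩ := H₁ ε u₂ (viter p q fg1 fg2 ℓ) ((C₀ + 1) * ε ^ b)
      ((C₀ + 1) * ε ^ ((p - 1) * b)) he he1 (by positivity) (by gcongr) D.r2 I.rv D.d2 dvl s1 s2
    refine ⟨B2, B1, hd.trans ?_⟩
    rw [Real.mul_rpow hc.le (by positivity), ebm, ← add_mul, ← hK, add_comm ((p - 1) * b),
      Real.rpow_add he]
    have : C₁ * K ≤ (C₁ + C₂) * (K + 1) := by nlinarith
    calc _ = (C₁ * K) * (ε ^ ((p - 1) ^ 2) * ε ^ ((p - 1) * b)) := by ring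
      _ ≤ _ := by gcongr
  · obtain ⟨B2, B1, hd⟩ := H₂ ε u₁ (witer p q fg1 fg2 (ℓ + 1)) (ε ^ b)
      (ε ^ ((p - 1) * b)) he he1 (by positivity) ebk D.r1 I.rw' D.z1 zwl D.y11 D.y12
    refine ⟨B2, B1, hd.trans ?_⟩
    rw [ebm, add_comm ((p - 1) * b), Real.rpow_add he]
    have : C₂ * 2 ≤ (C₁ + C₂) * (K + 1) := by nlinarith
    calc _ = (C₂ * 2) * (ε ^ ((p - 1) * (q - 1)) * ε ^ ((p - 1) * b)) := by ring
      _ ≤ _ := by gcongr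
  · have A2 := ZSet_sub2 D.r2 D'.r2 I.rv' D.B22 D'.B22
    have A1 := ZSet_sub1 D.r2 D'.r2 I.rv' D.B21 D'.B21
    obtain ⟨B2, B1, hd⟩ := H₁ ε u₂ u₂' _ _ he he1 Znorm_nonneg (Znorm12 A2) D.r2 D'.r2 D.d2 D'.d2
      (Znorm_Z1 A1) (Znorm_Z2 A2)
    refine ⟨B2, B1, hd.trans ?_⟩
    have n0 : 0 ≤ dTwo p q ℓ (u₂ - u₂') :=
      add_nonneg Znorm_nonneg (Real.rpow_nonneg Znorm_nonneg _)
    have : C₁ ≤ (C₁ + C₂) * (K + 1) := by nlinarith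
    change C₁ * ε ^ ((p - 1) ^ 2) * dTwo p q ℓ (u₂ - u₂') ≤ _
    gcongr
  · have A2 := ZSet_sub2 D.r1 D'.r1 I.rw' D.B12 D'.B12
    have A1 := ZSet_sub1 D.r1 D'.r1 I.rw' D.B11 D'.B11
    obtain ⟨B2, B1, hd⟩ := H₂ ε u₁ u₁' _ _ he he1 Znorm_nonneg (Znorm12 A2) D.r1 D'.r1 D.z1 D'.z1
      (Znorm_Z1 A1) (Znorm_Z2 A2)
    refine ⟨B2, B1, hd.trans ?_⟩
    have n0 : 0 ≤ dOne p q ℓ (u₁ - u₁') :=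
      add_nonneg Znorm_nonneg (Real.rpow_nonneg Znorm_nonneg _)
    have : C₂ ≤ (C₁ + C₂) * (K + 1) := by nlinarith
    change C₂ * ε ^ ((p - 1) * (q - 1)) * dOne p q ℓ (u₁ - u₁') ≤ _
    gcongr
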